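/- Let n ≤ 7 be a positive integer and let D ⊆ 2^[n] be a down set with ∅ ∈ D and nonempty complement U = 2^[n] \ D. Then sdepth(U) > sdepth(D). (This is the combinatorial statement, via Herzog–Vladoiu–Zheng, of the paper's main theorem: if K is a field, n ≤ 7, and I is a squarefree monomial ideal of S = K[x₁,…,x_n], then sdepth I > sdepth S/I.) -/

import Mathlib

open Finset

/-- An interval partition of a family `Q` of subsets of `[n]` (identified with `Fin n`):
a finite collection of nonempty intervals `[A,B]`, each contained in `Q`, pairwise
disjoint, and covering `Q`. -/
structure IntervalPartition (n : ℕ) (Q : Finset (Finset (Fin n))) where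
  pairs : Finset (Finset (Fin n) × Finset (Fin n))
  le : ∀ p ∈ pairs, p.1 ⊆ p.2
  sub : ∀ p ∈ pairs, Finset.Icc p.1 p.2 ⊆ Q
  disj : ∀ p ∈ pairs, ∀ q ∈ pairs, p ≠ q →
    Disjoint (Finset.Icc p.1 p.2) (Finset.Icc q.1 q.2)
  covers : ∀ C ∈ Q, ∃ p ∈ pairs, C ∈ Finset.Icc p.1 p.2

/-- The Stanley depth of a family `Q`: the largest `k` such that some interval
partition of `Q` has every interval's maximal element of size at least `k`. -/
noncomputable def sdepth {n : ℕ} (Q : Finset (Finset (Fin n))) : ℕ :=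
  sSup {k | ∃ P : IntervalPartition n Q, ∀ p ∈ P.pairs, k ≤ p.2.card}

/-- `D` is a down set in `2^[n]`. -/
def IsDownSet {n : ℕ} (D : Finset (Finset (Fin n))) : Prop :=
  ∀ B ∈ D, ∀ A, A ⊆ B → A ∈ D

/-- `B` is a maximal element of the family `D`. -/
def MaxElt {n : ℕ} (D : Finset (Finset (Fin n))) (B : Finset (Fin n)) : Prop :=
  B ∈ D ∧ ∀ C ∈ D, B ⊆ C → B = C

/-- The subset of `Fin 7` whose indicator is the binary expansion of `m`. -/
def bitset (m : ℕ) : Finset (Fin 7) := univ.filter fun i => m.testBit i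

/-- The natural number whose binary expansion is the indicator of `s`. -/
def mask (s : Finset (Fin 7)) : ℕ := ∑ i ∈ s, 2 ^ (i : ℕ)

/-- The number of elements of `bitset m`. -/
def weight (m : ℕ) : ℕ := (List.range 7).countP m.testBit

theorem mem_bitset {m : ℕ} {i : Fin 7} : i ∈ bitset m ↔ m.testBit i = true := by
  simp [bitset]

theorem mask_lt_and_bitset_mask : ∀ s : Finset (Fin 7), mask s < 128 ∧ bitset (mask s) = s := by
  decide +kernel

theorem bitset_mask (s : Finset (Fin 7)) : bitset (mask s) = s := (mask_lt_and_bitset_mask s).2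

theorem mask_lt (s : Finset (Fin 7)) : mask s < 128 := (mask_lt_and_bitset_mask s).1

theorem testBit_of_lt {m j : ℕ} (hm : m < 128) (hj : 7 ≤ j) : m.testBit j = false :=
  Nat.testBit_lt_two_pow
    (hm.trans_le (by simpa using Nat.pow_le_pow_right (n := 2) (by norm_num) hj))

theorem bitset_subset {m k : ℕ} (hm : m < 128) : bitset m ⊆ bitset k ↔ m &&& k = m := by
  constructor
  · intro h
    apply Nat.eq_of_testBit_eq
    intro j
    rw [Nat.testBit_and]
    by_cases hj : j < 7
    · have := @h ⟨j, hj⟩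
      simp only [mem_bitset] at this
      cases h1 : m.testBit j <;> simp_all
    · simp [testBit_of_lt hm (not_lt.1 hj)]
  · intro h i hi
    rw [mem_bitset] at hi ⊢
    rw [← h, Nat.testBit_and] at hi
    simp_all

theorem bitset_injOn {m k : ℕ} (hm : m < 128) (hk : k < 128) (h : bitset m = bitset k) :
    m = k := by
  have h1 := (bitset_subset (k := k) hm).1 h.le
  have h2 := (bitset_subset (k := m) hk).1 h.ge
  rw [← h1, Nat.land_comm, h2]

theorem mask_bitset {m : ℕ} (hm : m < 128) : mask (bitset m) = m :=
  bitset_injOn (mask_lt _) hm (bitset_mask _)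

theorem card_bitset (m : ℕ) : (bitset m).card = weight m := by
  simp only [bitset, weight, Finset.card_filter, Fin.sum_univ_seven]
  simp [List.range_succ, List.countP_cons]
  ring_nf

/-- The number whose bits, starting from the lowest, are the values of `P` along `l`. -/
def codeOf (P : ℕ → Bool) (l : List ℕ) : ℕ := List.rec 0 (fun t _ r => Nat.bit (P t) r) l

theorem codeOf_cons (P : ℕ → Bool) (t : ℕ) (l : List ℕ) :
    codeOf P (t :: l) = Nat.bit (P t) (codeOf P l) := rfl

theorem testBit_codeOf (P : ℕ → Bool) (l : List ℕ) (i : ℕ) :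
    (codeOf P l).testBit i = (l[i]?.map P).getD false := by
  induction l generalizing i with
  | nil => simp [codeOf]
  | cons t l ih =>
    rw [codeOf_cons]
    cases i with
    | zero => simp
    | succ i => simp [Nat.testBit_bit_succ, ih]

theorem codeOf_lt (P : ℕ → Bool) (l : List ℕ) : codeOf P l < 2 ^ l.length := by
  apply Nat.lt_pow_two_of_testBit
  intro i hi
  rw [testBit_codeOf, List.getElem?_eq_none (by omega)]
  rfl

theorem land_codeOf (P Q : ℕ → Bool) (l : List ℕ) :
    codeOf P l &&& codeOf Q l = codeOf (fun t => P t && Q t) l := by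
  apply Nat.eq_of_testBit_eq
  intro i
  simp only [Nat.testBit_and, testBit_codeOf]
  cases l[i]? <;> simp

theorem codeOf_inj {P Q : ℕ → Bool} {l : List ℕ} :
    codeOf P l = codeOf Q l ↔ ∀ t ∈ l, P t = Q t := by
  induction l with
  | nil => simp [codeOf]
  | cons t l ih =>
    rw [codeOf_cons, codeOf_cons, List.forall_mem_cons, ← ih]
    constructor
    · intro h
      have h0 := congrArg (fun x => Nat.testBit x 0) h
      simp only [Nat.testBit_bit_zero] at h0
      have h1 := congrArg (fun x => x / 2) h
      simp only [Nat.bit_div_two] at h1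
      exact ⟨h0, h1⟩
    · rintro ⟨h0, h1⟩
      rw [h0, h1]

/-- The code of the members of `l` whose bits are among those of `s`. -/
def faceCode (l : List ℕ) (s : ℕ) : ℕ := codeOf (fun t => Nat.beq (Nat.land t s) t) l

theorem land_faceCode_iff {P : ℕ → Bool} {l : List ℕ} {s : ℕ} :
    codeOf P l &&& faceCode l s = faceCode l s ↔ ∀ t ∈ l, t &&& s = t → P t = true := by
  rw [faceCode, land_codeOf, codeOf_inj]
  refine forall₂_congr fun t _ => ?_
  change (P t && Nat.beq (t &&& s) t) = Nat.beq (t &&& s) t ↔ _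
  rw [Bool.and_eq_right_iff_imp, Nat.beq_eq]

/-- The number obtained from `x` by clearing its `k` lowest bits. -/
def clearLow (k x : ℕ) : ℕ := 2 ^ k * (x / 2 ^ k)

theorem testBit_clearLow (k x i : ℕ) :
    (clearLow k x).testBit i = (decide (k ≤ i) && x.testBit i) := by
  rw [clearLow, Nat.testBit_two_pow_mul]
  by_cases h : k ≤ i
  · simp [h, Nat.testBit_div_two_pow, Nat.sub_add_cancel h]
  · simp [h]

theorem clearLow_le (k x : ℕ) : clearLow k x ≤ x := Nat.mul_div_le x (2 ^ k)

theorem clearLow_zero (x : ℕ) : clearLow 0 x = x := by simp [clearLow]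

theorem clearLow_cases (k x : ℕ) :
    clearLow k x = clearLow (k + 1) x ∨ clearLow k x = Nat.add (clearLow (k + 1) x) (2 ^ k) := by
  have h : clearLow (k + 1) x = 2 ^ k * (2 * (x / 2 ^ k / 2)) := by
    rw [clearLow, pow_succ, ← Nat.div_div_eq_div_mul, mul_assoc]
  rw [h, Nat.add_eq, ← Nat.mul_succ, clearLow]
  rcases Nat.mod_two_eq_zero_or_one (x / 2 ^ k) with h2 | h2
  · left
    congr 1
    omega
  · right
    congr 1
    omega

theorem land_clearLow {k s : ℕ} (h : 2 ^ k ∣ s) (x : ℕ) : clearLow k x &&& s = x &&& s := by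
  obtain ⟨r, rfl⟩ := h
  apply Nat.eq_of_testBit_eq
  intro i
  simp only [Nat.testBit_and, testBit_clearLow, Nat.testBit_two_pow_mul]
  by_cases h : k ≤ i <;> simp [h]

/-- `l` lists the masks of the subsets of `Fin 7` with `c + 1` elements. -/
def Enumerates (c : ℕ) (l : List ℕ) : Prop :=
  l.Perm ((List.range 128).filter fun m => weight m = c + 1)

instance (c : ℕ) (l : List ℕ) : Decidable (Enumerates c l) :=
  inferInstanceAs (Decidable (l.Perm _))

theorem Enumerates.mem_iff {c : ℕ} {l : List ℕ} (h : Enumerates c l) {m : ℕ} :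
    m ∈ l ↔ m < 128 ∧ (bitset m).card = c + 1 := by
  rw [List.Perm.mem_iff h, card_bitset]
  simp

/-- All subsets of `s` with `c + 1` elements belong to the family `H`. -/
def Face (c : ℕ) (H : Finset (Fin 7) → Bool) (s : Finset (Fin 7)) : Prop :=
  ∀ t, t ⊆ s → t.card = c + 1 → H t = true

instance (c : ℕ) (H : Finset (Fin 7) → Bool) : DecidablePred (Face c H) :=
  fun s => inferInstanceAs (Decidable (∀ t, t ⊆ s → t.card = c + 1 → H t = true))

/-- The code of a family with respect to a list of masks. -/
def code (l : List ℕ) (H : Finset (Fin 7) → Bool) : ℕ := codeOf (fun m => H (bitset m)) l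

theorem face_bitset_iff {c : ℕ} {l : List ℕ} (hl : Enumerates c l) {H : Finset (Fin 7) → Bool}
    (m : ℕ) : Face c H (bitset m) ↔ code l H &&& faceCode l m = faceCode l m := by
  rw [code, land_faceCode_iff]
  constructor
  · intro h t ht hm
    obtain ⟨h1, h2⟩ := hl.mem_iff.1 ht
    exact h _ ((bitset_subset h1).2 hm) h2
  · intro h t ht hc
    have h1 := h (mask t) (hl.mem_iff.2 ⟨mask_lt t, by rwa [bitset_mask]⟩)
      ((bitset_subset (mask_lt t)).1 (by rwa [bitset_mask]))
    rwa [bitset_mask] at h1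

/-- The combinatorial properties of the family `H` that the exhaustive search relies on. -/
structure Good (c : ℕ) (H : Finset (Fin 7) → Bool) : Prop where
  card_odd_le : ∀ W : Finset (Fin 7), W.Nonempty →
    #{s | s ⊆ W ∧ Face c H s ∧ c + 1 ≤ #s ∧ #s % 2 = (c + 1) % 2} ≤
      (#W - 1).choose c + #{s | s ⊆ W ∧ Face c H s ∧ c + 1 ≤ #s ∧ #s % 2 = c % 2}
  weighted : ∀ W : Finset (Fin 7), 2 ≤ #W →
    ∑ s with s ⊆ W ∧ Face c H s ∧ c + 1 ≤ #s ∧ #s % 2 = c % 2, (#s - c - 1) ≤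
      (#W - 2).choose c +
        ∑ s with s ⊆ W ∧ Face c H s ∧ c + 1 ≤ #s ∧ #s % 2 = (c + 1) % 2, (#s - c - 1)
  no_core : ∀ X Y : Finset (Fin 7), #X = c → X ⊆ Y → X ≠ Y → Face c H Y →
    ¬ ∀ z ∉ X, H (insert z X) = true ↔ z ∈ Y

/-- The largest elements of all intervals are faces, and the intervals partition the faces
with more than `c` elements. -/
def Sol (c : ℕ) (H : Finset (Fin 7) → Bool) : Prop :=
  ∃ P : Finset (Finset (Fin 7) × Finset (Fin 7)),
    (∀ p ∈ P, p.1 ⊆ p.2 ∧ #p.1 ≤ c ∧ c + 1 ≤ #p.2 ∧ Face c H p.2) ∧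
    (∀ p ∈ P, ∀ q ∈ P, p ≠ q → ∀ s, p.1 ⊆ s → s ⊆ p.2 → q.1 ⊆ s → s ⊆ q.2 → False) ∧
    ∀ s, Face c H s → c + 1 ≤ #s → ∃ p ∈ P, p.1 ⊆ s ∧ s ⊆ p.2

/-- A test accepts the truncated code of every family satisfying `A`. -/
def Accepts (A : (Finset (Fin 7) → Bool) → Prop) (l : List ℕ) (k : ℕ) (t : ℕ → Bool) : Prop :=
  ∀ H, A H → t (clearLow k (code l H)) = true

/-- Acceptance of a truncated code certifies `B` for the families satisfying `A`. -/
def Certifies (A B : (Finset (Fin 7) → Bool) → Prop) (l : List ℕ) (k : ℕ) (f : ℕ → Bool) : Prop :=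
  ∀ H, A H → f (clearLow k (code l H)) = true → B H

/-- Lazy conjunction. -/
def both (t u : ℕ → Bool) (m : ℕ) : Bool := Bool.rec false (u m) (t m)

theorem Accepts.both {A : (Finset (Fin 7) → Bool) → Prop} {l : List ℕ} {k : ℕ} {t u : ℕ → Bool}
    (ht : Accepts A l k t) (hu : Accepts A l k u) : Accepts A l k (both t u) := by
  intro H hH
  simp [_root_.both, ht H hH, hu H hH]

/-- Decide the bit with value `b`, discarding the codes that the test `t` rejects. -/
def branch (b : ℕ) (t f : ℕ → Bool) (m : ℕ) : Bool :=
  Bool.rec false (Bool.rec true (f (Nat.add m b)) (t (Nat.add m b))) (Bool.rec true (f m) (t m))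

theorem Certifies.branch {A B : (Finset (Fin 7) → Bool) → Prop} {l : List ℕ} {k : ℕ}
    {t f : ℕ → Bool} (hf : Certifies A B l k f) (ht : Accepts A l k t) :
    Certifies A B l (k + 1) (branch (2 ^ k) t f) := by
  intro H hH h
  have h1 := ht H hH
  apply hf H hH
  rcases clearLow_cases k (code l H) with h2 | h2
  · rw [h2] at h1 ⊢
    unfold _root_.branch at h
    rw [h1] at h
    revert h
    cases f (clearLow (k + 1) (code l H)) <;> simp
  · rw [h2] at h1 ⊢
    unfold _root_.branch at h
    rw [h1] at h
    revert h
    cases f (Nat.add (clearLow (k + 1) (code l H)) (2 ^ k)) <;>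
      cases (Bool.rec true (f (clearLow (k + 1) (code l H)))
        (t (clearLow (k + 1) (code l H))) : Bool) <;> simp

theorem land_eq_of_clearLow {k x m : ℕ} (h : clearLow k x &&& m = m) : x &&& m = m := by
  apply Nat.eq_of_testBit_eq
  intro i
  have := congrArg (fun y => Nat.testBit y i) h
  simp only [Nat.testBit_and, testBit_clearLow] at this ⊢
  cases h1 : m.testBit i <;> simp_all

/-- Look up the bits of `G` selected by `s` in a table `B` of face codes, hashed modulo `p`, and
check that `G` does not contain the face found there. -/
def pairTest (s p B G : ℕ) : Bool :=
  (fun m => Bool.rec true false (Nat.beq (Nat.land G m) m))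
    (Nat.mod (Nat.shiftRight B (Nat.mul 36 (Nat.mod (Nat.land G s) p))) 68719476736)

/-- The table `B` lists the face codes of the sets `Y` that would complete `X` to a core. -/
def pairTable (l : List ℕ) (X s p B k : ℕ) : Bool :=
  X < 128 && s == codeOf (fun t => Nat.beq (Nat.land X t) X) l && s % 2 ^ k == 0 &&
  (List.range 128).all fun Y => !Nat.beq (Nat.land X Y) X ||
    (fun e => Nat.ble 34359738368 e || !Nat.beq Y X && Nat.beq e (faceCode l Y))
      (Nat.mod (Nat.shiftRight B (Nat.mul 36 (Nat.mod
        (codeOf (fun t => Nat.beq (Nat.land X t) X && Nat.beq (Nat.land t Y) t) l) p))) 68719476736)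

theorem Good.pairTest {c : ℕ} {l : List ℕ} {H : Finset (Fin 7) → Bool} (hH : Good c H)
    (hl : Enumerates c l) (hlen : l.length ≤ 35) {X s p B k : ℕ} (hX : weight X = c)
    (hB : pairTable l X s p B k = true) : pairTest s p B (clearLow k (code l H)) = true := by
  simp only [pairTable, Bool.and_eq_true, decide_eq_true_eq, beq_iff_eq, List.all_eq_true,
    List.mem_range] at hB
  obtain ⟨⟨⟨hX', hs⟩, hk⟩, hB⟩ := hB
  set Y : Finset (Fin 7) := bitset X ∪ univ.filter fun z => H (insert z (bitset X)) = true with hY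
  have hXY : X &&& mask Y = X := by
    rw [← bitset_subset hX', bitset_mask]
    exact subset_union_left
  have hB := hB (mask Y) (mask_lt Y)
  have hland : clearLow k (code l H) &&& s =
      codeOf (fun t => Nat.beq (Nat.land X t) X && Nat.beq (Nat.land t (mask Y)) t) l := by
    rw [land_clearLow (Nat.dvd_of_mod_eq_zero hk), hs, code, land_codeOf, codeOf_inj]
    intro t ht
    obtain ⟨ht', htc⟩ := hl.mem_iff.1 ht
    rw [Bool.and_comm]
    by_cases hXt : X &&& t = X
    · have h1 : Nat.beq (Nat.land X t) X = true := by rw [Nat.beq_eq]; exact hXt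
      rw [h1, Bool.true_and, Bool.true_and]
      rw [← bitset_subset hX'] at hXt
      obtain ⟨z, hz, hzt⟩ : ∃ z ∉ bitset X, insert z (bitset X) = bitset t := by
        have : (bitset X).card + 1 = (bitset t).card := by rw [htc, card_bitset, hX]
        obtain ⟨z, hz⟩ := Finset.card_eq_one.1
          (show (bitset t \ bitset X).card = 1 by rw [card_sdiff_of_subset hXt]; omega)
        refine ⟨z, (mem_sdiff.1 (hz ▸ mem_singleton_self z)).2, ?_⟩
        rw [insert_eq, ← hz, sdiff_union_of_subset hXt]
      rw [Bool.eq_iff_iff, Nat.beq_eq]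
      change _ ↔ t &&& mask Y = t
      rw [← bitset_subset ht', bitset_mask, ← hzt, insert_subset_iff]
      simp [hY, hz]
    · have h1 : Nat.beq (Nat.land X t) X = false := by
        rw [Bool.eq_false_iff, Ne, Nat.beq_eq]; exact hXt
      rw [h1]; rfl
  rw [← hland] at hB
  unfold _root_.pairTest
  change (!Nat.beq (X &&& mask Y) X || _) = true at hB
  rw [hXY, Nat.beq_refl] at hB
  change ((fun m : ℕ => Bool.rec true false (Nat.beq (clearLow k (code l H) &&& m) m))
    (Nat.mod (Nat.shiftRight B (Nat.mul 36 (Nat.mod (clearLow k (code l H) &&& s) p)))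
      68719476736) : Bool) = true
  revert hB
  generalize Nat.mod (Nat.shiftRight B (Nat.mul 36 (Nat.mod (clearLow k (code l H) &&& s) p)))
    68719476736 = e
  intro hB
  by_contra hcon
  have he : clearLow k (code l H) &&& e = e := by
    rw [← Nat.beq_eq]
    cases h : Nat.beq (clearLow k (code l H) &&& e) e
    · exact absurd (by simp [h]) hcon
    · rfl
  simp only [Bool.not_true, Bool.false_or, Bool.or_eq_true, Bool.and_eq_true, Nat.ble_eq,
    Bool.not_eq_true', Nat.beq_eq] at hB
  rcases hB with hB | ⟨hne, rfl⟩
  · have h1 : e ≤ code l H := by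
      rw [← he]
      exact Nat.and_le_left.trans (clearLow_le _ _)
    have h2 := codeOf_lt (fun m => H (bitset m)) l
    have h3 : 2 ^ l.length ≤ 2 ^ 35 := Nat.pow_le_pow_right (by norm_num) hlen
    have h4 : code l H < 2 ^ l.length := h2
    norm_num at h3
    omega
  · have hf := (face_bitset_iff hl (H := H) (mask Y)).2 (land_eq_of_clearLow he)
    rw [bitset_mask] at hf
    refine hH.no_core (bitset X) Y (by rw [card_bitset, hX]) subset_union_left ?_ hf ?_
    · intro h
      rw [← h, mask_bitset hX'] at hne
      simp at hne
    · intro z hz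
      simp [hY, hz]

/-- Compare `G`, bit by bit, with another number given by the values of corresponding bits. -/
def lexTest (L : List (ℕ × ℕ)) (G : ℕ) : Bool :=
  List.rec true (fun p _ r => Bool.rec (Bool.rec false r (Nat.beq (Nat.land G p.2) 0))
    (Bool.rec r true (Nat.beq (Nat.land G p.2) 0)) (Nat.ble 1 (Nat.land G p.1))) L

/-- The bit positions `(i, j)` with `i < n` such that the `i`-th set listed by `l` is mapped to
the `j`-th one, as pairs of powers of two, starting from the highest `i`. -/
def lexTable (l : List ℕ) (f : ℕ → ℕ) (k : ℕ) : ℕ → List (ℕ × ℕ) → Bool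
  | _, [] => true
  | 0, _ :: _ => false
  | n + 1, p :: L => Nat.ble k n && p.1 == 2 ^ n &&
      (List.range l.length).any (fun j => Nat.ble k j && p.2 == 2 ^ j &&
        ((l[n]?.map f) == l[j]?)) && lexTable l f k n L

theorem land_two_pow_eq_zero (x j : ℕ) : Nat.beq (Nat.land x (2 ^ j)) 0 = !x.testBit j := by
  change Nat.beq (x &&& 2 ^ j) 0 = _
  rw [Nat.and_two_pow, Bool.eq_iff_iff, Nat.beq_eq]
  cases x.testBit j <;> simp

theorem one_le_land_two_pow (x j : ℕ) : Nat.ble 1 (Nat.land x (2 ^ j)) = x.testBit j := by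
  change Nat.ble 1 (x &&& 2 ^ j) = _
  rw [Nat.and_two_pow, Bool.eq_iff_iff, Nat.ble_eq]
  cases x.testBit j <;> simp [Nat.one_le_two_pow]

theorem lexTest_of_le {l : List ℕ} {P : ℕ → Bool} {f : ℕ → ℕ} {k : ℕ} :
    ∀ (n : ℕ) (L : List (ℕ × ℕ)), lexTable l f k n L = true →
    codeOf (fun t => P (f t)) l ≤ codeOf P l →
    (∀ j, n ≤ j → (codeOf (fun t => P (f t)) l).testBit j = (codeOf P l).testBit j) →
    lexTest L (clearLow k (codeOf P l)) = true
  | _, [], _, _, _ => rfl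
  | n + 1, (a, b) :: L, h, hle, heq => by
    simp only [lexTable, Bool.and_eq_true, Nat.ble_eq, beq_iff_eq, List.any_eq_true,
      List.mem_range] at h
    obtain ⟨⟨⟨hk, rfl⟩, j, hj, ⟨hkj, rfl⟩, hf⟩, hL⟩ := h
    have hbit : (codeOf (fun t => P (f t)) l).testBit n = (codeOf P l).testBit j := by
      rw [testBit_codeOf, testBit_codeOf, ← hf, Option.map_map]
      rfl
    have ih := lexTest_of_le n L hL hle
    unfold lexTest at ih ⊢
    simp only [one_le_land_two_pow, land_two_pow_eq_zero, testBit_clearLow, hk, hkj,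
      decide_true, Bool.true_and]
    rw [← hbit]
    cases h1 : (codeOf P l).testBit n <;> cases h2 : (codeOf (fun t => P (f t)) l).testBit n
    · simp only [Bool.not_false]
      apply ih
      intro i hi
      rcases hi.eq_or_lt with rfl | hi
      · rw [h1, h2]
      · exact heq i hi
    · exfalso
      exact hle.not_gt (Nat.lt_of_testBit n h1 h2 fun i hi => (heq i hi).symm)
    · rfl
    · simp only [Bool.not_true]
      apply ih
      intro i hi
      rcases hi.eq_or_lt with rfl | hi
      · rw [h1, h2]
      · exact heq i hi

/-- The mask of the image of the set with mask `m` under the map with values `p`. -/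
def mapMask (p : List (Fin 7)) (m : ℕ) : ℕ :=
  List.rec (fun _ => 0) (fun v _ r i => Nat.add (Nat.mul (Bool.rec 0 1 (m.testBit i))
    (2 ^ (v : ℕ))) (r (i + 1))) p 0

theorem exists_perm_of_nodup {p : List (Fin 7)} (h : p.Nodup) (h7 : p.length = 7) :
    ∃ ρ : Equiv.Perm (Fin 7), ∀ i : Fin 7, ρ i = p.getD i 0 := by
  have hinj : Function.Injective fun i : Fin 7 => p.getD i 0 := by
    intro i j hij
    have hi : (i : ℕ) < p.length := by omega
    have hj : (j : ℕ) < p.length := by omega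
    simp only [List.getD_eq_getElem _ _ hi, List.getD_eq_getElem _ _ hj] at hij
    exact Fin.ext ((h.getElem_inj_iff).1 hij)
  exact ⟨Equiv.ofBijective _ (Finite.injective_iff_bijective.1 hinj), fun i => rfl⟩

theorem map_bitset {p : List (Fin 7)} (h : p.Nodup) (h7 : p.length = 7)
    {ρ : Equiv.Perm (Fin 7)} (hρ : ∀ i : Fin 7, ρ i = p.getD i 0) {m : ℕ} :
    bitset (mapMask p m) = (bitset m).map ρ.toEmbedding := by
  have h1 : mapMask p m = mask ((bitset m).map ρ.toEmbedding) := by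
    obtain ⟨a, b, c, d, e, f, g, rfl⟩ : ∃ a b c d e f g, p = [a, b, c, d, e, f, g] := by
      match p, h7 with
      | [a, b, c, d, e, f, g], _ => exact ⟨a, b, c, d, e, f, g, rfl⟩
    rw [mask, sum_map, bitset, sum_filter, Fin.sum_univ_seven]
    simp only [Equiv.coe_toEmbedding, hρ]
    simp [mapMask]
    have hb : ∀ (b : Bool) (x : ℕ), (Bool.rec 0 1 b : ℕ) * x = if b = true then x else 0 := by
      intro b x
      cases b <;> simp
    simp only [hb, decide_eq_true_eq]
    ring
  rw [h1, bitset_mask]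

theorem lexTest_accepts {l : List ℕ} {H : Finset (Fin 7) → Bool} {p : List (Fin 7)}
    {ρ : Equiv.Perm (Fin 7)} (h : p.Nodup) (h7 : p.length = 7)
    (hρ : ∀ i : Fin 7, ρ i = p.getD i 0) {k : ℕ} {L : List (ℕ × ℕ)}
    (hL : lexTable l (mapMask p) k l.length L = true)
    (hle : code l (fun s => H (s.map ρ.toEmbedding)) ≤ code l H) :
    lexTest L (clearLow k (code l H)) = true := by
  have h1 : code l (fun s => H (s.map ρ.toEmbedding)) =
      codeOf (fun t => (fun m => H (bitset m)) (mapMask p t)) l := by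
    simp only [code, map_bitset h h7 hρ]
  rw [h1] at hle
  refine lexTest_of_le _ L hL hle fun j hj => ?_
  rw [testBit_codeOf, testBit_codeOf, List.getElem?_eq_none hj]
  rfl

/-- The four-bit entries of a table of binary digit sums of the numbers below `512`. -/
def digitSumTable : ℕ :=
  19255054270729893008491005534149248252256602926781282732690012290033276866808550227997693622604181043369877307314662111123331664736047184874077759948250443227256975055791411108947596559321109802036954624006373818143946017559684403162578529602068048730946422771823999999239149825717005481632390412975320206440279958629013623038381969796702446623878923952740084796477918444418310443408990755144638227854376788458924235859745937832180260096754594561627738988715237553750525742696058226208231293151672720457407743312923599856247524705366024968272077418776390695019160354360691986468851967610039890687248939048398439391504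

/-- The number of nonzero binary digits of a number below `2 ^ 36`. -/
def pop (x : ℕ) : ℕ :=
  Nat.add (Nat.add (Nat.mod (Nat.shiftRight digitSumTable (Nat.mul 4 (Nat.mod x 512))) 16)
    (Nat.mod (Nat.shiftRight digitSumTable (Nat.mul 4 (Nat.mod (Nat.shiftRight x 9) 512))) 16))
    (Nat.add (Nat.mod (Nat.shiftRight digitSumTable
      (Nat.mul 4 (Nat.mod (Nat.shiftRight x 18) 512))) 16)
    (Nat.mod (Nat.shiftRight digitSumTable (Nat.mul 4 (Nat.mod (Nat.shiftRight x 27) 512))) 16))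

theorem digitSumTable_spec : ∀ x < 512,
    Nat.mod (Nat.shiftRight digitSumTable (Nat.mul 4 x)) 16 =
      (List.range 9).countP x.testBit := by
  decide +kernel

theorem pop_eq (x : ℕ) : pop x = (List.range 36).countP x.testBit := by
  have h : ∀ y, Nat.mod y 512 < 512 := fun y => Nat.mod_lt _ (by norm_num)
  unfold pop
  rw [digitSumTable_spec _ (h x), digitSumTable_spec _ (h _), digitSumTable_spec _ (h _),
    digitSumTable_spec _ (h _)]
  have hb : ∀ y i, Nat.testBit (Nat.mod y 512) i = (decide (i < 9) && y.testBit i) := fun y i =>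
    Nat.testBit_mod_two_pow y 9 i
  have hs : ∀ j i, Nat.testBit (Nat.shiftRight x j) i = x.testBit (j + i) := fun j i =>
    Nat.testBit_shiftRight x
  have hr : List.range 36 = List.range 9 ++ (List.range 9).map (9 + ·) ++
      ((List.range 9).map (18 + ·) ++ (List.range 9).map (27 + ·)) := by decide
  rw [hr]
  simp only [List.countP_append, List.countP_map, Nat.add_eq]
  congr 2 <;> refine List.countP_congr fun i hi => ?_ <;>
    simp only [hb, hs, List.mem_range.1 hi, decide_true, Bool.true_and, Function.comp_apply]

theorem pop_mono {x y : ℕ} (h : ∀ i, x.testBit i = true → y.testBit i = true) :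
    pop x ≤ pop y := by
  rw [pop_eq, pop_eq]
  exact List.countP_mono_left fun i _ => h i

theorem countP_testBit_codeOf (P : ℕ → Bool) : ∀ (l : List ℕ) (n : ℕ), l.length ≤ n →
    (List.range n).countP (codeOf P l).testBit = l.countP P
  | [], n, _ => by
    simp [codeOf]
  | t :: l, n + 1, h => by
    rw [List.range_succ_eq_map, List.countP_cons, List.countP_cons, List.countP_map, codeOf_cons,
      ← countP_testBit_codeOf P l n (by simpa using h)]
    congr 1
    · refine List.countP_congr fun i _ => ?_
      simp [Nat.testBit_bit_succ]
    · simp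

theorem pop_codeOf {P : ℕ → Bool} {l : List ℕ} (h : l.length ≤ 36) :
    pop (codeOf P l) = l.countP P := by
  rw [pop_eq, countP_testBit_codeOf P l 36 h]

theorem card_filter_eq_countP (Q : Finset (Fin 7) → Prop) [DecidablePred Q] :
    #{s | Q s} = (List.range 128).countP fun m => Q (bitset m) := by
  have h1 : (univ.filter Q) = ((range 128).filter fun m => Q (bitset m)).image bitset := by
    ext s
    simp only [mem_filter, mem_univ, true_and, mem_image, mem_range]
    constructor
    · intro h
      exact ⟨mask s, ⟨mask_lt s, by rwa [bitset_mask]⟩, bitset_mask s⟩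
    · rintro ⟨m, ⟨_, h⟩, rfl⟩
      exact h
  rw [h1, card_image_of_injOn]
  · rw [List.countP_eq_length_filter]
    rfl
  · intro m hm k hk hmk
    simp only [coe_filter, mem_range, Set.mem_ofPred_eq] at hm hk
    exact bitset_injOn hm.1 hk.1 hmk

theorem Enumerates.countP_eq_card {c : ℕ} {l : List ℕ} (hl : Enumerates c l)
    (Q : Finset (Fin 7) → Prop) [DecidablePred Q] :
    l.countP (fun m => Q (bitset m)) = #{s | Q s ∧ #s = c + 1} := by
  rw [List.Perm.countP_eq _ hl, List.countP_filter, card_filter_eq_countP]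
  simp [card_bitset]

/-- The number of elements of `L` all of whose bits are bits of `G`. -/
def countSub (L : List ℕ) (G : ℕ) : ℕ :=
  List.rec 0 (fun k _ r => Nat.add (Nat.div (Nat.land G k) k) r) L

theorem countSub_cons (k : ℕ) (L : List ℕ) (G : ℕ) :
    countSub (k :: L) G = (G &&& k) / k + countSub L G := rfl

theorem countSub_append (L M : List ℕ) (G : ℕ) :
    countSub (L ++ M) G = countSub L G + countSub M G := by
  induction L with
  | nil => simp [countSub]
  | cons k L ih => rw [List.cons_append, countSub_cons, countSub_cons, ih, add_assoc]

theorem countSub_replicate {n k : ℕ} (hk : k ≠ 0) (G : ℕ) :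
    countSub (List.replicate n k) G = if G &&& k = k then n else 0 := by
  have h1 : (G &&& k) / k = if G &&& k = k then 1 else 0 := by
    split_ifs with h
    · rw [h, Nat.div_self (Nat.pos_of_ne_zero hk)]
    · exact Nat.div_eq_of_lt (lt_of_le_of_ne Nat.and_le_right h)
  induction n with
  | zero => simp [countSub]
  | succ n ih =>
    rw [List.replicate_succ, countSub_cons, ih, h1]
    split_ifs <;> omega

theorem countSub_clearLow {L : List ℕ} {k : ℕ} (h : ∀ f ∈ L, 2 ^ k ∣ f) (G : ℕ) :
    countSub L (clearLow k G) = countSub L G := by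
  induction L with
  | nil => rfl
  | cons f L ih =>
    rw [List.forall_mem_cons] at h
    rw [countSub_cons, countSub_cons, ih h.2, land_clearLow h.1]

/-- The codes of the subsets `s` of the set with mask `W` that have more than `c + 1` elements,
their number being congruent to `r` modulo two, each repeated `w s` times. -/
def largeSubsets (l : List ℕ) (c W r : ℕ) (w : ℕ → ℕ) : List ℕ :=
  (List.range 128).flatMap fun s => Bool.rec [] (List.replicate (w s) (faceCode l s))
    (Nat.beq (Nat.land s W) s && (Nat.ble (c + 2) (weight s) && Nat.beq (weight s % 2) (r % 2)))

theorem faceCode_ne_zero {c : ℕ} {l : List ℕ} (hl : Enumerates c l) {s : ℕ}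
    (h : c + 1 ≤ weight s) : faceCode l s ≠ 0 := by
  intro h0
  rw [← card_bitset] at h
  obtain ⟨t, hts, htc⟩ := Finset.exists_subset_card_eq h
  exact Bool.false_ne_true
    ((face_bitset_iff hl (H := fun _ => false) s).2 (by rw [h0, Nat.and_zero]) t hts htc)

theorem countSub_largeSubsets {c : ℕ} {l : List ℕ} (hl : Enumerates c l)
    (H : Finset (Fin 7) → Bool) (W r : ℕ) (w : ℕ → ℕ) (w' : Finset (Fin 7) → ℕ)
    (hw : ∀ s, w s = w' (bitset s)) :
    countSub (largeSubsets l c W r w) (code l H) =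
      ∑ s with s ⊆ bitset W ∧ Face c H s ∧ c + 2 ≤ #s ∧ #s % 2 = r % 2, w' s := by
  have key : ∀ L : List ℕ, (∀ s ∈ L, s < 128) →
      countSub (L.flatMap fun s => Bool.rec [] (List.replicate (w s) (faceCode l s))
        (Nat.beq (Nat.land s W) s && (Nat.ble (c + 2) (weight s) &&
          Nat.beq (weight s % 2) (r % 2)))) (code l H) =
      (L.map fun s => if bitset s ⊆ bitset W ∧ Face c H (bitset s) ∧ c + 2 ≤ #(bitset s) ∧
        #(bitset s) % 2 = r % 2 then w' (bitset s) else 0).sum := by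
    intro L hL
    induction L with
    | nil => rfl
    | cons s L ih =>
      rw [List.forall_mem_cons] at hL
      rw [List.flatMap_cons, countSub_append, ih hL.2, List.map_cons, List.sum_cons]
      congr 1
      simp only [bitset_subset hL.1, face_bitset_iff hl, card_bitset]
      have h1 : Nat.beq (Nat.land s W) s = decide (s &&& W = s) := by
        rw [Bool.eq_iff_iff, Nat.beq_eq, decide_eq_true_eq]; rfl
      have h2 : Nat.ble (c + 2) (weight s) = decide (c + 2 ≤ weight s) := by
        rw [Bool.eq_iff_iff, Nat.ble_eq, decide_eq_true_eq]
      have h3 : Nat.beq (weight s % 2) (r % 2) = decide (weight s % 2 = r % 2) := by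
        rw [Bool.eq_iff_iff, Nat.beq_eq, decide_eq_true_eq]
      rw [h1, h2, h3]
      by_cases a1 : s &&& W = s <;> by_cases a2 : c + 2 ≤ weight s <;>
        by_cases a3 : weight s % 2 = r % 2 <;> simp [a1, a2, a3, countSub]
      have := countSub_replicate (n := w s) (faceCode_ne_zero hl (s := s) (by omega)) (code l H)
      rw [← hw]
      exact this
  rw [largeSubsets, key _ fun s hs => List.mem_range.1 hs, sum_filter]
  have h1 : (univ : Finset (Finset (Fin 7))) = (range 128).image bitset := by
    ext s
    simp only [mem_univ, mem_image, mem_range, true_iff]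
    exact ⟨mask s, mask_lt s, bitset_mask s⟩
  rw [h1, sum_image]
  · rfl
  · intro m hm k hk hmk
    exact bitset_injOn (mem_range.1 hm) (mem_range.1 hk) hmk

/-- Compare the numbers of faces of both parities below a given set. -/
def faceTest (f b : ℕ) (o e : List ℕ) (G : ℕ) : Bool :=
  Nat.ble (Nat.add (pop (Nat.land G f)) (countSub o G)) (Nat.add b (countSub e G))

/-- The data for `faceTest` describe the set with mask `W`. -/
def faceTable (l : List ℕ) (c W k f b : ℕ) (o e : List ℕ) : Bool :=
  Nat.beq f (faceCode l W) && Nat.ble 1 (weight W) && Nat.beq b ((weight W - 1).choose c) &&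
    o == largeSubsets l c W (c + 1) (fun _ => 1) && e == largeSubsets l c W c (fun _ => 1) &&
    (f :: (o ++ e)).all fun x => Nat.beq (x % 2 ^ k) 0

theorem Good.faceTest {c : ℕ} {l : List ℕ} {H : Finset (Fin 7) → Bool} (hH : Good c H)
    (hl : Enumerates c l) (hlen : l.length ≤ 36) {W k f b : ℕ} {o e : List ℕ}
    (hT : faceTable l c W k f b o e = true) :
    faceTest f b o e (clearLow k (code l H)) = true := by
  simp only [faceTable, Bool.and_eq_true, Nat.beq_eq, Nat.ble_eq, beq_iff_eq, List.all_eq_true,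
    List.forall_mem_cons, List.forall_mem_append] at hT
  obtain ⟨⟨⟨⟨⟨hf, hW⟩, hb⟩, ho⟩, he⟩, hkf, hko, hke⟩ := hT
  have h1 := hH.card_odd_le (bitset W) (card_pos.1 (by rw [card_bitset]; omega))
  have h2 := countSub_largeSubsets hl H W (c + 1) (fun _ => 1) (fun _ => 1) fun _ => rfl
  have h3 := countSub_largeSubsets hl H W c (fun _ => 1) (fun _ => 1) fun _ => rfl
  have h4 : pop (code l H &&& f) = #{s | (s ⊆ bitset W ∧ H s = true) ∧ #s = c + 1} := by
    rw [hf, code, faceCode, land_codeOf, pop_codeOf hlen, ← hl.countP_eq_card]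
    refine List.countP_congr fun m hm => ?_
    rw [Bool.and_eq_true, Nat.beq_eq, decide_eq_true_eq, bitset_subset (hl.mem_iff.1 hm).1]
    exact And.comm
  have h5 : ∀ m ∈ f :: (o ++ e), 2 ^ k ∣ m := by
    simp only [List.forall_mem_cons, List.forall_mem_append]
    exact ⟨Nat.dvd_of_mod_eq_zero hkf, fun m hm => Nat.dvd_of_mod_eq_zero (hko m hm),
      fun m hm => Nat.dvd_of_mod_eq_zero (hke m hm)⟩
  simp only [List.forall_mem_cons, List.forall_mem_append] at h5
  rw [_root_.faceTest, Nat.ble_eq, countSub_clearLow h5.2.1, countSub_clearLow h5.2.2]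
  change pop (clearLow k (code l H) &&& f) + _ ≤ _ + _
  rw [land_clearLow h5.1, h4, ho, he, h2, h3, hb, ← card_eq_sum_ones, ← card_eq_sum_ones,
    ← card_bitset]
  have hface : ∀ s : Finset (Fin 7), #s = c + 1 → (Face c H s ↔ H s = true) := by
    intro s hs
    constructor
    · intro h
      exact h s subset_rfl hs
    · intro h t hts htc
      rwa [eq_of_subset_of_card_le hts (by omega)]
  have h6 : (univ.filter fun s : Finset (Fin 7) =>
      s ⊆ bitset W ∧ Face c H s ∧ c + 1 ≤ #s ∧ #s % 2 = (c + 1) % 2) =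
      (univ.filter fun s => (s ⊆ bitset W ∧ H s = true) ∧ #s = c + 1) ∪
      univ.filter fun s => s ⊆ bitset W ∧ Face c H s ∧ c + 2 ≤ #s ∧ #s % 2 = (c + 1) % 2 := by
    ext s
    simp only [mem_filter, mem_univ, true_and, mem_union]
    rcases eq_or_ne (#s) (c + 1) with hs | hs
    · rw [hface s hs]
      simp [hs]
    · have : c + 1 ≤ #s ↔ c + 2 ≤ #s := by omega
      simp [hs, this]
  have h7 : (univ.filter fun s : Finset (Fin 7) =>
      s ⊆ bitset W ∧ Face c H s ∧ c + 1 ≤ #s ∧ #s % 2 = c % 2) =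
      univ.filter fun s => s ⊆ bitset W ∧ Face c H s ∧ c + 2 ≤ #s ∧ #s % 2 = c % 2 := by
    ext s
    simp only [mem_filter, mem_univ, true_and]
    have : c + 1 ≤ #s ∧ #s % 2 = c % 2 ↔ c + 2 ≤ #s ∧ #s % 2 = c % 2 := by omega
    rw [this]
  rw [h6, h7, card_union_of_disjoint] at h1
  · exact h1
  · rw [disjoint_filter]
    rintro s - ⟨-, hs⟩ ⟨-, -, hs', -⟩
    omega

/-- Compare the weighted numbers of faces of both parities. -/
def weightedTest (b : ℕ) (o e : List ℕ) (G : ℕ) : Bool :=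
  Nat.ble (countSub e G) (Nat.add b (countSub o G))

/-- The data for `weightedTest` describe the set with mask `W`. -/
def weightedTable (l : List ℕ) (c W b : ℕ) (o e : List ℕ) : Bool :=
  Nat.ble 2 (weight W) && Nat.beq b ((weight W - 2).choose c) &&
    o == largeSubsets l c W (c + 1) (fun s => weight s - c - 1) &&
    e == largeSubsets l c W c (fun s => weight s - c - 1)

theorem Good.weightedTest {c : ℕ} {l : List ℕ} {H : Finset (Fin 7) → Bool} (hH : Good c H)
    (hl : Enumerates c l) {W b : ℕ} {o e : List ℕ} (hT : weightedTable l c W b o e = true) :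
    weightedTest b o e (clearLow 0 (code l H)) = true := by
  simp only [weightedTable, Bool.and_eq_true, Nat.beq_eq, Nat.ble_eq, beq_iff_eq] at hT
  obtain ⟨⟨⟨hW, hb⟩, ho⟩, he⟩ := hT
  rw [clearLow_zero, _root_.weightedTest, Nat.ble_eq, Nat.add_eq, ho, he,
    countSub_largeSubsets hl H W (c + 1) _ (fun s => #s - c - 1) fun s => by rw [card_bitset],
    countSub_largeSubsets hl H W c _ (fun s => #s - c - 1) fun s => by rw [card_bitset], hb,
    ← card_bitset]
  have key : ∀ r, ∑ s with s ⊆ bitset W ∧ Face c H s ∧ c + 2 ≤ #s ∧ #s % 2 = r % 2, (#s - c - 1) =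
      ∑ s with s ⊆ bitset W ∧ Face c H s ∧ c + 1 ≤ #s ∧ #s % 2 = r % 2, (#s - c - 1) := by
    intro r
    refine sum_subset ?_ ?_
    · intro s
      simp only [mem_filter, mem_univ, true_and]
      rintro ⟨h1, h2, h3, h4⟩
      exact ⟨h1, h2, by omega, h4⟩
    · intro s
      simp only [mem_filter, mem_univ, true_and]
      rintro ⟨h1, h2, h3, h4⟩ h5
      by_contra h6
      exact h5 ⟨h1, h2, by omega, h4⟩
  rw [key, key]
  exact hH.weighted _ (by rw [card_bitset]; omega)

/-- The number of members of `H` with `c + 1` elements that contain `v`. -/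
def degree (c : ℕ) (H : Finset (Fin 7) → Bool) (v : Fin 7) : ℕ :=
  #{s | (H s = true ∧ v ∈ s) ∧ #s = c + 1}

/-- Check that the number of bits of `G` in `a` does not exceed the number of bits in `b`, where
the bits in `u` are undecided. -/
def degreeTest (a b u G : ℕ) : Bool :=
  Nat.ble (pop (Nat.land G a)) (pop (Nat.land (Nat.lor G u) b))

theorem pop_land_eq_degree {c : ℕ} {l : List ℕ} (hl : Enumerates c l) (hlen : l.length ≤ 36)
    (H : Finset (Fin 7) → Bool) (v : Fin 7) :
    pop (code l H &&& codeOf (fun t => t.testBit v) l) = degree c H v := by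
  rw [code, land_codeOf, pop_codeOf hlen, degree, ← hl.countP_eq_card]
  refine List.countP_congr fun m _ => ?_
  rw [Bool.and_eq_true, decide_eq_true_eq, mem_bitset]

theorem degreeTest_accepts {c : ℕ} {l : List ℕ} (hl : Enumerates c l) (hlen : l.length ≤ 36)
    {H : Finset (Fin 7) → Bool} {v w : Fin 7} (hH : degree c H v ≤ degree c H w) {a b k : ℕ}
    (ha : a = codeOf (fun t => t.testBit v) l) (hb : b = codeOf (fun t => t.testBit w) l) :
    degreeTest a b (2 ^ k - 1) (clearLow k (code l H)) = true := by
  rw [degreeTest, Nat.ble_eq]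
  refine le_trans (pop_mono (y := code l H &&& a) fun i hi => ?_) (le_trans ?_
    (pop_mono (x := code l H &&& b) fun i hi => ?_))
  · change (clearLow k (code l H) &&& a).testBit i = true at hi
    simp only [Nat.testBit_and, testBit_clearLow, Bool.and_eq_true] at hi ⊢
    exact ⟨hi.1.2, hi.2⟩
  · rwa [ha, hb, pop_land_eq_degree hl hlen, pop_land_eq_degree hl hlen]
  · change ((clearLow k (code l H) ||| (2 ^ k - 1)) &&& b).testBit i = true
    simp only [Nat.testBit_and, Nat.testBit_or, testBit_clearLow, Bool.and_eq_true,
      Nat.testBit_two_pow_sub_one] at hi ⊢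
    refine ⟨?_, hi.2⟩
    rw [hi.1]
    by_cases h : k ≤ i
    · simp [h]
    · simp [not_le.1 h]

/-- A search tree with keys and values. -/
inductive SearchTree
  | leaf
  | node (l : SearchTree) (key value : ℕ) (r : SearchTree)

/-- The value stored with the key `x`, or `0`. -/
noncomputable def SearchTree.find (x : ℕ) (t : SearchTree) : ℕ :=
  SearchTree.rec 0 (fun _ k v _ a b => Bool.rec (Bool.rec b a (Nat.ble x k)) v (Nat.beq x k)) t

/-- The pairs of the elements `X` of a list with the nonzero base `128` digits of `n`. -/
def digitPairs (L : List ℕ) (n : ℕ) : List (ℕ × ℕ) :=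
  List.rec (fun _ => []) (fun X _ r n => (fun Y => Bool.rec ((X, Y) :: r (Nat.div n 128))
    (r (Nat.div n 128)) (Nat.beq Y 0)) (Nat.mod n 128)) L n

/-- All elements of a list satisfy a test. -/
def allOf {α : Type} (f : α → Bool) (L : List α) : Bool :=
  List.rec true (fun a _ r => Bool.rec false r (f a)) L

/-- Some element of a list satisfies a test. -/
def anyOf {α : Type} (f : α → Bool) (L : List α) : Bool :=
  List.rec false (fun a _ r => Bool.rec r true (f a)) L

/-- All pairs of elements of a list satisfy a test. -/
def pairwiseOf {α : Type} (f : α → α → Bool) (L : List α) : Bool :=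
  List.rec true (fun a L r => Bool.rec false r (allOf (f a) L)) L

theorem allOf_iff {α : Type} {f : α → Bool} {L : List α} :
    allOf f L = true ↔ ∀ a ∈ L, f a = true := by
  induction L with
  | nil => simp [allOf]
  | cons a L ih =>
    rw [List.forall_mem_cons, ← ih]
    simp only [allOf]
    cases f a <;> simp

theorem anyOf_iff {α : Type} {f : α → Bool} {L : List α} :
    anyOf f L = true ↔ ∃ a ∈ L, f a = true := by
  induction L with
  | nil => simp [anyOf]
  | cons a L ih =>
    rw [List.exists_mem_cons_iff, ← ih]
    simp only [anyOf]
    cases f a <;> simp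

theorem pairwiseOf_iff {α : Type} {f : α → α → Bool} {L : List α} :
    pairwiseOf f L = true ↔ L.Pairwise fun a b => f a b = true := by
  induction L with
  | nil => simp [pairwiseOf]
  | cons a L ih =>
    rw [List.pairwise_cons, ← ih, ← allOf_iff]
    simp only [pairwiseOf]
    cases allOf (f a) L <;> simp

/-- The entry of index `s` of a table with `36`-bit entries. -/
def entry (F s : ℕ) : ℕ := Nat.mod (Nat.shiftRight F (Nat.mul 36 s)) 68719476736

/-- `L` consists of the subsets with more than `c` elements, `F` is a table of face codes. -/
def faceData (l : List ℕ) (c F : ℕ) (L : List ℕ) : Bool :=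
  L == (List.range 128).filter (fun s => Nat.ble (c + 1) (weight s)) &&
    L.all fun s => Nat.beq (entry F s) (faceCode l s)

/-- `m` is a subset of `n`. -/
def subMask (m n : ℕ) : Bool := Nat.beq (Nat.land m n) m

/-- The intervals `P` partition the faces of `G` in `L`. -/
def solves (c F : ℕ) (L : List ℕ) (P : List (ℕ × ℕ)) (G : ℕ) : Bool :=
  both (fun _ => allOf (fun p => both (fun _ => both (fun _ => Nat.ble (weight p.1) c)
      (fun _ => Nat.ble (c + 1) (weight p.2)) 0)
      (fun _ => both (fun _ => both (fun _ => Nat.ble p.1 127) (fun _ => Nat.ble p.2 127) 0)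
        (fun _ => both (fun _ => subMask p.1 p.2) (fun _ => subMask (entry F p.2) G) 0) 0) 0) P)
    (both (fun _ => pairwiseOf (fun p q => Bool.not
      (subMask (Nat.lor p.1 q.1) (Nat.land p.2 q.2))) P)
    (fun _ => allOf (fun s => Bool.rec true
      (anyOf (fun p => both (fun _ => subMask p.1 s) (fun _ => subMask s p.2) 0) P)
      (subMask (entry F s) G)) L)) 0

theorem both_eq_true {t u : ℕ → Bool} {m : ℕ} :
    both t u m = true ↔ t m = true ∧ u m = true := by
  unfold both
  cases t m <;> simp

theorem subMask_iff {m n : ℕ} : subMask m n = true ↔ m &&& n = m := by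
  rw [subMask, Nat.beq_eq]
  rfl

theorem sol_of_solves {c : ℕ} {l : List ℕ} {H : Finset (Fin 7) → Bool} (hl : Enumerates c l)
    {F : ℕ} {L : List ℕ} (hF : faceData l c F L = true) {P : List (ℕ × ℕ)}
    (hP : solves c F L P (code l H) = true) : Sol c H := by
  simp only [faceData, Bool.and_eq_true, beq_iff_eq, List.all_eq_true, Nat.beq_eq] at hF
  obtain ⟨hL, hF⟩ := hF
  have hmem : ∀ s, s ∈ L ↔ s < 128 ∧ c + 1 ≤ #(bitset s) := by
    intro s
    rw [hL, List.mem_filter, List.mem_range, Nat.ble_eq, card_bitset]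
  have hface : ∀ s ∈ L, (subMask (entry F s) (code l H) = true ↔ Face c H (bitset s)) := by
    intro s hs
    rw [subMask_iff, face_bitset_iff hl, hF s hs, Nat.land_comm]
  simp only [solves, both_eq_true, allOf_iff, pairwiseOf_iff, Nat.ble_eq] at hP
  obtain ⟨hP1, hP2, hP3⟩ := hP
  refine ⟨(P.map fun p => (bitset p.1, bitset p.2)).toFinset, ?_, ?_, ?_⟩
  · intro p hp
    obtain ⟨q, hq, rfl⟩ := List.mem_map.1 (List.mem_toFinset.1 hp)
    obtain ⟨⟨h1, h2⟩, ⟨h3, h4⟩, h5, h6⟩ := hP1 q hq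
    rw [← card_bitset] at h1 h2
    refine ⟨(bitset_subset (by omega)).2 (subMask_iff.1 h5), h1, h2, ?_⟩
    exact (hface _ ((hmem _).2 ⟨by omega, h2⟩)).1 h6
  · have hsymm : ∀ p q : ℕ × ℕ, (!subMask (Nat.lor p.1 q.1) (Nat.land p.2 q.2)) = true →
        (!subMask (Nat.lor q.1 p.1) (Nat.land q.2 p.2)) = true := by
      intro p q h
      change (!subMask (q.1 ||| p.1) (q.2 &&& p.2)) = true
      rw [Nat.lor_comm, Nat.land_comm]
      exact h
    rintro p' hp' q' hq' hpq s h1 h2 h3 h4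
    obtain ⟨p, hp, rfl⟩ := List.mem_map.1 (List.mem_toFinset.1 hp')
    obtain ⟨q, hq, rfl⟩ := List.mem_map.1 (List.mem_toFinset.1 hq')
    have : Std.Symm fun a b : ℕ × ℕ => (!subMask (Nat.lor a.1 b.1) (Nat.land a.2 b.2)) = true :=
      ⟨hsymm⟩
    have h := hP2.forall hp hq fun h => hpq (congrArg (fun p : ℕ × ℕ => (bitset p.1, bitset p.2)) h)
    obtain ⟨-, ⟨hp1, -⟩, -⟩ := hP1 p hp
    obtain ⟨-, ⟨hq1, -⟩, -⟩ := hP1 q hq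
    rw [Bool.not_eq_true', Bool.eq_false_iff] at h
    apply h
    rw [subMask_iff]
    change (p.1 ||| q.1) &&& (p.2 &&& q.2) = p.1 ||| q.1
    have hlt : p.1 ||| q.1 < 128 := Nat.or_lt_two_pow (n := 7) (by omega) (by omega)
    rw [← bitset_subset hlt]
    intro i hi
    have hi' : i ∈ bitset p.1 ∨ i ∈ bitset q.1 := by simpa [mem_bitset] using hi
    have hs : i ∈ s := hi'.elim (fun h => h1 h) fun h => h3 h
    have h5 := mem_bitset.1 (h2 hs)
    have h6 := mem_bitset.1 (h4 hs)
    rw [mem_bitset, Nat.testBit_and, h5, h6]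
    rfl
  · intro s hs hsc
    have hm : mask s ∈ L := (hmem _).2 ⟨mask_lt s, by rwa [bitset_mask]⟩
    have h1 := hP3 (mask s) hm
    have h2 := (hface _ hm).2 (by rwa [bitset_mask])
    rw [h2] at h1
    obtain ⟨p, hp, h3⟩ := anyOf_iff.1 h1
    rw [both_eq_true, subMask_iff, subMask_iff] at h3
    refine ⟨(bitset p.1, bitset p.2), List.mem_toFinset.2 (List.mem_map.2 ⟨p, hp, rfl⟩), ?_, ?_⟩
    · obtain ⟨-, ⟨hp1, -⟩, -⟩ := hP1 p hp
      have := (bitset_subset (by omega)).2 h3.1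
      rwa [bitset_mask] at this
    · have := (bitset_subset (mask_lt s)).2 h3.2
      rwa [bitset_mask] at this

/-- Look up and verify a solution. -/
noncomputable def leafTest (c F : ℕ) (L X : List ℕ) (t : SearchTree) (G : ℕ) : Bool :=
  solves c F L (digitPairs X (t.find G)) G

theorem certifies_leafTest {A : (Finset (Fin 7) → Bool) → Prop} {c : ℕ} {l : List ℕ}
    (hl : Enumerates c l) {F : ℕ} {L X : List ℕ} (hF : faceData l c F L = true)
    (t : SearchTree) : Certifies A (Sol c) l 0 (leafTest c F L X t) := by
  intro H _ h
  rw [clearLow_zero] at h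
  exact sol_of_solves hl hF h

/-- The families for which the search for triples is carried out. -/
structure TripleCandidate (l : List ℕ) (H : Finset (Fin 7) → Bool) : Prop where
  good : Good 2 H
  degree_four : degree 2 H 6 ≤ degree 2 H 4
  degree_five : degree 2 H 6 ≤ degree 2 H 5
  code_le : ∀ ρ : Equiv.Perm (Fin 7), ρ 6 = 6 →
    code l (fun s => H (s.map ρ.toEmbedding)) ≤ code l H

/-- The families for which the search for edges is carried out. -/
structure EdgeCandidate (l : List ℕ) (H : Finset (Fin 7) → Bool) : Prop where
  good : Good 1 H
  code_le : ∀ ρ : Equiv.Perm (Fin 7), code l (fun s => H (s.map ρ.toEmbedding)) ≤ code l H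

section Accepts

variable {A : (Finset (Fin 7) → Bool) → Prop} {c : ℕ} {l : List ℕ}

theorem accepts_pairTest (hA : ∀ H, A H → Good c H) (hl : Enumerates c l) (hlen : l.length ≤ 35)
    {X s p B k : ℕ} (hX : weight X = c) (hB : pairTable l X s p B k = true) :
    Accepts A l k (pairTest s p B) :=
  fun H hH => (hA H hH).pairTest hl hlen hX hB

theorem accepts_faceTest (hA : ∀ H, A H → Good c H) (hl : Enumerates c l) (hlen : l.length ≤ 36)
    {W k f b : ℕ} {o e : List ℕ} (hT : faceTable l c W k f b o e = true) :
    Accepts A l k (faceTest f b o e) :=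
  fun H hH => (hA H hH).faceTest hl hlen hT

theorem accepts_weightedTest (hA : ∀ H, A H → Good c H) (hl : Enumerates c l)
    {W b : ℕ} {o e : List ℕ} (hT : weightedTable l c W b o e = true) :
    Accepts A l 0 (weightedTest b o e) :=
  fun H hH => (hA H hH).weightedTest hl hT

theorem accepts_true {k : ℕ} : Accepts A l k fun _ => true := fun _ _ => rfl

end Accepts

theorem accepts_lexTest_edge {l : List ℕ} {p : List (Fin 7)} (h : p.Nodup ∧ p.length = 7) {k : ℕ}
    {L : List (ℕ × ℕ)} (hL : lexTable l (mapMask p) k l.length L = true) :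
    Accepts (EdgeCandidate l) l k (lexTest L) := by
  intro H hH
  obtain ⟨ρ, hρ⟩ := exists_perm_of_nodup h.1 h.2
  exact lexTest_accepts h.1 h.2 hρ hL (hH.code_le ρ)

theorem accepts_lexTest_triple {l : List ℕ} {p : List (Fin 7)}
    (h : p.Nodup ∧ p.length = 7 ∧ p.getD 6 0 = 6) {k : ℕ}
    {L : List (ℕ × ℕ)} (hL : lexTable l (mapMask p) k l.length L = true) :
    Accepts (TripleCandidate l) l k (lexTest L) := by
  intro H hH
  obtain ⟨ρ, hρ⟩ := exists_perm_of_nodup h.1 h.2.1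
  exact lexTest_accepts h.1 h.2.1 hρ hL (hH.code_le ρ ((hρ 6).trans h.2.2))

theorem accepts_degreeTest_four {l : List ℕ} (hl : Enumerates 2 l) (hlen : l.length ≤ 36)
    {a b u k : ℕ} (h : a = codeOf (fun t => t.testBit 6) l ∧ b = codeOf (fun t => t.testBit 4) l ∧
      u = 2 ^ k - 1) : Accepts (TripleCandidate l) l k (degreeTest a b u) := by
  intro H hH
  rw [h.2.2]
  exact degreeTest_accepts hl hlen hH.degree_four h.1 h.2.1

theorem accepts_degreeTest_five {l : List ℕ} (hl : Enumerates 2 l) (hlen : l.length ≤ 36)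
    {a b u k : ℕ} (h : a = codeOf (fun t => t.testBit 6) l ∧ b = codeOf (fun t => t.testBit 5) l ∧
      u = 2 ^ k - 1) : Accepts (TripleCandidate l) l k (degreeTest a b u) := by
  intro H hH
  rw [h.2.2]
  exact degreeTest_accepts hl hlen hH.degree_five h.1 h.2.1

/-- The masks of the sets with 2 elements, in an order suited to the search. -/
def edgeMasks : List ℕ := [96, 80, 72, 68, 66, 65, 48, 40, 36, 34, 33, 24, 20, 18, 17, 12, 10, 9,
  6, 5, 3]

theorem enumerates_edgeMasks : Enumerates 1 edgeMasks := by
  decide +kernel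

/-- The test for a core over the set with mask `1`. -/
noncomputable def edgeCore1 : ℕ → Bool := pairTest 1721376 85
  22182748322801340822802885511467964411476114350633415798504843848632485121821587291327842081038410915414714614523145709761641468885891766663046188176194682119460938963377861526542790450225039725986481304853267192227475526239574823046614253322004843884822943780088949690069317452599280245605960512304503647043289840844674584302101879407470769918024646620968898216375745984751651674979036509756210268899776759504258009215338330203595835625253459175163448402946749193633399410875877009986655775191240905261232258790097931826200939131888526257024001249964277748680441263557230457990189961212255765626316321373668072384123968770901594683072317312410389217769924157829444213859495465091071063270949425648998760223537823905743359533247294718713763818781567443606444704566868923849163620393390417513303924005376811468885760156133433874305207313168916912368997570331435286714909106775341752881062954736484558243538025807085568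

/-- The test for a core over the set with mask `2`. -/
noncomputable def edgeCore2 : ℕ → Bool := pairTest 1384976 147
  20365304868251048330182506583426257389524360735712113349135416198594675867791943302634683746420507338261586070818701775428665791575394737263417441354545817996517941625216809309319762808495328614216843850979461539158546636733108035423625387017113709969897041516926202543575405847831062865210319722212680674274527536451550475442240133216697354682435846943807504576188230454030936713370218624413304381921016285076800693915386990593734818411990925721456407741994722560424235610261568876581391022907487362072856614311744238297180542795326717630499703966655402861910303486235971268843172481034947281073117500983357157330586185991554492308859609044640417799147533187172236426614688949491402218124753117695506674259676505040278590903669655728771058117136597676898832034297701411598570180201846738653316933352106157796616248393472262882628800428200466586176374695830149265921533329287109117545541408889309726109966070104750011558333632053128024892735549151910996566126342882172545667421925265692068556200614635297432426659754681247769132492683685499543188649308318825501560415259079388246967395289432347991431775428279537331986854801735937522435168692609052168703866325846959792239149785494561565119614763860188750783283727581772680994557739902774939074962978659161924534109203279391227234186997856078158099411982453869830359663761244304639578961242756176236303058232112360687549858944983955909340551702970371005587580334079187535202581472057065132569659146626004440052414499740054325088277311144291605905412698612856850453429045751173360214778414329932536688926267624109498068660936468284041068544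

/-- The test for a core over the set with mask `4`. -/
noncomputable def edgeCore4 : ℕ → Bool := pairTest 823560 177
  7279513826035167900734607191457088756952484348714412210928273978596051591077438539317514891325668274976871957720024996385910409010038239223703910351366947068248372143351940759367527466156707199306506326677577534088585682429300383221387444670310684322647896708462041332248870512771197862732169174881700822428516295923018695975681861585677432809382452331473651615865141705391199029457050714229394992929672771146523524858859717614465145161114789529800604174524311440945410866869891031601287109839408625461294797429130539059691163928216800251198572391928087914294567564013403951638009026250286946052839287793354920490084025829747110657140143653975901397363083165481407252794265268279010223769647421443668399818210611359569892952468503906532761656587859150095956065909721023469110762586187439426088852284291238993814472151475582160298108330475269415154952871243710939502352904645845484132839015906033156954731686414389598763370015724302883720121149112868887940362839901292076192014886654949084987600816269150293264277565728658826290382443082317034942641697175516784095080332304125380456270985137975041795638826579164894360896413859518749362462813137614848052760092394658585713847426759204227117220076784479108018574112557279840589733594788247467745775550590541372961051065412356773955902630089661435299393266866251960899563394073641927070500732160533390948199958396701995570101047041094574187576146241121475186269444608329551256480788545325164099656144158065641590475167070833105192553827959736201981697499027225977064259513482424898273609929975217296471182452310257188275951859520864420885193671899592705081852821220217034638246096378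670508703310085169205387274641711489905386967834571820906064578303068428063547096060127571169656399361762240460274079287818981132080717760991650412736032811908415518669494467479449157155020747177673159490091540333560899181865644478940413926438611302298973242820152857373727494744496406528

/-- The test for a core over the set with mask `8`. -/
noncomputable def edgeCore8 : ℕ → Bool := pairTest 231556 89
  172949104581312183915761214909483209617352191982876751827089716303642114110447062098026391138241797049156915615925769493577911189789363310408586833572356198358803464148814956120172837935406204904548177107584267330475881947934193760036930658925963096949034072052622105467337083139441381982013751163837747228421724330761636302442763195705252872106282318019289343678696549768546016502540755872737942320942326232407345996629497363394471682453829379021378529954646284348587352705114257947856363905486040045753507675061404541609856157967556612426165711880371968644795826337588266167986816688622026065064111787969883104762917698858111982180660271656919076029534992525419745114402041275275994758317604228290333829891170437995640925865775300226150406785916122284400638616272243460546303716449440306645397605248381907877143560934079931133101446160914780981196861002749537033216214090789264907972048399114039763617126895250578745901436548890437858347741213152284466216960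

/-- The test for a core over the set with mask `16`. -/
noncomputable def edgeCore16 : ℕ → Bool := pairTest 30786 73
  8219151691751160323749162603189956001683539300475462570220163533454429178233622675297830542734144926744681453430470825406969521301187409357793572490673848528715512782704491422743812284368674083234484799083316084018633192089670819305734981332365045931044042840573314113524434679432112746007447639002695374090729611560463096006812138523728185534268143601730353618495867206004623243311824389306048953531169339643987236853998135002892160178828581011711895670653569082425914783165397156457833939273961934572530868553003465745354043424763093546174704935160784840401547738532085222715753814065269736127285814423300191642123856012208443065724857055949265105378291568263768603787539226026594819936391262000247007110439014825715115257640969577862186727611727278615733485946918770408191176998912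

/-- The test for a core over the set with mask `32`. -/
noncomputable def edgeCore32 : ℕ → Bool := pairTest 1985 66
  17229181910331661980082718446501029803556334587807681474922147732975565442596261878325419171905361016588875497782734755888397027219167440631518371686836191131905989660831759264585170908795928066757888508698102042464554522721597358884467518607275467881324979126311745773226167072180006141832504872363223615934180782919220666606417577819803913859165375319400252861169399234749736160047279847619683361827141279494818482980788615022783350629832268448549124721301284938947625301015977363156845463000833530747601227143726579089479782664225000116897134111677246051197588767047032465982810727433225708074753920347070704526667641607538873289196374376837814453271222921813207009003074184703600481232277467654426460160

/-- The parity test for the faces below the set with mask `15`. -/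
noncomputable def edgeFace15 : ℕ → Bool := faceTest 2064384 3 [2064384] [1835008, 1245184, 688128,
  360448]

/-- The parity test for the faces below the set with mask `23`. -/
noncomputable def edgeFace23 : ℕ → Bool := faceTest 1863680 3 [1863680] [1835008, 1073152, 544768,
  274432]

/-- The parity test for the faces below the set with mask `30`. -/
noncomputable def edgeFace30 : ℕ → Bool := faceTest 374784 3 [374784] [360448, 274432, 75776,
  38912]

/-- The parity test for the faces below the set with mask `31`. -/
noncomputable def edgeFace31 : ℕ → Bool := faceTest 2095104 4 [2064384, 1863680, 1271808, 710656,
  374784] [1835008, 1245184, 688128, 360448, 1073152, 544768, 274432, 149504, 75776, 38912,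
  2095104]

/-- The parity test for the faces below the set with mask `39`. -/
noncomputable def edgeFace39 : ℕ → Bool := faceTest 1836800 3 [1836800] [1835008, 1050112, 525568,
  262912]

/-- The parity test for the faces below the set with mask `43`. -/
noncomputable def edgeFace43 : ℕ → Bool := faceTest 1246848 3 [1246848] [1245184, 1050112, 132224,
  66176]

/-- The parity test for the faces below the set with mask `45`. -/
noncomputable def edgeFace45 : ℕ → Bool := faceTest 689536 3 [689536] [688128, 525568, 132224,
  33152]

/-- The parity test for the faces below the set with mask `46`. -/
noncomputable def edgeFace46 : ℕ → Bool := faceTest 361344 3 [361344] [360448, 262912, 66176,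
  33152]

/-- The parity test for the faces below the set with mask `47`. -/
noncomputable def edgeFace47 : ℕ → Bool := faceTest 2066304 4 [2064384, 1836800, 1246848, 689536,
  361344] [1835008, 1245184, 688128, 360448, 1050112, 525568, 262912, 132224, 66176, 33152,
  2066304]

/-- The parity test for the faces below the set with mask `51`. -/
noncomputable def edgeFace51 : ℕ → Bool := faceTest 1074752 3 [1074752] [1073152, 1050112, 17472,
  8768]

/-- The parity test for the faces below the set with mask `53`. -/
noncomputable def edgeFace53 : ℕ → Bool := faceTest 546112 3 [546112] [544768, 525568, 17472,
  4416]

/-- The parity test for the faces below the set with mask `55`. -/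
noncomputable def edgeFace55 : ℕ → Bool := faceTest 1865536 4 [1863680, 1836800, 1074752, 546112,
  275264] [1835008, 1073152, 544768, 274432, 1050112, 525568, 262912, 17472, 8768, 4416, 1865536]

/-- The parity test for the faces below the set with mask `59`. -/
noncomputable def edgeFace59 : ℕ → Bool := faceTest 1273536 4 [1271808, 1246848, 1074752, 150720,
  76480] [1245184, 1073152, 149504, 75776, 1050112, 132224, 66176, 17472, 8768, 2240, 1273536]

/-- The parity test for the faces below the set with mask `60`. -/
noncomputable def edgeFace60 : ℕ → Bool := faceTest 39360 3 [39360] [38912, 33152, 4416, 2240]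

/-- The parity test for the faces below the set with mask `62`. -/
noncomputable def edgeFace62 : ℕ → Bool := faceTest 375744 4 [374784, 361344, 275264, 76480,
  39360] [360448, 274432, 75776, 38912, 262912, 66176, 33152, 8768, 4416, 2240, 375744]

/-- The parity test for the faces below the set with mask `63`. -/
noncomputable def edgeFace63 : ℕ → Bool := faceTest 2097088 5 [2064384, 1863680, 1271808, 710656,
  374784, 1836800, 1246848, 689536, 361344, 1074752, 546112, 275264, 150720, 76480, 39360,
  2097088] [1835008, 1245184, 688128, 360448, 1073152, 544768, 274432, 149504, 75776, 38912,
  2095104, 1050112, 525568, 262912, 132224, 66176, 33152, 2066304, 17472, 8768, 4416, 1865536,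
  2240, 1273536, 712128, 375744]

/-- The parity test for the faces below the set with mask `71`. -/
noncomputable def edgeFace71 : ℕ → Bool := faceTest 1835064 3 [1835064] [1835008, 1048624, 524328,
  262168]

/-- The parity test for the faces below the set with mask `75`. -/
noncomputable def edgeFace75 : ℕ → Bool := faceTest 1245236 3 [1245236] [1245184, 1048624, 131108,
  65556]

/-- The parity test for the faces below the set with mask `77`. -/
noncomputable def edgeFace77 : ℕ → Bool := faceTest 688172 3 [688172] [688128, 524328, 131108,
  32780]

/-- The parity test for the faces below the set with mask `78`. -/
noncomputable def edgeFace78 : ℕ → Bool := faceTest 360476 3 [360476] [360448, 262168, 65556,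
  32780]

/-- The parity test for the faces below the set with mask `79`. -/
noncomputable def edgeFace79 : ℕ → Bool := faceTest 2064444 4 [2064384, 1835064, 1245236, 688172,
  360476] [1835008, 1245184, 688128, 360448, 1048624, 524328, 262168, 131108, 65556, 32780,
  2064444]

/-- The parity test for the faces below the set with mask `85`. -/
noncomputable def edgeFace85 : ℕ → Bool := faceTest 544810 3 [544810] [544768, 524328, 16418,
  4106]

/-- The parity test for the faces below the set with mask `87`. -/
noncomputable def edgeFace87 : ℕ → Bool := faceTest 1863738 4 [1863680, 1835064, 1073202, 544810,
  274458] [1835008, 1073152, 544768, 274432, 1048624, 524328, 262168, 16418, 8210, 4106, 1863738]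

/-- The parity test for the faces below the set with mask `89`. -/
noncomputable def edgeFace89 : ℕ → Bool := faceTest 149542 3 [149542] [149504, 131108, 16418,
  2054]

/-- The parity test for the faces below the set with mask `90`. -/
noncomputable def edgeFace90 : ℕ → Bool := faceTest 75798 3 [75798] [75776, 65556, 8210, 2054]

/-- The parity test for the faces below the set with mask `91`. -/
noncomputable def edgeFace91 : ℕ → Bool := faceTest 1271862 4 [1271808, 1245236, 1073202, 149542,
  75798] [1245184, 1073152, 149504, 75776, 1048624, 131108, 65556, 16418, 8210, 2054, 1271862]

/-- The parity test for the faces below the set with mask `92`. -/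
noncomputable def edgeFace92 : ℕ → Bool := faceTest 38926 3 [38926] [38912, 32780, 4106, 2054]

/-- The parity test for the faces below the set with mask `94`. -/
noncomputable def edgeFace94 : ℕ → Bool := faceTest 374814 4 [374784, 360476, 274458, 75798,
  38926] [360448, 274432, 75776, 38912, 262168, 65556, 32780, 8210, 4106, 2054, 374814]

/-- The parity test for the faces below the set with mask `95`. -/
noncomputable def edgeFace95 : ℕ → Bool := faceTest 2095166 5 [2064384, 1863680, 1271808, 710656,
  374784, 1835064, 1245236, 688172, 360476, 1073202, 544810, 274458, 149542, 75798, 38926,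
  2095166] [1835008, 1245184, 688128, 360448, 1073152, 544768, 274432, 149504, 75776, 38912,
  2095104, 1048624, 524328, 262168, 131108, 65556, 32780, 2064444, 16418, 8210, 4106, 1863738,
  2054, 1271862, 710702, 374814]

/-- The parity test for the faces below the set with mask `113`. -/
noncomputable def edgeFace113 : ℕ → Bool := faceTest 17507 3 [17507] [17472, 16418, 1057, 67]

/-- The parity test for the faces below the set with mask `114`. -/
noncomputable def edgeFace114 : ℕ → Bool := faceTest 8787 3 [8787] [8768, 8210, 529, 67]

/-- The parity test for the faces below the set with mask `116`. -/
noncomputable def edgeFace116 : ℕ → Bool := faceTest 4427 3 [4427] [4416, 4106, 265, 67]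

/-- The parity test for the faces below the set with mask `120`. -/
noncomputable def edgeFace120 : ℕ → Bool := faceTest 2247 3 [2247] [2240, 2054, 133, 67]

/-- The parity test for the faces below the set with mask `121`. -/
noncomputable def edgeFace121 : ℕ → Bool := faceTest 150759 4 [150720, 149542, 132261, 17507,
  2247] [149504, 132224, 17472, 2240, 131108, 16418, 2054, 1057, 133, 67, 150759]

/-- The parity test for the faces below the set with mask `122`. -/
noncomputable def edgeFace122 : ℕ → Bool := faceTest 76503 4 [76480, 75798, 66197, 8787, 2247]
  [75776, 66176, 8768, 2240, 65556, 8210, 2054, 529, 133, 67, 76503]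

/-- The parity test for the faces below the set with mask `124`. -/
noncomputable def edgeFace124 : ℕ → Bool := faceTest 39375 4 [39360, 38926, 33165, 4427, 2247]
  [38912, 33152, 4416, 2240, 32780, 4106, 2054, 265, 133, 67, 39375]

/-- The parity test for the faces below the set with mask `125`. -/
noncomputable def edgeFace125 : ℕ → Bool := faceTest 712175 5 [710656, 689536, 546112, 150720,
  39360, 688172, 544810, 149542, 38926, 525609, 132261, 33165, 17507, 4427, 2247, 712175] [688128,
  544768, 149504, 38912, 525568, 132224, 33152, 17472, 4416, 2240, 712128, 524328, 131108, 32780,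
  16418, 4106, 2054, 710702, 1057, 265, 133, 689581, 67, 546155, 150759, 39375]

/-- The parity test for the faces below the set with mask `126`. -/
noncomputable def edgeFace126 : ℕ → Bool := faceTest 375775 5 [374784, 361344, 275264, 76480,
  39360, 360476, 274458, 75798, 38926, 262937, 66197, 33165, 8787, 4427, 2247, 375775] [360448,
  274432, 75776, 38912, 262912, 66176, 33152, 8768, 4416, 2240, 375744, 262168, 65556, 32780,
  8210, 4106, 2054, 374814, 529, 265, 133, 361373, 67, 275291, 76503, 39375]

/-- The parity test for the faces below the set with mask `127`. -/
noncomputable def edgeFace127 : ℕ → Bool := faceTest 2097151 6 [2064384, 1863680, 1271808, 710656,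
  374784, 1836800, 1246848, 689536, 361344, 1074752, 546112, 275264, 150720, 76480, 39360,
  2097088, 1835064, 1245236, 688172, 360476, 1073202, 544810, 274458, 149542, 75798, 38926,
  2095166, 1050161, 525609, 262937, 132261, 66197, 33165, 2066365, 17507, 8787, 4427, 1865595,
  2247, 1273591, 712175, 375775] [1835008, 1245184, 688128, 360448, 1073152, 544768, 274432,
  149504, 75776, 38912, 2095104, 1050112, 525568, 262912, 132224, 66176, 33152, 2066304, 17472,
  8768, 4416, 1865536, 2240, 1273536, 712128, 375744, 1048624, 524328, 262168, 131108, 65556,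
  32780, 2064444, 16418, 8210, 4106, 1863738, 2054, 1271862, 710702, 374814, 1057, 529, 265,
  1836857, 133, 1246901, 689581, 361373, 67, 1074803, 546155, 275291, 150759, 76503, 39375,
  2097151]

/-- The tests applied when the lowest `0` bits are undecided. -/
noncomputable def edgeTest0 : ℕ → Bool := both edgeCore32 (both edgeFace113 (both edgeFace122
  (both edgeFace116 (both edgeFace121 (both edgeFace125 (both edgeFace114 (both edgeFace120 (both
  edgeFace124 (both edgeFace126 edgeFace127)))))))))

theorem accepts_edgeTest0 : Accepts (EdgeCandidate edgeMasks) edgeMasks 0 edgeTest0 :=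
Accepts.both (accepts_pairTest (X := 32) (fun _ h => h.good) enumerates_edgeMasks (by decide) rfl
    (by decide +kernel)) <|
Accepts.both (accepts_faceTest (W := 113) (fun _ h => h.good) enumerates_edgeMasks (by decide) (by
    decide +kernel)) <|
Accepts.both (accepts_faceTest (W := 122) (fun _ h => h.good) enumerates_edgeMasks (by decide) (by
    decide +kernel)) <|
Accepts.both (accepts_faceTest (W := 116) (fun _ h => h.good) enumerates_edgeMasks (by decide) (by
    decide +kernel)) <|
Accepts.both (accepts_faceTest (W := 121) (fun _ h => h.good) enumerates_edgeMasks (by decide) (by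
    decide +kernel)) <|
Accepts.both (accepts_faceTest (W := 125) (fun _ h => h.good) enumerates_edgeMasks (by decide) (by
    decide +kernel)) <|
Accepts.both (accepts_faceTest (W := 114) (fun _ h => h.good) enumerates_edgeMasks (by decide) (by
    decide +kernel)) <|
Accepts.both (accepts_faceTest (W := 120) (fun _ h => h.good) enumerates_edgeMasks (by decide) (by
    decide +kernel)) <|
Accepts.both (accepts_faceTest (W := 124) (fun _ h => h.good) enumerates_edgeMasks (by decide) (by
    decide +kernel)) <|
Accepts.both (accepts_faceTest (W := 126) (fun _ h => h.good) enumerates_edgeMasks (by decide) (by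
    decide +kernel)) <|
accepts_faceTest (W := 127) (fun _ h => h.good) enumerates_edgeMasks (by decide) (by
    decide +kernel)

/-- The tests applied when the lowest `1` bits are undecided. -/
noncomputable def edgeTest1 : ℕ → Bool := both edgeCore16 (both edgeFace89 (both edgeFace94 (both
  edgeFace90 (both edgeFace92 (both edgeFace85 (both edgeFace91 (both edgeFace87 edgeFace95)))))))

theorem accepts_edgeTest1 : Accepts (EdgeCandidate edgeMasks) edgeMasks 1 edgeTest1 :=
Accepts.both (accepts_pairTest (X := 16) (fun _ h => h.good) enumerates_edgeMasks (by decide) rfl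
    (by decide +kernel)) <|
Accepts.both (accepts_faceTest (W := 89) (fun _ h => h.good) enumerates_edgeMasks (by decide) (by
    decide +kernel)) <|
Accepts.both (accepts_faceTest (W := 94) (fun _ h => h.good) enumerates_edgeMasks (by decide) (by
    decide +kernel)) <|
Accepts.both (accepts_faceTest (W := 90) (fun _ h => h.good) enumerates_edgeMasks (by decide) (by
    decide +kernel)) <|
Accepts.both (accepts_faceTest (W := 92) (fun _ h => h.good) enumerates_edgeMasks (by decide) (by
    decide +kernel)) <|
Accepts.both (accepts_faceTest (W := 85) (fun _ h => h.good) enumerates_edgeMasks (by decide) (by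
    decide +kernel)) <|
Accepts.both (accepts_faceTest (W := 91) (fun _ h => h.good) enumerates_edgeMasks (by decide) (by
    decide +kernel)) <|
Accepts.both (accepts_faceTest (W := 87) (fun _ h => h.good) enumerates_edgeMasks (by decide) (by
    decide +kernel)) <|
accepts_faceTest (W := 95) (fun _ h => h.good) enumerates_edgeMasks (by decide) (by
    decide +kernel)

/-- The tests applied when the lowest `2` bits are undecided. -/
noncomputable def edgeTest2 : ℕ → Bool := both edgeCore8 (both edgeFace77 (both edgeFace78 (both
  edgeFace75 edgeFace79)))

theorem accepts_edgeTest2 : Accepts (EdgeCandidate edgeMasks) edgeMasks 2 edgeTest2 :=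
Accepts.both (accepts_pairTest (X := 8) (fun _ h => h.good) enumerates_edgeMasks (by decide) rfl
    (by decide +kernel)) <|
Accepts.both (accepts_faceTest (W := 77) (fun _ h => h.good) enumerates_edgeMasks (by decide) (by
    decide +kernel)) <|
Accepts.both (accepts_faceTest (W := 78) (fun _ h => h.good) enumerates_edgeMasks (by decide) (by
    decide +kernel)) <|
Accepts.both (accepts_faceTest (W := 75) (fun _ h => h.good) enumerates_edgeMasks (by decide) (by
    decide +kernel)) <|
accepts_faceTest (W := 79) (fun _ h => h.good) enumerates_edgeMasks (by decide) (by
    decide +kernel)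

/-- The tests applied when the lowest `3` bits are undecided. -/
noncomputable def edgeTest3 : ℕ → Bool := both edgeCore4 edgeFace71

theorem accepts_edgeTest3 : Accepts (EdgeCandidate edgeMasks) edgeMasks 3 edgeTest3 :=
Accepts.both (accepts_pairTest (X := 4) (fun _ h => h.good) enumerates_edgeMasks (by decide) rfl
    (by decide +kernel)) <|
accepts_faceTest (W := 71) (fun _ h => h.good) enumerates_edgeMasks (by decide) (by
    decide +kernel)

/-- The tests applied when the lowest `4` bits are undecided. -/
noncomputable def edgeTest4 : ℕ → Bool := edgeCore2

theorem accepts_edgeTest4 : Accepts (EdgeCandidate edgeMasks) edgeMasks 4 edgeTest4 :=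
accepts_pairTest (X := 2) (fun _ h => h.good) enumerates_edgeMasks (by decide) rfl (by
    decide +kernel)

/-- The tests applied when the lowest `5` bits are undecided. -/
noncomputable def edgeTest5 : ℕ → Bool := edgeCore1

theorem accepts_edgeTest5 : Accepts (EdgeCandidate edgeMasks) edgeMasks 5 edgeTest5 :=
accepts_pairTest (X := 1) (fun _ h => h.good) enumerates_edgeMasks (by decide) rfl (by
    decide +kernel)

/-- The tests applied when the lowest `6` bits are undecided. -/
noncomputable def edgeTest6 : ℕ → Bool := both (lexTest [(1048576, 1048576), (524288, 524288),
  (262144, 262144), (131072, 131072), (65536, 65536), (32768, 32768), (16384, 1024), (8192, 512),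
  (4096, 256), (2048, 128), (1024, 16384), (512, 8192), (256, 4096), (128, 2048)]) (both (lexTest
  [(1048576, 524288), (524288, 1048576), (262144, 262144), (131072, 16384), (65536, 4096), (32768,
  8192), (16384, 131072), (8192, 32768), (4096, 65536), (2048, 2048), (1024, 1024), (512, 256),
  (256, 512), (128, 64), (64, 128)]) (both (lexTest [(1048576, 1048576), (524288, 131072),
  (262144, 65536), (131072, 524288), (65536, 262144), (32768, 32768), (16384, 16384), (8192,
  8192), (4096, 2048), (2048, 4096), (1024, 1024), (512, 512), (256, 128), (128, 256)]) (both
  (lexTest [(1048576, 1048576), (524288, 262144), (262144, 524288), (131072, 8192), (65536,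
  16384), (32768, 4096), (16384, 65536), (8192, 131072), (4096, 32768), (2048, 2048), (1024, 512),
  (512, 1024), (256, 256), (128, 64), (64, 128)]) (both edgeFace51 (both edgeFace53 (both
  edgeFace62 (both (lexTest [(1048576, 524288), (524288, 262144), (262144, 1048576), (131072,
  32768), (65536, 131072), (32768, 65536), (16384, 256), (8192, 1024), (4096, 512), (2048, 128),
  (1024, 4096), (512, 16384), (256, 8192), (128, 2048)]) (both (lexTest [(1048576, 16384),
  (524288, 131072), (262144, 2048), (131072, 1048576), (65536, 8192), (32768, 65536), (16384,
  524288), (8192, 4096), (4096, 32768), (2048, 262144), (1024, 1024), (512, 64), (256, 128), (128,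
  512), (64, 256)]) (both (lexTest [(1048576, 1048576), (524288, 262144), (262144, 524288),
  (131072, 65536), (65536, 131072), (32768, 32768), (16384, 8192), (8192, 16384), (4096, 4096),
  (2048, 2048), (1024, 512), (512, 1024)]) (both (lexTest [(1048576, 262144), (524288, 1048576),
  (262144, 524288), (131072, 512), (65536, 256), (32768, 1024), (16384, 65536), (8192, 32768),
  (4096, 131072), (2048, 128), (1024, 8192), (512, 4096), (256, 16384), (128, 64), (64, 2048)])
  (both edgeFace59 (both edgeFace60 (both (lexTest [(1048576, 1048576), (524288, 524288), (262144,
  262144), (131072, 16384), (65536, 8192), (32768, 4096), (16384, 131072), (8192, 65536), (4096,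
  32768), (2048, 2048), (1024, 1024), (512, 512), (256, 256), (128, 64), (64, 128)]) (both
  edgeFace55 edgeFace63))))))))))))))

theorem accepts_edgeTest6 : Accepts (EdgeCandidate edgeMasks) edgeMasks 6 edgeTest6 :=
Accepts.both (accepts_lexTest_edge (p := [0, 1, 2, 3, 5, 4, 6]) (by decide) (by decide +kernel))
    <|
Accepts.both (accepts_lexTest_edge (p := [0, 2, 1, 4, 3, 5, 6]) (by decide) (by decide +kernel))
    <|
Accepts.both (accepts_lexTest_edge (p := [0, 1, 3, 2, 4, 5, 6]) (by decide) (by decide +kernel))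
    <|
Accepts.both (accepts_lexTest_edge (p := [1, 0, 2, 4, 3, 5, 6]) (by decide) (by decide +kernel))
    <|
Accepts.both (accepts_faceTest (W := 51) (fun _ h => h.good) enumerates_edgeMasks (by decide) (by
    decide +kernel)) <|
Accepts.both (accepts_faceTest (W := 53) (fun _ h => h.good) enumerates_edgeMasks (by decide) (by
    decide +kernel)) <|
Accepts.both (accepts_faceTest (W := 62) (fun _ h => h.good) enumerates_edgeMasks (by decide) (by
    decide +kernel)) <|
Accepts.both (accepts_lexTest_edge (p := [2, 0, 1, 3, 5, 4, 6]) (by decide) (by decide +kernel))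
    <|
Accepts.both (accepts_lexTest_edge (p := [0, 4, 3, 1, 2, 5, 6]) (by decide) (by decide +kernel))
    <|
Accepts.both (accepts_lexTest_edge (p := [1, 0, 2, 3, 4, 5, 6]) (by decide) (by decide +kernel))
    <|
Accepts.both (accepts_lexTest_edge (p := [1, 2, 0, 5, 3, 4, 6]) (by decide) (by decide +kernel))
    <|
Accepts.both (accepts_faceTest (W := 59) (fun _ h => h.good) enumerates_edgeMasks (by decide) (by
    decide +kernel)) <|
Accepts.both (accepts_faceTest (W := 60) (fun _ h => h.good) enumerates_edgeMasks (by decide) (by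
    decide +kernel)) <|
Accepts.both (accepts_lexTest_edge (p := [0, 1, 2, 4, 3, 5, 6]) (by decide) (by decide +kernel))
    <|
Accepts.both (accepts_faceTest (W := 55) (fun _ h => h.good) enumerates_edgeMasks (by decide) (by
    decide +kernel)) <|
accepts_faceTest (W := 63) (fun _ h => h.good) enumerates_edgeMasks (by decide) (by
    decide +kernel)

/-- The tests applied when the lowest `7` bits are undecided. -/
noncomputable def edgeTest7 : ℕ → Bool := both edgeFace45 (both edgeFace43 (both edgeFace46
  edgeFace47))

theorem accepts_edgeTest7 : Accepts (EdgeCandidate edgeMasks) edgeMasks 7 edgeTest7 :=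
Accepts.both (accepts_faceTest (W := 45) (fun _ h => h.good) enumerates_edgeMasks (by decide) (by
    decide +kernel)) <|
Accepts.both (accepts_faceTest (W := 43) (fun _ h => h.good) enumerates_edgeMasks (by decide) (by
    decide +kernel)) <|
Accepts.both (accepts_faceTest (W := 46) (fun _ h => h.good) enumerates_edgeMasks (by decide) (by
    decide +kernel)) <|
accepts_faceTest (W := 47) (fun _ h => h.good) enumerates_edgeMasks (by decide) (by
    decide +kernel)

/-- The tests applied when the lowest `8` bits are undecided. -/
noncomputable def edgeTest8 : ℕ → Bool := edgeFace39

theorem accepts_edgeTest8 : Accepts (EdgeCandidate edgeMasks) edgeMasks 8 edgeTest8 :=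
accepts_faceTest (W := 39) (fun _ h => h.good) enumerates_edgeMasks (by decide) (by
    decide +kernel)

/-- The tests applied when the lowest `11` bits are undecided. -/
noncomputable def edgeTest11 : ℕ → Bool := both (lexTest [(1048576, 1048576), (524288, 524288),
  (262144, 262144), (131072, 16384), (65536, 8192), (32768, 4096), (16384, 131072), (8192, 65536),
  (4096, 32768)]) (both (lexTest [(1048576, 1048576), (524288, 65536), (262144, 131072), (131072,
  262144), (65536, 524288), (32768, 32768), (16384, 8192), (8192, 16384), (4096, 2048), (2048,
  4096)]) (both (lexTest [(1048576, 524288), (524288, 131072), (262144, 32768), (131072, 1048576),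
  (65536, 262144), (32768, 65536), (16384, 16384), (8192, 4096), (4096, 2048), (2048, 8192)])
  (both edgeFace31 (both (lexTest [(1048576, 524288), (524288, 262144), (262144, 1048576),
  (131072, 4096), (65536, 16384), (32768, 8192), (16384, 32768), (8192, 131072), (4096, 65536)])
  (both (lexTest [(1048576, 32768), (524288, 524288), (262144, 131072), (131072, 262144), (65536,
  65536), (32768, 1048576), (16384, 4096), (8192, 2048), (4096, 16384), (2048, 8192)]) (both
  edgeFace30 (lexTest [(1048576, 1048576), (524288, 131072), (262144, 65536), (131072, 524288),
  (65536, 262144), (32768, 32768), (16384, 16384), (8192, 8192), (4096, 2048), (2048,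
  4096)])))))))

theorem accepts_edgeTest11 : Accepts (EdgeCandidate edgeMasks) edgeMasks 11 edgeTest11 :=
Accepts.both (accepts_lexTest_edge (p := [0, 1, 2, 4, 3, 5, 6]) (by decide) (by decide +kernel))
    <|
Accepts.both (accepts_lexTest_edge (p := [1, 0, 3, 2, 4, 5, 6]) (by decide) (by decide +kernel))
    <|
Accepts.both (accepts_lexTest_edge (p := [0, 2, 3, 1, 4, 5, 6]) (by decide) (by decide +kernel))
    <|
Accepts.both (accepts_faceTest (W := 31) (fun _ h => h.good) enumerates_edgeMasks (by decide) (by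
    decide +kernel)) <|
Accepts.both (accepts_lexTest_edge (p := [2, 0, 1, 4, 3, 5, 6]) (by decide) (by decide +kernel))
    <|
Accepts.both (accepts_lexTest_edge (p := [2, 3, 0, 1, 4, 5, 6]) (by decide) (by decide +kernel))
    <|
Accepts.both (accepts_faceTest (W := 30) (fun _ h => h.good) enumerates_edgeMasks (by decide) (by
    decide +kernel)) <|
accepts_lexTest_edge (p := [0, 1, 3, 2, 4, 5, 6]) (by decide) (by decide +kernel)

/-- The tests applied when the lowest `12` bits are undecided. -/
noncomputable def edgeTest12 : ℕ → Bool := edgeFace23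

theorem accepts_edgeTest12 : Accepts (EdgeCandidate edgeMasks) edgeMasks 12 edgeTest12 :=
accepts_faceTest (W := 23) (fun _ h => h.good) enumerates_edgeMasks (by decide) (by
    decide +kernel)

/-- The tests applied when the lowest `15` bits are undecided. -/
noncomputable def edgeTest15 : ℕ → Bool := both (lexTest [(1048576, 1048576), (524288, 131072),
  (262144, 65536), (131072, 524288), (65536, 262144)]) (both (lexTest [(1048576, 524288), (524288,
  1048576), (262144, 262144), (131072, 131072), (65536, 32768), (32768, 65536)]) (both (lexTest
  [(1048576, 1048576), (524288, 262144), (262144, 524288), (131072, 65536), (65536, 131072)])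
  edgeFace15))

theorem accepts_edgeTest15 : Accepts (EdgeCandidate edgeMasks) edgeMasks 15 edgeTest15 :=
Accepts.both (accepts_lexTest_edge (p := [0, 1, 3, 2, 4, 5, 6]) (by decide) (by decide +kernel))
    <|
Accepts.both (accepts_lexTest_edge (p := [0, 2, 1, 3, 4, 5, 6]) (by decide) (by decide +kernel))
    <|
Accepts.both (accepts_lexTest_edge (p := [1, 0, 2, 3, 4, 5, 6]) (by decide) (by decide +kernel))
    <|
accepts_faceTest (W := 15) (fun _ h => h.good) enumerates_edgeMasks (by decide) (by
    decide +kernel)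

/-- The tests applied when the lowest `18` bits are undecided. -/
noncomputable def edgeTest18 : ℕ → Bool := both (lexTest [(1048576, 262144), (524288, 1048576),
  (262144, 524288)]) (lexTest [(1048576, 524288), (524288, 1048576)])

theorem accepts_edgeTest18 : Accepts (EdgeCandidate edgeMasks) edgeMasks 18 edgeTest18 :=
Accepts.both (accepts_lexTest_edge (p := [1, 2, 0, 3, 4, 5, 6]) (by decide) (by decide +kernel))
    <|
accepts_lexTest_edge (p := [0, 2, 1, 3, 4, 5, 6]) (by decide) (by decide +kernel)

/-- The face codes of all sets, as a table with `36`-bit entries. -/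
def edgeFaceCodes : ℕ :=
  427336390657268345303457046870589419306540072904293093233604586728548173249786172930425486922231251912429656172960292221244879266747340045988162805383554557499918649633462595732883790516951838468927800945162994718640313291434191637353737219840992013751071587858969386897567518363696561881398202406510128568419847297034099400254216718927542599514130302857403470590468130494897146059694874363849736045188302686748854338744885283566762279178908600113754110758303179928063599951151403924540967212248275673552833611267328773818011293738499407131951919218067435293926214164345432802876767076710235474610669035066003459701329617498661167066418447842671870718429243705398416181301904947457880558571929335618675227703902449001188957569675286661248127046846092027622940929377058329033069806670554266695144151090919705764363822791634624966833526541121586333976806513956307214969887619986809272032670439197793795374073982593722108279506617993867019189017819750302975314422099396351257178587465462422109888675257856702313055956403428940742202823835183157449441455989151354680318109296187841086722213188391608389006585901259371546386194496903075701243960513070340638619795004140885941797546295187151415030335267500777826087832510066105580349505994447880252403788565857662207358802582393615593060895460585226712079174423187983563888090548252498771468626533499724224561701031827951831341853984161792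

/-- The masks of the sets with more than `1` element. -/
def largeEdgeMasks : List ℕ := [3, 5, 6, 7, 9, 10, 11, 12, 13, 14, 15, 17, 18, 19, 20, 21, 22, 23,
  24, 25, 26, 27, 28, 29, 30, 31, 33, 34, 35, 36, 37, 38, 39, 40, 41, 42, 43, 44, 45, 46, 47, 48,
  49, 50, 51, 52, 53, 54, 55, 56, 57, 58, 59, 60, 61, 62, 63, 65, 66, 67, 68, 69, 70, 71, 72, 73,
  74, 75, 76, 77, 78, 79, 80, 81, 82, 83, 84, 85, 86, 87, 88, 89, 90, 91, 92, 93, 94, 95, 96, 97,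
  98, 99, 100, 101, 102, 103, 104, 105, 106, 107, 108, 109, 110, 111, 112, 113, 114, 115, 116,
  117, 118, 119, 120, 121, 122, 123, 124, 125, 126, 127]

theorem faceData_edge : faceData edgeMasks 1 edgeFaceCodes largeEdgeMasks = true := by
  decide +kernel

/-- The solutions for the families that pass all tests. -/
def edgeSolutions : SearchTree :=
  .leaf

/-- The search once all bits are decided. -/
noncomputable def edgeSearch0 : ℕ → Bool := leafTest 1 edgeFaceCodes largeEdgeMasks []
  edgeSolutions

theorem certifies_edgeSearch0 :
    Certifies (EdgeCandidate edgeMasks) (Sol 1) edgeMasks 0 edgeSearch0 :=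
  certifies_leafTest enumerates_edgeMasks faceData_edge _

/-- The search when the lowest `1` bits are undecided. -/
noncomputable def edgeSearch1 : ℕ → Bool := branch 1 edgeTest0 edgeSearch0

theorem certifies_edgeSearch1 :
    Certifies (EdgeCandidate edgeMasks) (Sol 1) edgeMasks 1 edgeSearch1 :=
  certifies_edgeSearch0.branch accepts_edgeTest0

/-- The search when the lowest `2` bits are undecided. -/
noncomputable def edgeSearch2 : ℕ → Bool := branch 2 edgeTest1 edgeSearch1

theorem certifies_edgeSearch2 :
    Certifies (EdgeCandidate edgeMasks) (Sol 1) edgeMasks 2 edgeSearch2 :=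
  certifies_edgeSearch1.branch accepts_edgeTest1

/-- The search when the lowest `3` bits are undecided. -/
noncomputable def edgeSearch3 : ℕ → Bool := branch 4 edgeTest2 edgeSearch2

theorem certifies_edgeSearch3 :
    Certifies (EdgeCandidate edgeMasks) (Sol 1) edgeMasks 3 edgeSearch3 :=
  certifies_edgeSearch2.branch accepts_edgeTest2

/-- The search when the lowest `4` bits are undecided. -/
noncomputable def edgeSearch4 : ℕ → Bool := branch 8 edgeTest3 edgeSearch3

theorem certifies_edgeSearch4 :
    Certifies (EdgeCandidate edgeMasks) (Sol 1) edgeMasks 4 edgeSearch4 :=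
  certifies_edgeSearch3.branch accepts_edgeTest3

/-- The search when the lowest `5` bits are undecided. -/
noncomputable def edgeSearch5 : ℕ → Bool := branch 16 edgeTest4 edgeSearch4

theorem certifies_edgeSearch5 :
    Certifies (EdgeCandidate edgeMasks) (Sol 1) edgeMasks 5 edgeSearch5 :=
  certifies_edgeSearch4.branch accepts_edgeTest4

/-- The search when the lowest `6` bits are undecided. -/
noncomputable def edgeSearch6 : ℕ → Bool := branch 32 edgeTest5 edgeSearch5

theorem certifies_edgeSearch6 :
    Certifies (EdgeCandidate edgeMasks) (Sol 1) edgeMasks 6 edgeSearch6 :=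
  certifies_edgeSearch5.branch accepts_edgeTest5

/-- The search when the lowest `7` bits are undecided. -/
noncomputable def edgeSearch7 : ℕ → Bool := branch 64 edgeTest6 edgeSearch6

theorem certifies_edgeSearch7 :
    Certifies (EdgeCandidate edgeMasks) (Sol 1) edgeMasks 7 edgeSearch7 :=
  certifies_edgeSearch6.branch accepts_edgeTest6

/-- The search when the lowest `8` bits are undecided. -/
noncomputable def edgeSearch8 : ℕ → Bool := branch 128 edgeTest7 edgeSearch7

theorem certifies_edgeSearch8 :
    Certifies (EdgeCandidate edgeMasks) (Sol 1) edgeMasks 8 edgeSearch8 :=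
  certifies_edgeSearch7.branch accepts_edgeTest7

/-- The search when the lowest `9` bits are undecided. -/
noncomputable def edgeSearch9 : ℕ → Bool := branch 256 edgeTest8 edgeSearch8

theorem certifies_edgeSearch9 :
    Certifies (EdgeCandidate edgeMasks) (Sol 1) edgeMasks 9 edgeSearch9 :=
  certifies_edgeSearch8.branch accepts_edgeTest8

/-- The search when the lowest `10` bits are undecided. -/
noncomputable def edgeSearch10 : ℕ → Bool := branch 512 (fun _ => true) edgeSearch9

theorem certifies_edgeSearch10 :
    Certifies (EdgeCandidate edgeMasks) (Sol 1) edgeMasks 10 edgeSearch10 :=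
  certifies_edgeSearch9.branch accepts_true

/-- The search when the lowest `11` bits are undecided. -/
noncomputable def edgeSearch11 : ℕ → Bool := branch 1024 (fun _ => true) edgeSearch10

theorem certifies_edgeSearch11 :
    Certifies (EdgeCandidate edgeMasks) (Sol 1) edgeMasks 11 edgeSearch11 :=
  certifies_edgeSearch10.branch accepts_true

/-- The search when the lowest `12` bits are undecided. -/
noncomputable def edgeSearch12 : ℕ → Bool := branch 2048 edgeTest11 edgeSearch11

theorem certifies_edgeSearch12 :
    Certifies (EdgeCandidate edgeMasks) (Sol 1) edgeMasks 12 edgeSearch12 :=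
  certifies_edgeSearch11.branch accepts_edgeTest11

/-- The search when the lowest `13` bits are undecided. -/
noncomputable def edgeSearch13 : ℕ → Bool := branch 4096 edgeTest12 edgeSearch12

theorem certifies_edgeSearch13 :
    Certifies (EdgeCandidate edgeMasks) (Sol 1) edgeMasks 13 edgeSearch13 :=
  certifies_edgeSearch12.branch accepts_edgeTest12

/-- The search when the lowest `14` bits are undecided. -/
noncomputable def edgeSearch14 : ℕ → Bool := branch 8192 (fun _ => true) edgeSearch13

theorem certifies_edgeSearch14 :
    Certifies (EdgeCandidate edgeMasks) (Sol 1) edgeMasks 14 edgeSearch14 :=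
  certifies_edgeSearch13.branch accepts_true

/-- The search when the lowest `15` bits are undecided. -/
noncomputable def edgeSearch15 : ℕ → Bool := branch 16384 (fun _ => true) edgeSearch14

theorem certifies_edgeSearch15 :
    Certifies (EdgeCandidate edgeMasks) (Sol 1) edgeMasks 15 edgeSearch15 :=
  certifies_edgeSearch14.branch accepts_true

/-- The search when the lowest `16` bits are undecided. -/
noncomputable def edgeSearch16 : ℕ → Bool := branch 32768 edgeTest15 edgeSearch15

theorem certifies_edgeSearch16 :
    Certifies (EdgeCandidate edgeMasks) (Sol 1) edgeMasks 16 edgeSearch16 :=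
  certifies_edgeSearch15.branch accepts_edgeTest15

/-- The search when the lowest `17` bits are undecided. -/
noncomputable def edgeSearch17 : ℕ → Bool := branch 65536 (fun _ => true) edgeSearch16

theorem certifies_edgeSearch17 :
    Certifies (EdgeCandidate edgeMasks) (Sol 1) edgeMasks 17 edgeSearch17 :=
  certifies_edgeSearch16.branch accepts_true

/-- The search when the lowest `18` bits are undecided. -/
noncomputable def edgeSearch18 : ℕ → Bool := branch 131072 (fun _ => true) edgeSearch17

theorem certifies_edgeSearch18 :
    Certifies (EdgeCandidate edgeMasks) (Sol 1) edgeMasks 18 edgeSearch18 :=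
  certifies_edgeSearch17.branch accepts_true

/-- The search when the lowest `19` bits are undecided. -/
noncomputable def edgeSearch19 : ℕ → Bool := branch 262144 edgeTest18 edgeSearch18

theorem certifies_edgeSearch19 :
    Certifies (EdgeCandidate edgeMasks) (Sol 1) edgeMasks 19 edgeSearch19 :=
  certifies_edgeSearch18.branch accepts_edgeTest18

/-- The search when the lowest `20` bits are undecided. -/
noncomputable def edgeSearch20 : ℕ → Bool := branch 524288 (fun _ => true) edgeSearch19

theorem certifies_edgeSearch20 :
    Certifies (EdgeCandidate edgeMasks) (Sol 1) edgeMasks 20 edgeSearch20 :=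
  certifies_edgeSearch19.branch accepts_true

/-- The search when the lowest `21` bits are undecided. -/
noncomputable def edgeSearch21 : ℕ → Bool := branch 1048576 (fun _ => true) edgeSearch20

theorem certifies_edgeSearch21 :
    Certifies (EdgeCandidate edgeMasks) (Sol 1) edgeMasks 21 edgeSearch21 :=
  certifies_edgeSearch20.branch accepts_true

theorem edgeSearch21_eq_true : edgeSearch21 0 = true := by
  decide +kernel

/-- The masks of the sets with 3 elements, in an order suited to the search. -/
def tripleMasks : List ℕ := [67, 69, 73, 81, 97, 70, 74, 82, 98, 76, 84, 100, 88, 104, 112, 56,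
  52, 50, 49, 44, 42, 41, 38, 37, 35, 28, 26, 25, 22, 21, 19, 14, 13, 11, 7]

theorem enumerates_tripleMasks : Enumerates 2 tripleMasks := by
  decide +kernel

/-- The test for a core over the set with mask `6`. -/
noncomputable def tripleCore6 : ℕ → Bool := pairTest 19599982624 33
  1959760015282273397249228865731161239804110924000581542668105635200646431732832418539624978360801584492524389743304272797862698010738183864987013366528521535223948584187921670605666499237735977460668858701207030480813904383446575490411830741651494502262654872696472362071412897843832024013996016523622845581906492080372564278855725583136864289685504

/-- The test for a core over the set with mask `9`. -/
noncomputable def tripleCore9 : ℕ → Bool := pairTest 13021216772 51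
  2454946563957839306474444701892957262554653139524743001901067273311110996547506157542330376483233093232314123406385798600892628613708738668348540262389849516097586829762738566415046362090380797628273392016559452220462393618030877974734104798593390818238155897032445009212382926309602167959663854110742070363797676182078195189444564889245155052059974348299938951929954631658415300728471141938534807819865002191197159015541446355001699165713374206850781374895348118116717076691475772977287275827880457931631792837436085123717542818761371777621931128258560

/-- The test for a core over the set with mask `10`. -/
noncomputable def tripleCore10 : ℕ → Bool := pairTest 10805575744 39
  207730509498372793937156036393580770995844521912050687737695549850892735986268649072097711856967123082504919624056761219064874287592131301643482361102379324616628269547144037262773120987806940324198409312356537526746816348468025307422129955879114397839478338986000261100010548742989192393899732702796322475539482134057450912144245919406995631540134102513894738704143434142845474636355184395775405439744836805802224078815232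

/-- The test for a core over the set with mask `12`. -/
noncomputable def tripleCore12 : ℕ → Bool := pairTest 6476530176 77
  178706305770970684754132596824577112483505945469997236999229055517581458022945214902611269484949966288207635189401245767668120597956307844331363369632619703070722148973496820461055601847589889597619592724246639490596919349033958154863988266766930962378119063336346091760496687441936644552486724308806756638538760014409549397543970932497968591310015794896157335542821200831173689104348395893055587461120265402160729879966350425989739370378165518069230545426540639277339228844296513181996326657429737725282812705724012251384762452459791566041499069348139661377990865511892519102334030131447184686720853234996396671011346605072449070233933720358125788752357926121389271911599791740276095030942022564759500827518041047565191115114655518665321625657372222120561429047156223390445385329169522781836526957905038347499051150792595780690509824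

/-- The test for a core over the set with mask `17`. -/
noncomputable def tripleCore17 : ℕ → Bool := pairTest 1745092616 41
  32665824620457525511658649789257213735617568411236635406625517737512600164456616444873235587154311129077011740599556289127410260381438905243178444693107363980618414804921691201914428974924958750085913326310197983222320202636528173843022401531093127268970252532456042612518191153674797437183272274092328874451394384469619145260031401107259836047707026479342517681588380988376915873508722681680259037428678004632603937061635645666925625997262848

/-- The test for a core over the set with mask `18`. -/
noncomputable def tripleCore18 : ℕ → Bool := pairTest 1409417344 61
  180173329494584674229342500474895550813120794780081984855237167563097086642996301368849091364470431438517543088517307241207022609127875039542912459045016298521617593208413743061065965422036417890885539507551805710399910949807320549963457686534344702087415884690305595892289985355412074954123654677127447993506081225794644727153394154362632875851417437094710855355052589782103105558310870841690779520358259477181989917119183798015726462149853870989439102701552388777809056164076825138450644548141110960650619538716518936430083075580063496851536394812388089445321040942670512016785117422149866607323397761473397143007884341014365077307378429799146147881387294720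

/-- The test for a core over the set with mask `20`. -/
noncomputable def tripleCore20 : ℕ → Bool := pairTest 838927360 43
  4936319850335415393711988656831053497314977942006119108225450495097845089650236188234763147568368734691114923152028012223659777330696091683026487573743580421070618341054182172183946839051609373258616586475142651338874913236613592547459768574163358552440372853814409530332370397587633085224910803011388491408165962099967278647149845996373636442530239973635155949250200047770975280584721920571366019977970100356075688225101050927490743265257258062075941893572028006400

/-- The test for a core over the set with mask `24`. -/
noncomputable def tripleCore24 : ℕ → Bool := pairTest 234917888 77
  1425994941412008725081191106263231069764622760967168954451350136690858324514047147816424202612352635420360650888430395016054368105919449343223271826025768299943689498441796892649374356083904906956918778182359878064766807984039361875895351254544848089306166104216133049595970778001265025774949333539540071971485200563304745697072437329856296693701127727423039246153114008010360478733065296477462658673270024572912458559813995681070048390647207973415558852108841214557181474016833579543657385535850467956829659966759347110093146983724061995203764307522299911676995727963173277641001435853242462820574828087290447666257595675588025690789463043864079263132929758965847634736233664573184460035198293360575238883999560002046400926493529557078530901306276033300679420728506306620477262154380247241616922046790090359334282794636630786083651584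

/-- The test for a core over the set with mask `33`. -/
noncomputable def tripleCore33 : ℕ → Bool := pairTest 27525136 49
  75815019605467332193561860352854726530647794059226171752919236252788990594299447538074096661143754738919557589471181651468240083590978076532925239408044960474908799771296179597355155990929862792779047016431595646271500900717503425319655317933890171333474553465700250416137354730845983550312599427008500618975787973484460933105194516009320449976958968037000695127145044871022641238723114890529428198330861591375805346165275408735635811208549931211171721735302435673246765477790741575795181175819341965569460149144652641983375867904

/-- The test for a core over the set with mask `34`. -/
noncomputable def tripleCore34 : ℕ → Bool := pairTest 22151424 79
  6734070716065733431167250216564168333832640819752450545309890318477182474451597963090533583871902975890468341414143250569495181871201539857191597187668343930545718472195961250423957095163652244729664462669992235446314694089864899459383277867488246500375433548175621093179942708805258003438218668035412318480120478761777873544316291795316858935768801901703170283708774447862641342581686153000842880615257464119087470983708292642747199223458328528254587162486822730343456553700204859405249797026729378761727178188437020469863661165501832385055298631566283346954093994586317013064584724775238721915825675074882252799649374122459581949040951590169151773909561550129129534526893851695642634078059329682841355857326184582743428126559980665977785541378870665120114179978242550110857840497921068276498076672350443223451139176852939457395759843245271991586469707776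

/-- The test for a core over the set with mask `36`. -/
noncomputable def tripleCore36 : ℕ → Bool := pairTest 13174784 53
  92059763891872496315569054414109969668662931044590362887218352701433025014454516380911130257870226855569332588123451669333697535778348013200826645074658945134908345814923470482712624635960991011315782223133194005984788183251438402160845003182109179289194477440918834023204356425548705511611209216354091772738566555993909752129746914059506734667224896247891592276061616031412074709081293596932276370074848179599969379328433509238818391757541049720246180389753663709470636330654887949558666483649509175456441983664473148701249913978764422779839826968060424487304135345963008

/-- The test for a core over the set with mask `40`. -/
noncomputable def tripleCore40 : ℕ → Bool := pairTest 3710976 53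
  11593157370870502131260144632530934572139242008738231620783290004840228635729084127166521206555322887256792827421419759869555027199995144301117906513942253204666788411608851077727601595949002616458719133119736016068305208056139004179581367381348757178810778354244194840509278693317629994463286160294104344520522574584994712661759611249669477142151276465785899350941243021792721367773017466028258235723714363416332376319938942233787334075640556219588687274607755165726637416908036822881964788736527299130974304714838104861431330693452183184203076672805926384137854828146589696

/-- The test for a core over the set with mask `48`. -/
noncomputable def tripleCore48 : ℕ → Bool := pairTest 507904 33
  2004494827343951250506998086118306259820117790527366549299735977691458823751703010795546152861028860321986094817621793330027715291535786310112390358219751560122526171017142018824785894846620535579404371000335769756562032063150906597071471395050819249312245386626990399521456018691939452400283567173634505299632733071908707296026216738553689068714065920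

/-- The test for a core over the set with mask `65`. -/
noncomputable def tripleCore65 : ℕ → Bool := pairTest 31 32
  30586163746868621998021576486799900235207812474796155340203363531449727687534380437552932411879035989806090988841941225422255223214342705336611676215482115967834122023434020289777201431617244368843507667246800750026796401115821035080533812091921979883762446049705372787268455698326993516286562330702435320497244673271091836024093007017750365732864

/-- The test for a core over the set with mask `66`. -/
noncomputable def tripleCore66 : ℕ → Bool := pairTest 481 34
  72219537404967141123436344455452193267154203114707056020782799520330606522817582027131003431074452198097340377932950402596107338792898140784540546451311737973575479985718590684001174552083405890548425622328707208394453045980603032768061992971665056209736607563205868139336791197979489095116974062606609937405599338517416367578892913952133290338739451638291470074511360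

/-- The test for a core over the set with mask `68`. -/
noncomputable def tripleCore68 : ℕ → Bool := pairTest 3618 43
  4936319850343253855996332647270638400215328639045720813792050892644919270465920666743943068432755517446357255363433420494629848640722565649419128822683347781748094680108270787276943858918183829236968653751124590517367429579079352021164152863344930110266886632081041359254866523458331011870219562245714265661143861452238369484333528567097919684857591930571341940952023767554827379597579320391121820042540100536090166983035753168746950894150279434280422102117027676160

/-- The test for a core over the set with mask `72`. -/
noncomputable def tripleCore72 : ℕ → Bool := pairTest 12868 77
  1425994941412008725081191106263231069764622824656761421891150511835684537197202467048492336569374817598285330771354839042695478115741952390377749302960740656101336074483620078501794311550592318095071174769496540631932094873722225967837052770710824862942826956738873823721469697079453335646310856674344616390468889797057441395139755077618570421467349709467659675872594250790159962445822168110019343910402598353781157887962437802633004724129898818878558653485491727025903767661076803449515362039197421632864073246663499369158361182107686595078218728746876752877899646353348072633468733879000358352187110720100857803456700395429173148846809090011630779143267057799945713258292482561763785626319349444914416475325903983414936591535438516865594641890516790113172986077619037985495568296970033166969353542798536967781526550383118746860388352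

/-- The test for a core over the set with mask `80`. -/
noncomputable def tripleCore80 : ℕ → Bool := pairTest 21640 63
  27227023754287711052722990248321500546608671899745191426676674939285509785678813823609977246023110411397265480384459246452167274674546052252618999850061634855335309971364497371833407868696342364012677005350351244468716672422354259970323393556792187570806342587037808991183153466010673548356646547835761730321043705854693797406897338445061725824993778645007989693811609173246450970599081316761105931303720227540763276388584303324291044906547903218031647888960082534006397139581800999081353328460283125347700460374706243155588161490930006939551156465192100959381228305589871587150411360501375470340694277483539367931816930063505103780627645852761078088032620727587342613715379436912640

/-- The test for a core over the set with mask `96`. -/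
noncomputable def tripleCore96 : ℕ → Bool := pairTest 26896 51
  2454946563931066898719815269820913062718039377204364683708946736889036891932289954546258770335790145879396064575632405928198789655816437790270345516932922138734585718271834533472853501744261306681664005864151160239271830856164104192735257753447781311758961089459714572381466775925730737354976290279350339867110923105918075866611015105568066830084177108060912602615045463705889928051923779399935216660458098291315023618068779801361551925384326157004768963114864089698550788750557360969350240705361483683526188899664567872813931370293490485663434864066560

/-- The parity test for the faces below the set with mask `31`. -/
noncomputable def tripleFace31 : ℕ → Bool := faceTest 34326183936 6 [34326183936] [32212254720,
  19058917376, 9865003008, 4999610368, 2516582400]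

/-- The parity test for the faces below the set with mask `47`. -/
noncomputable def tripleFace47 : ℕ → Bool := faceTest 32245284864 6 [32245284864] [32212254720,
  17209229312, 8609857536, 4305977344, 2153250816]

/-- The parity test for the faces below the set with mask `55`. -/
noncomputable def tripleFace55 : ℕ → Bool := faceTest 19088736256 6 [19088736256] [19058917376,
  17209229312, 1090912256, 545587200, 272826368]

/-- The parity test for the faces below the set with mask `59`. -/
noncomputable def tripleFace59 : ℕ → Bool := faceTest 9885351936 6 [9885351936] [9865003008,
  8609857536, 1090912256, 136609792, 68321280]

/-- The parity test for the faces below the set with mask `61`. -/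
noncomputable def tripleFace61 : ℕ → Bool := faceTest 5010980864 6 [5010980864] [4999610368,
  4305977344, 545587200, 136609792, 34177024]

/-- The parity test for the faces below the set with mask `62`. -/
noncomputable def tripleFace62 : ℕ → Bool := faceTest 2522578944 6 [2522578944] [2516582400,
  2153250816, 272826368, 68321280, 34177024]

/-- The parity test for the faces below the set with mask `63`. -/
noncomputable def tripleFace63 : ℕ → Bool := faceTest 34359705600 10 [34326183936, 32245284864,
  19088736256, 9885351936, 5010980864, 2522578944] [32212254720, 19058917376, 9865003008,
  4999610368, 2516582400, 17209229312, 8609857536, 4305977344, 2153250816, 1090912256, 545587200,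
  272826368, 136609792, 68321280, 34177024, 34359705600]

/-- The parity test for the faces below the set with mask `79`. -/
noncomputable def tripleFace79 : ℕ → Bool := faceTest 32212255335 6 [32212255335] [32212254720,
  17179869219, 8589934661, 4294967814, 2147484256]

/-- The parity test for the faces below the set with mask `87`. -/
noncomputable def tripleFace87 : ℕ → Bool := faceTest 19058918571 6 [19058918571] [19058917376,
  17179869219, 1073741961, 536871946, 268436640]

/-- The parity test for the faces below the set with mask `91`. -/
noncomputable def tripleFace91 : ℕ → Bool := faceTest 9865007309 6 [9865007309] [9865003008,
  8589934661, 1073741961, 134221836, 67113152]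

/-- The parity test for the faces below the set with mask `93`. -/
noncomputable def tripleFace93 : ℕ → Bool := faceTest 4999616014 6 [4999616014] [4999610368,
  4294967814, 536871946, 134221836, 33560064]

/-- The parity test for the faces below the set with mask `94`. -/
noncomputable def tripleFace94 : ℕ → Bool := faceTest 2516588256 6 [2516588256] [2516582400,
  2147484256, 268436640, 67113152, 33560064]

/-- The parity test for the faces below the set with mask `95`. -/
noncomputable def tripleFace95 : ℕ → Bool := faceTest 34326189807 10 [34326183936, 32212255335,
  19058918571, 9865007309, 4999616014, 2516588256] [32212254720, 19058917376, 9865003008,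
  4999610368, 2516582400, 17179869219, 8589934661, 4294967814, 2147484256, 1073741961, 536871946,
  268436640, 134221836, 67113152, 33560064, 34326189807]

/-- The parity test for the faces below the set with mask `103`. -/
noncomputable def tripleFace103 : ℕ → Bool := faceTest 17209231667 6 [17209231667] [17209229312,
  17179869219, 16777489, 8390674, 4196640]

/-- The parity test for the faces below the set with mask `107`. -/
noncomputable def tripleFace107 : ℕ → Bool := faceTest 8609866069 6 [8609866069] [8609857536,
  8589934661, 16777489, 2105364, 1057088]

/-- The parity test for the faces below the set with mask `110`. -/
noncomputable def tripleFace110 : ℕ → Bool := faceTest 2153261920 6 [2153261920] [2153250816,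
  2147484256, 4196640, 1057088, 535040]

/-- The parity test for the faces below the set with mask `111`. -/
noncomputable def tripleFace111 : ℕ → Bool := faceTest 32245295991 10 [32245284864, 32212255335,
  17209231667, 8609866069, 4305988118, 2153261920] [32212254720, 17209229312, 8609857536,
  4305977344, 2153250816, 17179869219, 8589934661, 4294967814, 2147484256, 16777489, 8390674,
  4196640, 2105364, 1057088, 535040, 32245295991]

/-- The parity test for the faces below the set with mask `115`. -/
noncomputable def tripleFace115 : ℕ → Bool := faceTest 1090929049 6 [1090929049] [1090912256,
  1073741961, 16777489, 278552, 147840]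

/-- The parity test for the faces below the set with mask `118`. -/
noncomputable def tripleFace118 : ℕ → Bool := faceTest 272846240 6 [272846240] [272826368,
  268436640, 4196640, 147840, 84992]

/-- The parity test for the faces below the set with mask `119`. -/
noncomputable def tripleFace119 : ℕ → Bool := faceTest 19088756155 10 [19088736256, 19058918571,
  17209231667, 1090929049, 545606682, 272846240] [19058917376, 17209229312, 1090912256, 545587200,
  272826368, 17179869219, 1073741961, 536871946, 268436640, 16777489, 8390674, 4196640, 278552,
  147840, 84992, 19088756155]

/-- The parity test for the faces below the set with mask `121`. -/
noncomputable def tripleFace121 : ℕ → Bool := faceTest 136638492 6 [136638492] [136609792,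
  134221836, 2105364, 278552, 61440]

/-- The parity test for the faces below the set with mask `122`. -/
noncomputable def tripleFace122 : ℕ → Bool := faceTest 68350400 6 [68350400] [68321280, 67113152,
  1057088, 147840, 61440]

/-- The parity test for the faces below the set with mask `123`. -/
noncomputable def tripleFace123 : ℕ → Bool := faceTest 9885381085 10 [9885351936, 9865007309,
  8609866069, 1090929049, 136638492, 68350400] [9865003008, 8609857536, 1090912256, 136609792,
  68321280, 8589934661, 1073741961, 134221836, 67113152, 16777489, 2105364, 1057088, 278552,
  147840, 61440, 9885381085]

/-- The parity test for the faces below the set with mask `124`. -/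
noncomputable def tripleFace124 : ℕ → Bool := faceTest 34209280 6 [34209280] [34177024, 33560064,
  535040, 84992, 61440]

/-- The parity test for the faces below the set with mask `125`. -/
noncomputable def tripleFace125 : ℕ → Bool := faceTest 5011013150 10 [5010980864, 4999616014,
  4305988118, 545606682, 136638492, 34209280] [4999610368, 4305977344, 545587200, 136609792,
  34177024, 4294967814, 536871946, 134221836, 33560064, 8390674, 2105364, 535040, 278552, 84992,
  61440, 5011013150]

/-- The parity test for the faces below the set with mask `126`. -/
noncomputable def tripleFace126 : ℕ → Bool := faceTest 2522611680 10 [2522578944, 2516588256,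
  2153261920, 272846240, 68350400, 34209280] [2516582400, 2153250816, 272826368, 68321280,
  34177024, 2147484256, 268436640, 67113152, 33560064, 4196640, 1057088, 535040, 147840, 84992,
  61440, 2522611680]

/-- The parity test for the faces below the set with mask `127`. -/
noncomputable def tripleFace127 : ℕ → Bool := faceTest 34359738367 15 [34326183936, 32245284864,
  19088736256, 9885351936, 5010980864, 2522578944, 32212255335, 19058918571, 9865007309,
  4999616014, 2516588256, 17209231667, 8609866069, 4305988118, 2153261920, 1090929049, 545606682,
  272846240, 136638492, 68350400, 34209280, 34359738367] [32212254720, 19058917376, 9865003008,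
  4999610368, 2516582400, 17209229312, 8609857536, 4305977344, 2153250816, 1090912256, 545587200,
  272826368, 136609792, 68321280, 34177024, 34359705600, 17179869219, 8589934661, 4294967814,
  2147484256, 1073741961, 536871946, 268436640, 134221836, 67113152, 33560064, 34326189807,
  16777489, 8390674, 4196640, 2105364, 1057088, 535040, 32245295991, 278552, 147840, 84992,
  19088756155, 61440, 9885381085, 5011013150, 2522611680]

/-- The tests applied when the lowest `0` bits are undecided. -/
noncomputable def tripleTest0 : ℕ → Bool := both tripleCore66 (both tripleCore65 (both (degreeTest
  32767 33548560 0) (both (degreeTest 32767 2114442376 0) (both tripleCore80 (both (lexTest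
  [(17179869184, 17179869184), (8589934592, 1073741824), (4294967296, 536870912), (2147483648,
  268435456), (1073741824, 8589934592), (536870912, 4294967296), (268435456, 2147483648),
  (134217728, 134217728), (67108864, 67108864), (33554432, 33554432), (16777216, 16777216),
  (8388608, 8388608), (4194304, 4194304), (2097152, 262144), (1048576, 131072), (524288, 65536),
  (262144, 2097152), (131072, 1048576), (65536, 524288), (32768, 32768), (16384, 8192), (8192,
  16384), (4096, 4096), (2048, 2048), (1024, 512), (512, 1024), (256, 256), (128, 64), (64, 128),
  (32, 32), (16, 16), (8, 4), (4, 8)]) (both tripleCore72 (both tripleFace125 (both (lexTest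
  [(17179869184, 8589934592), (8589934592, 17179869184), (4294967296, 4294967296), (2147483648,
  2147483648), (1073741824, 1073741824), (536870912, 134217728), (268435456, 67108864),
  (134217728, 536870912), (67108864, 268435456), (33554432, 33554432), (16777216, 16777216),
  (8388608, 2097152), (4194304, 1048576), (2097152, 8388608), (1048576, 4194304), (524288,
  524288), (262144, 262144), (131072, 131072), (65536, 32768), (32768, 65536), (16384, 16384),
  (8192, 2048), (4096, 1024), (2048, 8192), (1024, 4096), (512, 512), (256, 256), (128, 128), (64,
  32), (32, 64), (16, 16), (8, 8), (4, 2), (2, 4)]) (both tripleCore17 (both tripleFace123 (both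
  tripleFace127 (both tripleCore96 (both tripleCore68 (both (lexTest [(17179869184, 17179869184),
  (8589934592, 8589934592), (4294967296, 2147483648), (2147483648, 4294967296), (1073741824,
  1073741824), (536870912, 268435456), (268435456, 536870912), (134217728, 67108864), (67108864,
  134217728), (33554432, 33554432), (16777216, 16777216), (8388608, 4194304), (4194304, 8388608),
  (2097152, 1048576), (1048576, 2097152), (524288, 524288), (262144, 131072), (131072, 262144),
  (65536, 65536), (32768, 32768), (16384, 16384), (8192, 8192), (4096, 4096), (2048, 2048), (1024,
  1024), (512, 512), (256, 16), (128, 8), (64, 4), (32, 2), (16, 256), (8, 128), (4, 64), (2,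
  32)]) (both (lexTest [(17179869184, 17179869184), (8589934592, 4294967296), (4294967296,
  8589934592), (2147483648, 2147483648), (1073741824, 536870912), (536870912, 1073741824),
  (268435456, 268435456), (134217728, 134217728), (67108864, 33554432), (33554432, 67108864),
  (16777216, 8388608), (8388608, 16777216), (4194304, 4194304), (2097152, 2097152), (1048576,
  524288), (524288, 1048576), (262144, 262144), (131072, 65536), (65536, 131072), (32768, 32768),
  (16384, 16384), (8192, 8192), (4096, 4096), (2048, 256), (1024, 128), (512, 64), (256, 2048),
  (128, 1024), (64, 512), (32, 32), (16, 16), (8, 8), (4, 4), (2, 1), (1, 2)]) (both tripleCore34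
  (both tripleFace94 (both (lexTest [(17179869184, 8388608), (8589934592, 262144), (4294967296,
  536870912), (2147483648, 65536), (1073741824, 2097152), (536870912, 4294967296), (268435456,
  524288), (134217728, 134217728), (67108864, 32768), (33554432, 33554432), (16777216, 16777216),
  (8388608, 17179869184), (4194304, 4194304), (2097152, 1073741824), (1048576, 131072), (524288,
  268435456), (262144, 8589934592), (131072, 1048576), (65536, 2147483648), (32768, 67108864),
  (16384, 64), (8192, 128), (4096, 4096), (2048, 32), (1024, 512), (512, 1024), (256, 256), (128,
  8192), (64, 16384), (32, 2048), (16, 1), (8, 4), (4, 8), (2, 2), (1, 16)]) (both tripleCore24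
  (both tripleFace103 (both tripleFace87 (both tripleFace118 (both (weightedTest 6 [34326183936,
  34326183936, 32245284864, 32245284864, 19088736256, 19088736256, 9885351936, 9885351936,
  5010980864, 5010980864, 2522578944, 2522578944] [32212254720, 19058917376, 9865003008,
  4999610368, 2516582400, 17209229312, 8609857536, 4305977344, 2153250816, 1090912256, 545587200,
  272826368, 136609792, 68321280, 34177024, 34359705600, 34359705600, 34359705600]) (both
  tripleFace115 (both tripleFace93 (both (lexTest [(17179869184, 8589934592), (8589934592,
  17179869184), (4294967296, 4294967296), (2147483648, 2147483648), (1073741824, 16777216),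
  (536870912, 2097152), (268435456, 1048576), (134217728, 8388608), (67108864, 4194304),
  (33554432, 524288), (16777216, 1073741824), (8388608, 134217728), (4194304, 67108864), (2097152,
  536870912), (1048576, 268435456), (524288, 33554432), (262144, 262144), (131072, 131072),
  (65536, 32768), (32768, 65536), (16384, 16384), (8192, 1024), (4096, 2048), (2048, 4096), (1024,
  8192), (512, 512), (256, 128), (128, 256), (64, 32), (32, 64), (16, 8), (8, 16), (4, 2), (2,
  4)]) (both (lexTest [(17179869184, 17179869184), (8589934592, 1073741824), (4294967296,
  268435456), (2147483648, 536870912), (1073741824, 8589934592), (536870912, 2147483648),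
  (268435456, 4294967296), (134217728, 67108864), (67108864, 134217728), (33554432, 33554432),
  (16777216, 16777216), (8388608, 4194304), (4194304, 8388608), (2097152, 131072), (1048576,
  262144), (524288, 65536), (262144, 1048576), (131072, 2097152), (65536, 524288), (32768, 32768),
  (16384, 8192), (8192, 16384), (4096, 4096), (2048, 2048), (1024, 512), (512, 1024), (256, 16),
  (128, 4), (64, 8), (32, 2), (16, 256), (8, 64), (4, 128), (2, 32)]) (both tripleFace121 (both
  tripleFace95 (both (lexTest [(17179869184, 17179869184), (8589934592, 4294967296), (4294967296,
  8589934592), (2147483648, 2147483648), (1073741824, 8388608), (536870912, 16777216), (268435456,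
  4194304), (134217728, 2097152), (67108864, 524288), (33554432, 1048576), (16777216, 536870912),
  (8388608, 1073741824), (4194304, 268435456), (2097152, 134217728), (1048576, 33554432), (524288,
  67108864), (262144, 262144), (131072, 65536), (65536, 131072), (32768, 32768), (16384, 16384),
  (8192, 4096), (4096, 8192), (2048, 128), (1024, 256), (512, 64), (256, 1024), (128, 2048), (64,
  512), (32, 32), (16, 8), (8, 16), (4, 4), (2, 1), (1, 2)]) (both tripleFace107 (both
  tripleFace79 (both tripleFace91 (both tripleFace119 (both tripleFace122 (both (weightedTest 6
  [5010980864, 5010980864, 4999616014, 4999616014, 4305988118, 4305988118, 545606682, 545606682,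
  136638492, 136638492, 34209280, 34209280] [4999610368, 4305977344, 545587200, 136609792,
  34177024, 4294967814, 536871946, 134221836, 33560064, 8390674, 2105364, 535040, 278552, 84992,
  61440, 5011013150, 5011013150, 5011013150]) (both tripleFace111 (both (lexTest [(17179869184,
  4294967296), (8589934592, 2147483648), (4294967296, 17179869184), (2147483648, 8589934592),
  (1073741824, 524288), (536870912, 8388608), (268435456, 2097152), (134217728, 4194304),
  (67108864, 1048576), (33554432, 16777216), (16777216, 33554432), (8388608, 536870912), (4194304,
  134217728), (2097152, 268435456), (1048576, 67108864), (524288, 1073741824), (262144, 65536),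
  (131072, 32768), (65536, 262144), (32768, 131072), (16384, 16384), (8192, 128), (4096, 256),
  (2048, 8), (1024, 16), (512, 1), (256, 4096), (128, 8192), (64, 64), (32, 4), (16, 1024), (8,
  2048), (4, 32), (2, 2), (1, 512)]) (both (lexTest [(17179869184, 4194304), (8589934592, 131072),
  (4294967296, 65536), (2147483648, 268435456), (1073741824, 1048576), (536870912, 524288),
  (268435456, 2147483648), (134217728, 32768), (67108864, 67108864), (33554432, 33554432),
  (16777216, 16777216), (8388608, 8388608), (4194304, 17179869184), (2097152, 262144), (1048576,
  1073741824), (524288, 536870912), (262144, 2097152), (131072, 8589934592), (65536, 4294967296),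
  (32768, 134217728), (16384, 4), (8192, 8), (4096, 4096), (2048, 2), (1024, 512), (512, 1024),
  (256, 1), (128, 64), (64, 128), (32, 32), (16, 16), (8, 8192), (4, 16384), (2, 2048), (1, 256)])
  (both tripleFace110 (both (weightedTest 6 [9885351936, 9885351936, 9865007309, 9865007309,
  8609866069, 8609866069, 1090929049, 1090929049, 136638492, 136638492, 68350400, 68350400]
  [9865003008, 8609857536, 1090912256, 136609792, 68321280, 8589934661, 1073741961, 134221836,
  67113152, 16777489, 2105364, 1057088, 278552, 147840, 61440, 9885381085, 9885381085,
  9885381085]) (weightedTest 6 [2522578944, 2522578944, 2516588256, 2516588256, 2153261920,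
  2153261920, 272846240, 272846240, 68350400, 68350400, 34209280, 34209280] [2516582400,
  2153250816, 272826368, 68321280, 34177024, 2147484256, 268436640, 67113152, 33560064, 4196640,
  1057088, 535040, 147840, 84992, 61440, 2522611680, 2522611680,
  2522611680]))))))))))))))))))))))))))))))))))))))))))

theorem accepts_tripleTest0 : Accepts (TripleCandidate tripleMasks) tripleMasks 0 tripleTest0 :=
Accepts.both (accepts_pairTest (X := 66) (fun _ h => h.good) enumerates_tripleMasks (by decide)
    rfl (by decide +kernel)) <|
Accepts.both (accepts_pairTest (X := 65) (fun _ h => h.good) enumerates_tripleMasks (by decide)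
    rfl (by decide +kernel)) <|
Accepts.both (accepts_degreeTest_five enumerates_tripleMasks (by decide) (by decide +kernel)) <|
Accepts.both (accepts_degreeTest_four enumerates_tripleMasks (by decide) (by decide +kernel)) <|
Accepts.both (accepts_pairTest (X := 80) (fun _ h => h.good) enumerates_tripleMasks (by decide)
    rfl (by decide +kernel)) <|
Accepts.both (accepts_lexTest_triple (p := [0, 1, 2, 4, 3, 5, 6]) (by decide) (by decide +kernel))
    <|
Accepts.both (accepts_pairTest (X := 72) (fun _ h => h.good) enumerates_tripleMasks (by decide)
    rfl (by decide +kernel)) <|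
Accepts.both (accepts_faceTest (W := 125) (fun _ h => h.good) enumerates_tripleMasks (by decide)
    (by decide +kernel)) <|
Accepts.both (accepts_lexTest_triple (p := [0, 1, 3, 2, 4, 5, 6]) (by decide) (by decide +kernel))
    <|
Accepts.both (accepts_pairTest (X := 17) (fun _ h => h.good) enumerates_tripleMasks (by decide)
    rfl (by decide +kernel)) <|
Accepts.both (accepts_faceTest (W := 123) (fun _ h => h.good) enumerates_tripleMasks (by decide)
    (by decide +kernel)) <|
Accepts.both (accepts_faceTest (W := 127) (fun _ h => h.good) enumerates_tripleMasks (by decide)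
    (by decide +kernel)) <|
Accepts.both (accepts_pairTest (X := 96) (fun _ h => h.good) enumerates_tripleMasks (by decide)
    rfl (by decide +kernel)) <|
Accepts.both (accepts_pairTest (X := 68) (fun _ h => h.good) enumerates_tripleMasks (by decide)
    rfl (by decide +kernel)) <|
Accepts.both (accepts_lexTest_triple (p := [1, 0, 2, 3, 4, 5, 6]) (by decide) (by decide +kernel))
    <|
Accepts.both (accepts_lexTest_triple (p := [0, 2, 1, 3, 4, 5, 6]) (by decide) (by decide +kernel))
    <|
Accepts.both (accepts_pairTest (X := 34) (fun _ h => h.good) enumerates_tripleMasks (by decide)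
    rfl (by decide +kernel)) <|
Accepts.both (accepts_faceTest (W := 94) (fun _ h => h.good) enumerates_tripleMasks (by decide)
    (by decide +kernel)) <|
Accepts.both (accepts_lexTest_triple (p := [0, 5, 2, 4, 3, 1, 6]) (by decide) (by decide +kernel))
    <|
Accepts.both (accepts_pairTest (X := 24) (fun _ h => h.good) enumerates_tripleMasks (by decide)
    rfl (by decide +kernel)) <|
Accepts.both (accepts_faceTest (W := 103) (fun _ h => h.good) enumerates_tripleMasks (by decide)
    (by decide +kernel)) <|
Accepts.both (accepts_faceTest (W := 87) (fun _ h => h.good) enumerates_tripleMasks (by decide)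
    (by decide +kernel)) <|
Accepts.both (accepts_faceTest (W := 118) (fun _ h => h.good) enumerates_tripleMasks (by decide)
    (by decide +kernel)) <|
Accepts.both (accepts_weightedTest (W := 63) (fun _ h => h.good) enumerates_tripleMasks (by
    decide +kernel)) <|
Accepts.both (accepts_faceTest (W := 115) (fun _ h => h.good) enumerates_tripleMasks (by decide)
    (by decide +kernel)) <|
Accepts.both (accepts_faceTest (W := 93) (fun _ h => h.good) enumerates_tripleMasks (by decide)
    (by decide +kernel)) <|
Accepts.both (accepts_lexTest_triple (p := [0, 1, 3, 2, 5, 4, 6]) (by decide) (by decide +kernel))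
    <|
Accepts.both (accepts_lexTest_triple (p := [1, 0, 2, 4, 3, 5, 6]) (by decide) (by decide +kernel))
    <|
Accepts.both (accepts_faceTest (W := 121) (fun _ h => h.good) enumerates_tripleMasks (by decide)
    (by decide +kernel)) <|
Accepts.both (accepts_faceTest (W := 95) (fun _ h => h.good) enumerates_tripleMasks (by decide)
    (by decide +kernel)) <|
Accepts.both (accepts_lexTest_triple (p := [0, 2, 1, 3, 5, 4, 6]) (by decide) (by decide +kernel))
    <|
Accepts.both (accepts_faceTest (W := 107) (fun _ h => h.good) enumerates_tripleMasks (by decide)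
    (by decide +kernel)) <|
Accepts.both (accepts_faceTest (W := 79) (fun _ h => h.good) enumerates_tripleMasks (by decide)
    (by decide +kernel)) <|
Accepts.both (accepts_faceTest (W := 91) (fun _ h => h.good) enumerates_tripleMasks (by decide)
    (by decide +kernel)) <|
Accepts.both (accepts_faceTest (W := 119) (fun _ h => h.good) enumerates_tripleMasks (by decide)
    (by decide +kernel)) <|
Accepts.both (accepts_faceTest (W := 122) (fun _ h => h.good) enumerates_tripleMasks (by decide)
    (by decide +kernel)) <|
Accepts.both (accepts_weightedTest (W := 125) (fun _ h => h.good) enumerates_tripleMasks (by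
    decide +kernel)) <|
Accepts.both (accepts_faceTest (W := 111) (fun _ h => h.good) enumerates_tripleMasks (by decide)
    (by decide +kernel)) <|
Accepts.both (accepts_lexTest_triple (p := [2, 3, 0, 1, 5, 4, 6]) (by decide) (by decide +kernel))
    <|
Accepts.both (accepts_lexTest_triple (p := [5, 1, 2, 4, 3, 0, 6]) (by decide) (by decide +kernel))
    <|
Accepts.both (accepts_faceTest (W := 110) (fun _ h => h.good) enumerates_tripleMasks (by decide)
    (by decide +kernel)) <|
Accepts.both (accepts_weightedTest (W := 123) (fun _ h => h.good) enumerates_tripleMasks (by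
    decide +kernel)) <|
accepts_weightedTest (W := 126) (fun _ h => h.good) enumerates_tripleMasks (by decide +kernel)

/-- The tests applied when the lowest `1` bits are undecided. -/
noncomputable def tripleTest1 : ℕ → Bool := both tripleCore68 (degreeTest 32767 33548560 1)

theorem accepts_tripleTest1 : Accepts (TripleCandidate tripleMasks) tripleMasks 1 tripleTest1 :=
Accepts.both (accepts_pairTest (X := 68) (fun _ h => h.good) enumerates_tripleMasks (by decide)
    rfl (by decide +kernel)) <|
accepts_degreeTest_five enumerates_tripleMasks (by decide) (by decide +kernel)

/-- The tests applied when the lowest `2` bits are undecided. -/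
noncomputable def tripleTest2 : ℕ → Bool := both tripleCore72 (both tripleCore9 (degreeTest 32767
  33548560 3))

theorem accepts_tripleTest2 : Accepts (TripleCandidate tripleMasks) tripleMasks 2 tripleTest2 :=
Accepts.both (accepts_pairTest (X := 72) (fun _ h => h.good) enumerates_tripleMasks (by decide)
    rfl (by decide +kernel)) <|
Accepts.both (accepts_pairTest (X := 9) (fun _ h => h.good) enumerates_tripleMasks (by decide) rfl
    (by decide +kernel)) <|
accepts_degreeTest_five enumerates_tripleMasks (by decide) (by decide +kernel)

/-- The tests applied when the lowest `3` bits are undecided. -/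
noncomputable def tripleTest3 : ℕ → Bool := both tripleCore80 (both (degreeTest 32767 33548560 7)
  (degreeTest 32767 2114442376 7))

theorem accepts_tripleTest3 : Accepts (TripleCandidate tripleMasks) tripleMasks 3 tripleTest3 :=
Accepts.both (accepts_pairTest (X := 80) (fun _ h => h.good) enumerates_tripleMasks (by decide)
    rfl (by decide +kernel)) <|
Accepts.both (accepts_degreeTest_five enumerates_tripleMasks (by decide) (by decide +kernel)) <|
accepts_degreeTest_four enumerates_tripleMasks (by decide) (by decide +kernel)

/-- The tests applied when the lowest `4` bits are undecided. -/
noncomputable def tripleTest4 : ℕ → Bool := both tripleCore33 (both tripleCore96 (degreeTest 32767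
  33548560 15))

theorem accepts_tripleTest4 : Accepts (TripleCandidate tripleMasks) tripleMasks 4 tripleTest4 :=
Accepts.both (accepts_pairTest (X := 33) (fun _ h => h.good) enumerates_tripleMasks (by decide)
    rfl (by decide +kernel)) <|
Accepts.both (accepts_pairTest (X := 96) (fun _ h => h.good) enumerates_tripleMasks (by decide)
    rfl (by decide +kernel)) <|
accepts_degreeTest_five enumerates_tripleMasks (by decide) (by decide +kernel)

/-- The tests applied when the lowest `5` bits are undecided. -/
noncomputable def tripleTest5 : ℕ → Bool := both tripleCore6 (both tripleFace126 (both (degreeTest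
  32767 33548560 31) tripleCore34))

theorem accepts_tripleTest5 : Accepts (TripleCandidate tripleMasks) tripleMasks 5 tripleTest5 :=
Accepts.both (accepts_pairTest (X := 6) (fun _ h => h.good) enumerates_tripleMasks (by decide) rfl
    (by decide +kernel)) <|
Accepts.both (accepts_faceTest (W := 126) (fun _ h => h.good) enumerates_tripleMasks (by decide)
    (by decide +kernel)) <|
Accepts.both (accepts_degreeTest_five enumerates_tripleMasks (by decide) (by decide +kernel)) <|
accepts_pairTest (X := 34) (fun _ h => h.good) enumerates_tripleMasks (by decide) rfl (by
    decide +kernel)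

/-- The tests applied when the lowest `6` bits are undecided. -/
noncomputable def tripleTest6 : ℕ → Bool := both tripleCore10 (both tripleCore24 tripleCore40)

theorem accepts_tripleTest6 : Accepts (TripleCandidate tripleMasks) tripleMasks 6 tripleTest6 :=
Accepts.both (accepts_pairTest (X := 10) (fun _ h => h.good) enumerates_tripleMasks (by decide)
    rfl (by decide +kernel)) <|
Accepts.both (accepts_pairTest (X := 24) (fun _ h => h.good) enumerates_tripleMasks (by decide)
    rfl (by decide +kernel)) <|
accepts_pairTest (X := 40) (fun _ h => h.good) enumerates_tripleMasks (by decide) rfl (by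
    decide +kernel)

/-- The tests applied when the lowest `7` bits are undecided. -/
noncomputable def tripleTest7 : ℕ → Bool := both tripleCore18 (both tripleCore34 tripleCore48)

theorem accepts_tripleTest7 : Accepts (TripleCandidate tripleMasks) tripleMasks 7 tripleTest7 :=
Accepts.both (accepts_pairTest (X := 18) (fun _ h => h.good) enumerates_tripleMasks (by decide)
    rfl (by decide +kernel)) <|
Accepts.both (accepts_pairTest (X := 34) (fun _ h => h.good) enumerates_tripleMasks (by decide)
    rfl (by decide +kernel)) <|
accepts_pairTest (X := 48) (fun _ h => h.good) enumerates_tripleMasks (by decide) rfl (by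
    decide +kernel)

/-- The tests applied when the lowest `8` bits are undecided. -/
noncomputable def tripleTest8 : ℕ → Bool := tripleCore34

theorem accepts_tripleTest8 : Accepts (TripleCandidate tripleMasks) tripleMasks 8 tripleTest8 :=
accepts_pairTest (X := 34) (fun _ h => h.good) enumerates_tripleMasks (by decide) rfl (by
    decide +kernel)

/-- The tests applied when the lowest `9` bits are undecided. -/
noncomputable def tripleTest9 : ℕ → Bool := both tripleCore12 (both tripleCore40 (both
  tripleFace124 (both tripleCore36 tripleCore24)))

theorem accepts_tripleTest9 : Accepts (TripleCandidate tripleMasks) tripleMasks 9 tripleTest9 :=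
Accepts.both (accepts_pairTest (X := 12) (fun _ h => h.good) enumerates_tripleMasks (by decide)
    rfl (by decide +kernel)) <|
Accepts.both (accepts_pairTest (X := 40) (fun _ h => h.good) enumerates_tripleMasks (by decide)
    rfl (by decide +kernel)) <|
Accepts.both (accepts_faceTest (W := 124) (fun _ h => h.good) enumerates_tripleMasks (by decide)
    (by decide +kernel)) <|
Accepts.both (accepts_pairTest (X := 36) (fun _ h => h.good) enumerates_tripleMasks (by decide)
    rfl (by decide +kernel)) <|
accepts_pairTest (X := 24) (fun _ h => h.good) enumerates_tripleMasks (by decide) rfl (by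
    decide +kernel)

/-- The tests applied when the lowest `10` bits are undecided. -/
noncomputable def tripleTest10 : ℕ → Bool := both tripleCore20 (both tripleCore36 tripleCore48)

theorem accepts_tripleTest10 : Accepts (TripleCandidate tripleMasks) tripleMasks 10 tripleTest10 :=
Accepts.both (accepts_pairTest (X := 20) (fun _ h => h.good) enumerates_tripleMasks (by decide)
    rfl (by decide +kernel)) <|
Accepts.both (accepts_pairTest (X := 36) (fun _ h => h.good) enumerates_tripleMasks (by decide)
    rfl (by decide +kernel)) <|
accepts_pairTest (X := 48) (fun _ h => h.good) enumerates_tripleMasks (by decide) rfl (by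
    decide +kernel)

/-- The tests applied when the lowest `11` bits are undecided. -/
noncomputable def tripleTest11 : ℕ → Bool := tripleCore36

theorem accepts_tripleTest11 : Accepts (TripleCandidate tripleMasks) tripleMasks 11 tripleTest11 :=
accepts_pairTest (X := 36) (fun _ h => h.good) enumerates_tripleMasks (by decide) rfl (by
    decide +kernel)

/-- The tests applied when the lowest `12` bits are undecided. -/
noncomputable def tripleTest12 : ℕ → Bool := both tripleCore24 (both tripleCore40 tripleCore48)

theorem accepts_tripleTest12 : Accepts (TripleCandidate tripleMasks) tripleMasks 12 tripleTest12 :=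
Accepts.both (accepts_pairTest (X := 24) (fun _ h => h.good) enumerates_tripleMasks (by decide)
    rfl (by decide +kernel)) <|
Accepts.both (accepts_pairTest (X := 40) (fun _ h => h.good) enumerates_tripleMasks (by decide)
    rfl (by decide +kernel)) <|
accepts_pairTest (X := 48) (fun _ h => h.good) enumerates_tripleMasks (by decide) rfl (by
    decide +kernel)

/-- The tests applied when the lowest `13` bits are undecided. -/
noncomputable def tripleTest13 : ℕ → Bool := tripleCore40

theorem accepts_tripleTest13 : Accepts (TripleCandidate tripleMasks) tripleMasks 13 tripleTest13 :=
accepts_pairTest (X := 40) (fun _ h => h.good) enumerates_tripleMasks (by decide) rfl (by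
    decide +kernel)

/-- The tests applied when the lowest `14` bits are undecided. -/
noncomputable def tripleTest14 : ℕ → Bool := tripleCore48

theorem accepts_tripleTest14 : Accepts (TripleCandidate tripleMasks) tripleMasks 14 tripleTest14 :=
accepts_pairTest (X := 48) (fun _ h => h.good) enumerates_tripleMasks (by decide) rfl (by
    decide +kernel)

/-- The tests applied when the lowest `15` bits are undecided. -/
noncomputable def tripleTest15 : ℕ → Bool := both tripleFace63 (both (lexTest [(17179869184,
  17179869184), (8589934592, 4294967296), (4294967296, 8589934592), (2147483648, 2147483648),
  (1073741824, 536870912), (536870912, 1073741824), (268435456, 268435456), (134217728,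
  134217728), (67108864, 33554432), (33554432, 67108864), (16777216, 8388608), (8388608,
  16777216), (4194304, 4194304), (2097152, 2097152), (1048576, 524288), (524288, 1048576),
  (262144, 262144), (131072, 65536), (65536, 131072)]) (both (lexTest [(17179869184, 8589934592),
  (8589934592, 17179869184), (4294967296, 4294967296), (2147483648, 2147483648), (1073741824,
  1073741824), (536870912, 134217728), (268435456, 67108864), (134217728, 536870912), (67108864,
  268435456), (33554432, 33554432), (16777216, 16777216), (8388608, 2097152), (4194304, 1048576),
  (2097152, 8388608), (1048576, 4194304), (524288, 524288), (262144, 262144), (131072, 131072),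
  (65536, 32768), (32768, 65536)]) (both (lexTest [(17179869184, 17179869184), (8589934592,
  1073741824), (4294967296, 536870912), (2147483648, 268435456), (1073741824, 8589934592),
  (536870912, 4294967296), (268435456, 2147483648), (134217728, 134217728), (67108864, 67108864),
  (33554432, 33554432), (16777216, 16777216), (8388608, 8388608), (4194304, 4194304), (2097152,
  262144), (1048576, 131072), (524288, 65536), (262144, 2097152), (131072, 1048576), (65536,
  524288)]) (both (lexTest [(17179869184, 1073741824), (8589934592, 16777216), (4294967296,
  262144), (2147483648, 131072), (1073741824, 17179869184), (536870912, 536870912), (268435456,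
  268435456), (134217728, 8388608), (67108864, 4194304), (33554432, 65536), (16777216,
  8589934592), (8388608, 134217728), (4194304, 67108864), (2097152, 2097152), (1048576, 1048576),
  (524288, 32768), (262144, 4294967296), (131072, 2147483648), (65536, 33554432), (32768,
  524288)]) (both (lexTest [(17179869184, 8589934592), (8589934592, 17179869184), (4294967296,
  2147483648), (2147483648, 4294967296), (1073741824, 1073741824), (536870912, 67108864),
  (268435456, 134217728), (134217728, 268435456), (67108864, 536870912), (33554432, 33554432),
  (16777216, 16777216), (8388608, 1048576), (4194304, 2097152), (2097152, 4194304), (1048576,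
  8388608), (524288, 524288), (262144, 131072), (131072, 262144), (65536, 32768), (32768, 65536)])
  (both (lexTest [(17179869184, 4294967296), (8589934592, 2147483648), (4294967296, 17179869184),
  (2147483648, 8589934592), (1073741824, 33554432), (536870912, 536870912), (268435456,
  134217728), (134217728, 268435456), (67108864, 67108864), (33554432, 1073741824), (16777216,
  524288), (8388608, 8388608), (4194304, 2097152), (2097152, 4194304), (1048576, 1048576),
  (524288, 16777216), (262144, 65536), (131072, 32768), (65536, 262144), (32768, 131072)]) (both
  tripleFace59 (both (lexTest [(17179869184, 17179869184), (8589934592, 4294967296), (4294967296,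
  8589934592), (2147483648, 2147483648), (1073741824, 8388608), (536870912, 16777216), (268435456,
  4194304), (134217728, 2097152), (67108864, 524288), (33554432, 1048576), (16777216, 536870912),
  (8388608, 1073741824), (4194304, 268435456), (2097152, 134217728), (1048576, 33554432), (524288,
  67108864), (262144, 262144), (131072, 65536), (65536, 131072)]) (both (lexTest [(17179869184,
  2147483648), (8589934592, 4294967296), (4294967296, 8589934592), (2147483648, 17179869184),
  (1073741824, 524288), (536870912, 1048576), (268435456, 4194304), (134217728, 2097152),
  (67108864, 8388608), (33554432, 16777216), (16777216, 33554432), (8388608, 67108864), (4194304,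
  268435456), (2097152, 134217728), (1048576, 536870912), (524288, 1073741824), (262144, 32768),
  (131072, 65536), (65536, 131072), (32768, 262144)]) (both (lexTest [(17179869184, 8589934592),
  (8589934592, 17179869184), (4294967296, 4294967296), (2147483648, 2147483648), (1073741824,
  16777216), (536870912, 2097152), (268435456, 1048576), (134217728, 8388608), (67108864,
  4194304), (33554432, 524288), (16777216, 1073741824), (8388608, 134217728), (4194304, 67108864),
  (2097152, 536870912), (1048576, 268435456), (524288, 33554432), (262144, 262144), (131072,
  131072), (65536, 32768), (32768, 65536)]) (both (lexTest [(17179869184, 17179869184),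
  (8589934592, 8589934592), (4294967296, 2147483648), (2147483648, 4294967296), (1073741824,
  1073741824), (536870912, 268435456), (268435456, 536870912), (134217728, 67108864), (67108864,
  134217728), (33554432, 33554432), (16777216, 16777216), (8388608, 4194304), (4194304, 8388608),
  (2097152, 1048576), (1048576, 2097152), (524288, 524288), (262144, 131072), (131072, 262144)])
  (both (lexTest [(17179869184, 17179869184), (8589934592, 1073741824), (4294967296, 268435456),
  (2147483648, 536870912), (1073741824, 8589934592), (536870912, 2147483648), (268435456,
  4294967296), (134217728, 67108864), (67108864, 134217728), (33554432, 33554432), (16777216,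
  16777216), (8388608, 4194304), (4194304, 8388608), (2097152, 131072), (1048576, 262144),
  (524288, 65536), (262144, 1048576), (131072, 2097152), (65536, 524288)]) (both (lexTest
  [(17179869184, 536870912), (8589934592, 8388608), (4294967296, 262144), (2147483648, 65536),
  (1073741824, 17179869184), (536870912, 1073741824), (268435456, 268435456), (134217728,
  16777216), (67108864, 4194304), (33554432, 131072), (16777216, 4294967296), (8388608,
  134217728), (4194304, 33554432), (2097152, 2097152), (1048576, 524288), (524288, 32768),
  (262144, 8589934592), (131072, 2147483648), (65536, 67108864), (32768, 1048576)]) (both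
  tripleFace61 (both tripleFace62 (both (lexTest [(17179869184, 17179869184), (8589934592,
  8589934592), (4294967296, 2147483648), (2147483648, 4294967296), (1073741824, 16777216),
  (536870912, 4194304), (268435456, 8388608), (134217728, 1048576), (67108864, 2097152),
  (33554432, 524288), (16777216, 1073741824), (8388608, 268435456), (4194304, 536870912),
  (2097152, 67108864), (1048576, 134217728), (524288, 33554432), (262144, 131072), (131072,
  262144)]) (both (lexTest [(17179869184, 8589934592), (8589934592, 17179869184), (4294967296,
  2147483648), (2147483648, 4294967296), (1073741824, 16777216), (536870912, 1048576), (268435456,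
  2097152), (134217728, 4194304), (67108864, 8388608), (33554432, 524288), (16777216, 1073741824),
  (8388608, 67108864), (4194304, 134217728), (2097152, 268435456), (1048576, 536870912), (524288,
  33554432), (262144, 131072), (131072, 262144), (65536, 32768), (32768, 65536)]) (both (lexTest
  [(17179869184, 16777216), (8589934592, 8589934592), (4294967296, 2097152), (2147483648,
  1048576), (1073741824, 1073741824), (536870912, 262144), (268435456, 131072), (134217728,
  134217728), (67108864, 67108864), (33554432, 32768), (16777216, 17179869184), (8388608,
  8388608), (4194304, 4194304), (2097152, 4294967296), (1048576, 2147483648), (524288, 524288),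
  (262144, 536870912), (131072, 268435456), (65536, 65536), (32768, 33554432)]) (both (lexTest
  [(17179869184, 536870912), (8589934592, 262144), (4294967296, 8388608), (2147483648, 65536),
  (1073741824, 1073741824), (536870912, 17179869184), (268435456, 268435456), (134217728,
  16777216), (67108864, 131072), (33554432, 4194304), (16777216, 134217728), (8388608,
  4294967296), (4194304, 33554432), (2097152, 2097152), (1048576, 32768), (524288, 524288),
  (262144, 8589934592), (131072, 67108864), (65536, 2147483648), (32768, 1048576)]) (both (lexTest
  [(17179869184, 17179869184), (8589934592, 1073741824), (4294967296, 268435456), (2147483648,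
  536870912), (1073741824, 16777216), (536870912, 4194304), (268435456, 8388608), (134217728,
  131072), (67108864, 262144), (33554432, 65536), (16777216, 8589934592), (8388608, 2147483648),
  (4194304, 4294967296), (2097152, 67108864), (1048576, 134217728), (524288, 33554432), (262144,
  1048576), (131072, 2097152), (65536, 524288)]) (both (lexTest [(17179869184, 17179869184),
  (8589934592, 2147483648), (4294967296, 4294967296), (2147483648, 8589934592), (1073741824,
  4194304), (536870912, 8388608), (268435456, 16777216), (134217728, 524288), (67108864, 1048576),
  (33554432, 2097152), (16777216, 268435456), (8388608, 536870912), (4194304, 1073741824),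
  (2097152, 33554432), (1048576, 67108864), (524288, 134217728), (262144, 65536), (131072,
  131072), (65536, 262144)]) (lexTest [(17179869184, 2147483648), (8589934592, 4294967296),
  (4294967296, 17179869184), (2147483648, 8589934592), (1073741824, 524288), (536870912, 4194304),
  (268435456, 1048576), (134217728, 8388608), (67108864, 2097152), (33554432, 16777216),
  (16777216, 33554432), (8388608, 268435456), (4194304, 67108864), (2097152, 536870912), (1048576,
  134217728), (524288, 1073741824), (262144, 65536), (131072, 32768), (65536, 131072), (32768,
  262144)]))))))))))))))))))))))

theorem accepts_tripleTest15 : Accepts (TripleCandidate tripleMasks) tripleMasks 15 tripleTest15 :=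
Accepts.both (accepts_faceTest (W := 63) (fun _ h => h.good) enumerates_tripleMasks (by decide)
    (by decide +kernel)) <|
Accepts.both (accepts_lexTest_triple (p := [0, 2, 1, 3, 4, 5, 6]) (by decide) (by decide +kernel))
    <|
Accepts.both (accepts_lexTest_triple (p := [0, 1, 3, 2, 4, 5, 6]) (by decide) (by decide +kernel))
    <|
Accepts.both (accepts_lexTest_triple (p := [0, 1, 2, 4, 3, 5, 6]) (by decide) (by decide +kernel))
    <|
Accepts.both (accepts_lexTest_triple (p := [0, 1, 4, 5, 2, 3, 6]) (by decide) (by decide +kernel))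
    <|
Accepts.both (accepts_lexTest_triple (p := [1, 0, 3, 2, 4, 5, 6]) (by decide) (by decide +kernel))
    <|
Accepts.both (accepts_lexTest_triple (p := [2, 3, 0, 1, 4, 5, 6]) (by decide) (by decide +kernel))
    <|
Accepts.both (accepts_faceTest (W := 59) (fun _ h => h.good) enumerates_tripleMasks (by decide)
    (by decide +kernel)) <|
Accepts.both (accepts_lexTest_triple (p := [0, 2, 1, 3, 5, 4, 6]) (by decide) (by decide +kernel))
    <|
Accepts.both (accepts_lexTest_triple (p := [3, 2, 1, 0, 5, 4, 6]) (by decide) (by decide +kernel))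
    <|
Accepts.both (accepts_lexTest_triple (p := [0, 1, 3, 2, 5, 4, 6]) (by decide) (by decide +kernel))
    <|
Accepts.both (accepts_lexTest_triple (p := [1, 0, 2, 3, 4, 5, 6]) (by decide) (by decide +kernel))
    <|
Accepts.both (accepts_lexTest_triple (p := [1, 0, 2, 4, 3, 5, 6]) (by decide) (by decide +kernel))
    <|
Accepts.both (accepts_lexTest_triple (p := [0, 2, 4, 5, 1, 3, 6]) (by decide) (by decide +kernel))
    <|
Accepts.both (accepts_faceTest (W := 61) (fun _ h => h.good) enumerates_tripleMasks (by decide)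
    (by decide +kernel)) <|
Accepts.both (accepts_faceTest (W := 62) (fun _ h => h.good) enumerates_tripleMasks (by decide)
    (by decide +kernel)) <|
Accepts.both (accepts_lexTest_triple (p := [1, 0, 2, 3, 5, 4, 6]) (by decide) (by decide +kernel))
    <|
Accepts.both (accepts_lexTest_triple (p := [1, 0, 3, 2, 5, 4, 6]) (by decide) (by decide +kernel))
    <|
Accepts.both (accepts_lexTest_triple (p := [0, 1, 5, 3, 4, 2, 6]) (by decide) (by decide +kernel))
    <|
Accepts.both (accepts_lexTest_triple (p := [0, 4, 2, 5, 1, 3, 6]) (by decide) (by decide +kernel))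
    <|
Accepts.both (accepts_lexTest_triple (p := [1, 0, 2, 4, 5, 3, 6]) (by decide) (by decide +kernel))
    <|
Accepts.both (accepts_lexTest_triple (p := [2, 1, 0, 3, 5, 4, 6]) (by decide) (by decide +kernel))
    <|
accepts_lexTest_triple (p := [2, 3, 1, 0, 5, 4, 6]) (by decide) (by decide +kernel)

/-- The tests applied when the lowest `16` bits are undecided. -/
noncomputable def tripleTest16 : ℕ → Bool := tripleFace55

theorem accepts_tripleTest16 : Accepts (TripleCandidate tripleMasks) tripleMasks 16 tripleTest16 :=
accepts_faceTest (W := 55) (fun _ h => h.good) enumerates_tripleMasks (by decide) (by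
    decide +kernel)

/-- The tests applied when the lowest `17` bits are undecided. -/
noncomputable def tripleTest17 : ℕ → Bool := both (lexTest [(17179869184, 17179869184),
  (8589934592, 1073741824), (4294967296, 536870912), (2147483648, 268435456), (1073741824,
  8589934592), (536870912, 4294967296), (268435456, 2147483648), (134217728, 134217728),
  (67108864, 67108864), (33554432, 33554432), (16777216, 16777216), (8388608, 8388608), (4194304,
  4194304), (2097152, 262144), (1048576, 131072)]) (both (lexTest [(17179869184, 8589934592),
  (8589934592, 17179869184), (4294967296, 2147483648), (2147483648, 4294967296), (1073741824,
  1073741824), (536870912, 67108864), (268435456, 134217728), (134217728, 268435456), (67108864,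
  536870912), (33554432, 33554432), (16777216, 16777216), (8388608, 1048576), (4194304, 2097152),
  (2097152, 4194304), (1048576, 8388608), (524288, 524288), (262144, 131072), (131072, 262144)])
  (both (lexTest [(17179869184, 1073741824), (8589934592, 16777216), (4294967296, 262144),
  (2147483648, 131072), (1073741824, 17179869184), (536870912, 536870912), (268435456, 268435456),
  (134217728, 8388608), (67108864, 4194304)]) (both (lexTest [(17179869184, 8589934592),
  (8589934592, 17179869184), (4294967296, 2147483648), (2147483648, 4294967296), (1073741824,
  16777216), (536870912, 1048576), (268435456, 2097152), (134217728, 4194304), (67108864,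
  8388608), (33554432, 524288), (16777216, 1073741824), (8388608, 67108864), (4194304, 134217728),
  (2097152, 268435456), (1048576, 536870912), (524288, 33554432), (262144, 131072), (131072,
  262144)]) (lexTest [(17179869184, 4294967296), (8589934592, 2147483648), (4294967296,
  17179869184), (2147483648, 8589934592), (1073741824, 33554432), (536870912, 536870912),
  (268435456, 134217728), (134217728, 268435456), (67108864, 67108864), (33554432, 1073741824),
  (16777216, 524288), (8388608, 8388608), (4194304, 2097152), (2097152, 4194304), (1048576,
  1048576), (524288, 16777216)]))))

theorem accepts_tripleTest17 : Accepts (TripleCandidate tripleMasks) tripleMasks 17 tripleTest17 :=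
Accepts.both (accepts_lexTest_triple (p := [0, 1, 2, 4, 3, 5, 6]) (by decide) (by decide +kernel))
    <|
Accepts.both (accepts_lexTest_triple (p := [1, 0, 3, 2, 4, 5, 6]) (by decide) (by decide +kernel))
    <|
Accepts.both (accepts_lexTest_triple (p := [0, 1, 4, 5, 2, 3, 6]) (by decide) (by decide +kernel))
    <|
Accepts.both (accepts_lexTest_triple (p := [1, 0, 3, 2, 5, 4, 6]) (by decide) (by decide +kernel))
    <|
accepts_lexTest_triple (p := [2, 3, 0, 1, 4, 5, 6]) (by decide) (by decide +kernel)

/-- The tests applied when the lowest `19` bits are undecided. -/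
noncomputable def tripleTest19 : ℕ → Bool := both (lexTest [(17179869184, 8589934592),
  (8589934592, 17179869184), (4294967296, 2147483648), (2147483648, 4294967296), (1073741824,
  1073741824), (536870912, 67108864), (268435456, 134217728), (134217728, 268435456), (67108864,
  536870912), (33554432, 33554432), (16777216, 16777216), (8388608, 1048576), (4194304, 2097152),
  (2097152, 4194304), (1048576, 8388608)]) (both (lexTest [(17179869184, 8589934592), (8589934592,
  4294967296), (4294967296, 2147483648), (2147483648, 17179869184), (1073741824, 2097152),
  (536870912, 1048576), (268435456, 16777216), (134217728, 524288), (67108864, 8388608),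
  (33554432, 4194304), (16777216, 134217728), (8388608, 67108864), (4194304, 1073741824),
  (2097152, 33554432), (1048576, 536870912), (524288, 268435456)]) (both (lexTest [(17179869184,
  17179869184), (8589934592, 4294967296), (4294967296, 8589934592), (2147483648, 2147483648),
  (1073741824, 536870912), (536870912, 1073741824), (268435456, 268435456), (134217728,
  134217728), (67108864, 33554432), (33554432, 67108864), (16777216, 8388608), (8388608,
  16777216), (4194304, 4194304), (2097152, 2097152), (1048576, 524288), (524288, 1048576)]) (both
  tripleFace47 (both (lexTest [(17179869184, 2147483648), (8589934592, 4294967296), (4294967296,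
  17179869184), (2147483648, 8589934592), (1073741824, 524288), (536870912, 4194304), (268435456,
  1048576), (134217728, 8388608), (67108864, 2097152), (33554432, 16777216), (16777216, 33554432),
  (8388608, 268435456), (4194304, 67108864), (2097152, 536870912), (1048576, 134217728), (524288,
  1073741824)]) (both (lexTest [(17179869184, 8589934592), (8589934592, 17179869184), (4294967296,
  4294967296), (2147483648, 2147483648), (1073741824, 1073741824), (536870912, 134217728),
  (268435456, 67108864), (134217728, 536870912), (67108864, 268435456), (33554432, 33554432),
  (16777216, 16777216), (8388608, 2097152), (4194304, 1048576), (2097152, 8388608), (1048576,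
  4194304)]) (both (lexTest [(17179869184, 17179869184), (8589934592, 8589934592), (4294967296,
  2147483648), (2147483648, 4294967296), (1073741824, 1073741824), (536870912, 268435456),
  (268435456, 536870912), (134217728, 67108864), (67108864, 134217728), (33554432, 33554432),
  (16777216, 16777216), (8388608, 4194304), (4194304, 8388608), (2097152, 1048576), (1048576,
  2097152)]) (both (lexTest [(17179869184, 17179869184), (8589934592, 4294967296), (4294967296,
  8589934592), (2147483648, 2147483648), (1073741824, 8388608), (536870912, 16777216), (268435456,
  4194304), (134217728, 2097152), (67108864, 524288), (33554432, 1048576), (16777216, 536870912),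
  (8388608, 1073741824), (4194304, 268435456), (2097152, 134217728), (1048576, 33554432), (524288,
  67108864)]) (both (lexTest [(17179869184, 8589934592), (8589934592, 17179869184), (4294967296,
  4294967296), (2147483648, 2147483648), (1073741824, 16777216), (536870912, 2097152), (268435456,
  1048576), (134217728, 8388608), (67108864, 4194304), (33554432, 524288), (16777216, 1073741824),
  (8388608, 134217728), (4194304, 67108864), (2097152, 536870912), (1048576, 268435456), (524288,
  33554432)]) (both (lexTest [(17179869184, 4294967296), (8589934592, 17179869184), (4294967296,
  8589934592), (2147483648, 2147483648), (1073741824, 8388608), (536870912, 2097152), (268435456,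
  524288), (134217728, 16777216), (67108864, 4194304), (33554432, 1048576), (16777216, 536870912),
  (8388608, 134217728), (4194304, 33554432), (2097152, 1073741824), (1048576, 268435456), (524288,
  67108864)]) (lexTest [(17179869184, 8589934592), (8589934592, 17179869184), (4294967296,
  2147483648), (2147483648, 4294967296), (1073741824, 16777216), (536870912, 1048576), (268435456,
  2097152), (134217728, 4194304), (67108864, 8388608), (33554432, 524288), (16777216, 1073741824),
  (8388608, 67108864), (4194304, 134217728), (2097152, 268435456), (1048576, 536870912), (524288,
  33554432)]))))))))))

theorem accepts_tripleTest19 : Accepts (TripleCandidate tripleMasks) tripleMasks 19 tripleTest19 :=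
Accepts.both (accepts_lexTest_triple (p := [1, 0, 3, 2, 4, 5, 6]) (by decide) (by decide +kernel))
    <|
Accepts.both (accepts_lexTest_triple (p := [3, 0, 1, 2, 5, 4, 6]) (by decide) (by decide +kernel))
    <|
Accepts.both (accepts_lexTest_triple (p := [0, 2, 1, 3, 4, 5, 6]) (by decide) (by decide +kernel))
    <|
Accepts.both (accepts_faceTest (W := 47) (fun _ h => h.good) enumerates_tripleMasks (by decide)
    (by decide +kernel)) <|
Accepts.both (accepts_lexTest_triple (p := [2, 3, 1, 0, 5, 4, 6]) (by decide) (by decide +kernel))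
    <|
Accepts.both (accepts_lexTest_triple (p := [0, 1, 3, 2, 4, 5, 6]) (by decide) (by decide +kernel))
    <|
Accepts.both (accepts_lexTest_triple (p := [1, 0, 2, 3, 4, 5, 6]) (by decide) (by decide +kernel))
    <|
Accepts.both (accepts_lexTest_triple (p := [0, 2, 1, 3, 5, 4, 6]) (by decide) (by decide +kernel))
    <|
Accepts.both (accepts_lexTest_triple (p := [0, 1, 3, 2, 5, 4, 6]) (by decide) (by decide +kernel))
    <|
Accepts.both (accepts_lexTest_triple (p := [0, 2, 3, 1, 5, 4, 6]) (by decide) (by decide +kernel))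
    <|
accepts_lexTest_triple (p := [1, 0, 3, 2, 5, 4, 6]) (by decide) (by decide +kernel)

/-- The tests applied when the lowest `22` bits are undecided. -/
noncomputable def tripleTest22 : ℕ → Bool := both (lexTest [(17179869184, 17179869184),
  (8589934592, 8589934592), (4294967296, 4294967296), (2147483648, 2147483648), (1073741824,
  16777216), (536870912, 8388608), (268435456, 4194304)]) (both (lexTest [(17179869184,
  17179869184), (8589934592, 4294967296), (4294967296, 8589934592), (2147483648, 2147483648),
  (1073741824, 536870912), (536870912, 1073741824), (268435456, 268435456), (134217728,
  134217728), (67108864, 33554432), (33554432, 67108864), (16777216, 8388608), (8388608,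
  16777216)]) (both (lexTest [(17179869184, 17179869184), (8589934592, 8589934592), (4294967296,
  2147483648), (2147483648, 4294967296), (1073741824, 1073741824), (536870912, 268435456),
  (268435456, 536870912), (134217728, 67108864), (67108864, 134217728), (33554432, 33554432),
  (16777216, 16777216), (8388608, 4194304), (4194304, 8388608)]) (lexTest [(17179869184,
  17179869184), (8589934592, 4294967296), (4294967296, 8589934592), (2147483648, 2147483648),
  (1073741824, 8388608), (536870912, 16777216), (268435456, 4194304)])))

theorem accepts_tripleTest22 : Accepts (TripleCandidate tripleMasks) tripleMasks 22 tripleTest22 :=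
Accepts.both (accepts_lexTest_triple (p := [0, 1, 2, 3, 5, 4, 6]) (by decide) (by decide +kernel))
    <|
Accepts.both (accepts_lexTest_triple (p := [0, 2, 1, 3, 4, 5, 6]) (by decide) (by decide +kernel))
    <|
Accepts.both (accepts_lexTest_triple (p := [1, 0, 2, 3, 4, 5, 6]) (by decide) (by decide +kernel))
    <|
accepts_lexTest_triple (p := [0, 2, 1, 3, 5, 4, 6]) (by decide) (by decide +kernel)

/-- The tests applied when the lowest `25` bits are undecided. -/
noncomputable def tripleTest25 : ℕ → Bool := both (lexTest [(17179869184, 8589934592),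
  (8589934592, 17179869184), (4294967296, 4294967296), (2147483648, 2147483648), (1073741824,
  1073741824), (536870912, 134217728), (268435456, 67108864), (134217728, 536870912), (67108864,
  268435456)]) (both (lexTest [(17179869184, 17179869184), (8589934592, 4294967296), (4294967296,
  8589934592), (2147483648, 2147483648), (1073741824, 536870912), (536870912, 1073741824),
  (268435456, 268435456), (134217728, 134217728), (67108864, 33554432), (33554432, 67108864)])
  (both (lexTest [(17179869184, 17179869184), (8589934592, 8589934592), (4294967296, 2147483648),
  (2147483648, 4294967296), (1073741824, 1073741824), (536870912, 268435456), (268435456,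
  536870912), (134217728, 67108864), (67108864, 134217728)]) tripleFace31))

theorem accepts_tripleTest25 : Accepts (TripleCandidate tripleMasks) tripleMasks 25 tripleTest25 :=
Accepts.both (accepts_lexTest_triple (p := [0, 1, 3, 2, 4, 5, 6]) (by decide) (by decide +kernel))
    <|
Accepts.both (accepts_lexTest_triple (p := [0, 2, 1, 3, 4, 5, 6]) (by decide) (by decide +kernel))
    <|
Accepts.both (accepts_lexTest_triple (p := [1, 0, 2, 3, 4, 5, 6]) (by decide) (by decide +kernel))
    <|
accepts_faceTest (W := 31) (fun _ h => h.good) enumerates_tripleMasks (by decide) (by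
    decide +kernel)

/-- The tests applied when the lowest `28` bits are undecided. -/
noncomputable def tripleTest28 : ℕ → Bool := both (lexTest [(17179869184, 17179869184),
  (8589934592, 2147483648), (4294967296, 8589934592), (2147483648, 4294967296), (1073741824,
  268435456), (536870912, 1073741824), (268435456, 536870912)]) (lexTest [(17179869184,
  17179869184), (8589934592, 4294967296), (4294967296, 8589934592), (2147483648, 2147483648),
  (1073741824, 536870912), (536870912, 1073741824)])

theorem accepts_tripleTest28 : Accepts (TripleCandidate tripleMasks) tripleMasks 28 tripleTest28 :=
Accepts.both (accepts_lexTest_triple (p := [1, 2, 0, 3, 4, 5, 6]) (by decide) (by decide +kernel))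
    <|
accepts_lexTest_triple (p := [0, 2, 1, 3, 4, 5, 6]) (by decide) (by decide +kernel)

/-- The face codes of all sets, as a table with `36`-bit entries. -/
def tripleFaceCodes : ℕ :=
  7001482762881282607352860749249040093467536876419159248019484657154650220493726368736619971525136678829998327085601179636874268345674371662778346598681643690608681298735977717731701628865956030174000036422992543870785872490492921856492169794015263952787765790271324849689394623383311393446220765102186161066922546052554712805549070740976272652385477202799438622947738374591680914294068792985072045004856763066291964161023187205326525368237186494921400090534620345915009157915930198078112617589059522010669761024970941881119057980520852194397685064334080439491086109642075350217631763988570823811750594698065586612981021976663542211842701256372080995768130862618057676190344520728120461067822762602715894152005341550646627871091579207188951412812735107104476181628163225667385635918924358090050490259550790967160436504580543808513474244311611836848240443533523457885513561689790622768649868189534488820448236493602866798439072010399442722937952678396086143497958648450120908404695914002306349810279781677159975139771893859695470578886338610447123726557501109851200805042285189011623833643886170798132415043023088522444305471228495379000586874154360270234198145030120340579309097757496063020871253836596271599619311081979668198789196946825180198310441704570167387968266939544939960584815391436759683355204698912205138772161058799600881769625982879802238943567078886872086970982170793869312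

/-- The masks of the sets with more than `2` elements. -/
def largeTripleMasks : List ℕ := [7, 11, 13, 14, 15, 19, 21, 22, 23, 25, 26, 27, 28, 29, 30, 31,
  35, 37, 38, 39, 41, 42, 43, 44, 45, 46, 47, 49, 50, 51, 52, 53, 54, 55, 56, 57, 58, 59, 60, 61,
  62, 63, 67, 69, 70, 71, 73, 74, 75, 76, 77, 78, 79, 81, 82, 83, 84, 85, 86, 87, 88, 89, 90, 91,
  92, 93, 94, 95, 97, 98, 99, 100, 101, 102, 103, 104, 105, 106, 107, 108, 109, 110, 111, 112,
  113, 114, 115, 116, 117, 118, 119, 120, 121, 122, 123, 124, 125, 126, 127]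

theorem faceData_triple : faceData tripleMasks 2 tripleFaceCodes largeTripleMasks = true := by
  decide +kernel

/-- The solutions for the families that pass all tests. -/
def tripleSolutions : SearchTree :=
  .node (.node (.node (.node (.node (.node (.node (.node (.node .leaf 33824647340
    66890454140505142396711420674622719623 .leaf) 33824655468
    66848951002362141994747321432660870791 .leaf) 33824662565
    55830329418573863691592834878037657223 (.node .leaf 33824901236
    66849564545252710306767060990166140551 .leaf)) 33828318732
    139379713321678226460557787145516852307396231 (.node (.node (.node .leaf 33828333068
    55830897326042765938364706500584769159 .leaf) 33828334092
    66464721292322092921595162982827525767 .leaf) 33828335116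
    77098545258601419904825619465070282375 (.node .leaf 33829564096
    892957142606592452039134714416382429726343 .leaf))) 33890609189
    66464117890630037940342395914408789639 (.node (.node (.node (.node .leaf 33890863220
    66849564545246363962709407451984266887 .leaf) 33894789381 2753595615860322013469194823763591
    .leaf) 33894795590 66848428730323310961466530460148008583 (.node .leaf 33894796037
    139379708004198078368926874631945478828820103 .leaf)) 33894801669
    2718101399053636442322107781187207 (.node (.node (.node .leaf 33894801702
    366260011134906177121152639831737991 .leaf) 33894801804 429054351267811748753693329813243527
    .leaf) 33894809932 387551213124811346789594087851394695 (.node .leaf 33894813957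
    7486214825598770528049747830335353751175 .leaf)))) 33894860300
    914729516233072779940596307481087001069191 (.node (.node (.node (.node (.node .leaf
    33894863878 7542042447056145523091129121500039841415 .leaf) 33894870028
    55830861832755624019720436593717773959 .leaf) 33894884358
    55830410547207661458670097087846778503 (.node .leaf 33894920204
    3321503077509013867651942811534983 .leaf)) 33896366900 366422012920321736512657727165138567
    (.node (.node (.node .leaf 33896366930 387028941077631833663388134471730823 .leaf) 33896676864
    55827576082399890593249078570960651911 .leaf) 33898989684
    66849564545246349795609958843048625799 (.node .leaf 33899512628
    512779880611738874057315643611514503 .leaf))) 33900565152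
    7486637840604051922541626968631260841607 (.node (.node (.node (.node .leaf 33900569137
    135198267768810004179848269069941235684312711 .leaf) 33900585632
    425804095114060909167944219067778695 .leaf) 33903658516 55831546104652772536925093969456105095
    (.node .leaf 33907376948 50514598628310589056360055163889747591 .leaf)) 33911036436
    66465370071931576875486608866417411719 (.node (.node .leaf 33911056916
    66465334835206298361274558958392673927 .leaf) 33911522836
    914729516917604096549374518422983785678471 (.node .leaf 33911566356
    3970540177311401655351931906393735 .leaf))))) 33913060864
    55827576082392318278593797094860490375 (.node (.node (.node (.node (.node (.node .leaf
    33913140736 55827611575680669639553003796375897735 .leaf) 33913141760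
    66461435541959996622783460278618654343 .leaf) 33957325664
    6701967555006057995493614220396559697543 (.node .leaf 33961499456
    66845665252014813716532684724806190727 .leaf)) 33961519968
    142167251045632135990361730342257885291579015 (.node (.node (.node .leaf 33962431136
    7486575533041755807788779138131616695943 .leaf) 33962436480
    56336421173606581601455622240726517383 .leaf) 33962451616 363496532817946156320113719423633031
    (.node .leaf 33962491392 55827611576615430208876801495170385543 .leaf))) 33962540544
    139379713318392476104767028193576640718669447 (.node (.node (.node (.node .leaf 33962554880
    55827611575686975179412766288996042375 .leaf) 33962555904
    66461435541966302162643222771238798983 .leaf) 33962556928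
    77095259508245629145873679253481555591 (.node .leaf 34094737280
    508880843851152385019823249181476487 .leaf)) 34094757760
    7486720917610280542705346778904259823239 (.node (.node (.node .leaf 34094765952
    7486720952847005820924410923632931735175 .leaf) 34094779276
    882012406865398376529343179407274681927303 .leaf) 34094780352
    136592120552805859180636205610183666887394951 (.node .leaf 34094788480
    56336421174535093965634041543582385799 .leaf)))) 34094795712
    136592064725265530430975934073529042802673287 (.node (.node (.node (.node (.node .leaf
    34094803840 508880845785433694097386919497664135 .leaf) 34094816128
    7486720917354723295843065245395558172295 .leaf) 34094843584
    892901315030510066109855104638811849983623 (.node .leaf 34094843796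
    136091169208698769268639154099197714069030535 .leaf)) 34094860037
    6210664794736373471744066106233096341127 (.node (.node (.node .leaf 34094860096
    136592064725265528496694624977950973977003655 .leaf) 34094867968
    35751714739277405820210408425095 .leaf) 34094868160 892901315066261774444416886977898557572743
    (.node .leaf 34094868256 136592064704496598554083485822926167677961863 .leaf))) 34094868384
    158892809986068477215370055728820562761713287 (.node (.node (.node (.node .leaf 34094868416
    1241350624911308017339006174722004051396231 .leaf) 34094976408
    512130844432947373627363632943040135 .leaf) 34095254912 508880588293905525044131650181891719
    (.node .leaf 34095254938 157499013476915629646815928893539828346750599 .leaf)) 34095254944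
    57665684407045288053854997343050761863 (.node (.node .leaf 34095369481
    882012406622009461285525422147418859079303 .leaf) 34095369600
    136592064766768411082448166966358616939267719 (.node .leaf 34095369611
    136592064775408717573603778566960145987110535 .leaf)))))) 34095377600
    892901315030769491919337847141570886076039 (.node (.node (.node (.node (.node (.node (.node
    .leaf 34095385600 35496157492417430128611408840327 .leaf) 34095385995
    158892809973939340715139496839608507493090951 .leaf) 34095386009
    159807555438774380125472180702988543472025600 (.node .leaf 34095386016
    158892809986068221658123195753128963762128519 .leaf)) 34110783948
    882012282285766062664511589121851893581447 (.node (.node (.node .leaf 34110898380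
    888307547576684060901473316067796649870983 .leaf) 34110899308
    888363312844944724950203733598372473702023 .leaf) 34110899785
    888533474554203713077425889936706659255943 (.node .leaf 34110914892
    882012282285766062664511571107453384099463 .leaf))) 34110922825
    882012282042634624139521594838057996355207 (.node (.node (.node (.node .leaf 34110922957
    910170263675374750413871332346308453566087 .leaf) 34111054272
    1219572387290397210861612063821473213941383 .leaf) 34111331225
    137993347131347373269434436309680411319305863 (.node .leaf 34111514496
    508880843851303500747275077828314759 .leaf)) 34111514560 550419218719582121775519048462075527
    (.node (.node (.node .leaf 34111565696 56336421174535245081361493372229224071 .leaf)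
    34111565760 56377959549403523702389737342862984839 .leaf) 34111581056
    508880845785584809824838748144502407 (.node .leaf 34111581120
    550419220653863430853082718778263175 .leaf)))) 34111593344
    7486720917354723446958792697224205010567 (.node (.node (.node (.node (.node .leaf 34111645184
    1219572003061063496231798210372020776306311 .leaf) 34111645443
    1219618372989853099131844824513172384089735 .leaf) 34111645472
    137811636707521910335576006627477978045843079 (.node .leaf 34111645632
    158901827022270257304374664424117798256871047 .leaf)) 34111645664
    148990479677767369115033664006840325289394176 (.node (.node (.node .leaf 34226674560
    7486720917354723237994075830242370750087 .leaf) 34226738688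
    7486212072260652543577384263533281511047 .leaf) 34226751296
    136592064725265528496637292497369884657026695 (.node .leaf 34226759168
    35751714681944925239121088448135 .leaf))) 34227146112 508880588293848192563550560861914759
    (.node (.node (.node (.node .leaf 34227146144 57665684407045230721374416253730784903 .leaf)
    34227248640 50510699335984238550442120992094783111 .leaf) 34227256320
    35753648963551456549880459527815 (.node .leaf 34227260681
    882012406622009461228192941566329539102343 .leaf)) 34227260800
    136592064766768411082390834485777527619290759 (.node (.node .leaf 34227268620
    882011898020563731587076749762235308803719 .leaf) 34227272704
    7486212072520078353060126766292317603463 (.node .leaf 34227276800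
    35496157435084949547522088863367 .leaf))))) 34227277216
    158892809986068221658065863272547874442151559 (.node (.node (.node (.node (.node (.node .leaf
    34227295328 6351414824640431826344372229867540153991 .leaf) 34227295744
    914729512947322422940397274405988613850759 .leaf) 34227312646
    6210156030775809697514896700042675324551 (.node .leaf 34227313152
    50510699335984238548136277982881089159 .leaf)) 34227318784 35751714682237767300191715952263
    (.node (.node (.node .leaf 34227322368 1272315769917390855518545025555165880878727 .leaf)
    34228869656 135198267769377655092029254261428444251653767 .leaf) 34229001088
    508860622796943295048989671300630151 (.node .leaf 34230863552
    56211805894490750124388360460752488071 .leaf))) 34230866592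
    7486575533144736340346155705442561787527 (.node (.node (.node (.node .leaf 34231303552
    508845351569174731557118326130181767 .leaf) 34231340448
    142167307797472035502430969292961553125312135 .leaf) 34231450624
    35753649568014366357195046880903 (.node .leaf 34231451136
    9187623942361496553354121660673770751623 .leaf)) 34231454985
    882012406622009461832655851373644126455431 (.node (.node .leaf 34231462924
    882011898020563732191539659569549896156807 .leaf) 34231467008
    7486212072520078957523036573606904956551 (.node .leaf 34231467022
    7571286112259946194172852296497565632135 .leaf)))) 34231471104
    35496158039547859354836676216455 (.node (.node (.node (.node (.node .leaf 34231471520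
    159829334403942759307072444123646242978906112 .leaf) 34231479822
    150536580529128438127166788749588691568395911 .leaf) 34231483406
    167263160275091676016183888538062029842646663 (.node .leaf 34231483872
    168220187148662714730059496744299019188797455 .leaf)) 34231483904
    1315871912883270979446027043051576660166279 (.node (.node (.node .leaf 34231484320
    168220346656022102069660136932307956783906831 .leaf) 34231513088
    1219572003062014234636122168678873733367431 .leaf) 34231516512
    161689420701701815506023377283292324988028551 (.node .leaf 34231516672
    161689590313270996404702690860485415291684487 .leaf))) 34231517184
    17113290054921068641058092844679 (.node (.node (.node (.node .leaf 34231518912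
    50894910920648435342023565872474719879 .leaf) 34231519491
    46369945904827236279066188889230509703 .leaf) 34231522400
    964530732515293462179796443379047319570055 (.node .leaf 34231522816
    7536722753213763054291707510746832537223 .leaf)) 34231523040
    964927808225253054587854677879325091792519 (.node (.node .leaf 34231535626
    156987228287589522237687257861554132046153351 .leaf) 34231535657
    156987228650969172696710585176993086086416007 (.node .leaf 34231535747
    1219617864145456143875906109397602417346183 .leaf))))))) 34231535915
    156987228817284931446654282653360546631747207 (.node (.node (.node (.node (.node (.node (.node
    (.node .leaf 34231536907 162606017097318622050609119261615617619378176 .leaf) 34231536939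
    162606018262867572303228403319583376360341527 .leaf) 34231537035
    162606017177677528900277037470598578099568723 (.node .leaf 34231541772
    156987228287752037071763331200636209544398471 .leaf)) 34231545358
    162615204209662552365820198943218666274029583 (.node (.node (.node .leaf 34231545792
    162604269907477064630360535560720793603899415 .leaf) 34231548942
    161687973975476428685230640637697879680845447 .leaf) 34231549280
    161689420701701815506023672431197504340854407 (.node .leaf 34231549440
    161689590313270996404702986008390594644510343 .leaf))) 34231549454
    168231263605551587555273798339045835248741015 (.node (.node (.node (.node .leaf 34231549920
    168220459640401743788718266421011794902483840 .leaf) 34232044404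
    142173461202762973127634218602917767636420231 .leaf) 34233602068
    136417839772114891340849790975858098896733831 (.node .leaf 34245005760
    384265563274318333782684194916632199 .leaf)) 34245760896
    7486720952847005981484871341200835446407 (.node (.node (.node .leaf 34245760928
    7543877756665757364013682206893704316551 .leaf) 34245769088
    1306684797821753334206430058370963194873479 .leaf) 34245769120
    1306741954625572085588958869236656063743623 (.node .leaf 34245811072
    7486720917354723456403525662963461883527 .leaf)))) 34245867008
    8847341575545079760844616223773530883719 (.node (.node (.node (.node (.node .leaf 34245867424
    158901657327608270580391622939224125884171911 .leaf) 34248117689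
    142167307800838915496754025153787820557829767 .leaf) 34249965536
    168220527856798288288415545275589081029413803 (.node .leaf 34254199680
    508845235202420260599073112769005191 .leaf)) 34254199711
    136086541337524681474512804109475132089942016 (.node (.node (.node .leaf 34254225376
    168220537182163446507108158284243065848840235 .leaf) 34293248000
    7486212108012354531008801845141584578183 .leaf) 34293252096 138649284652740733344678250119
    (.node .leaf 34293257728 922215725019721712073568271541727184389767 .leaf))) 34293276805
    8847344293420153030414786739306347464327 (.node (.node (.node (.node .leaf 34293276864
    8847725805544797718335461187102884333191 .leaf) 34293284352
    168220289499218283302863822965398571644469248 .leaf) 34301592594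
    135198267768926508186998949906220218107397767 (.node .leaf 34301592625
    135198268132306158646022277221659172147660423 .leaf)) 34301594650
    140773454069208201079699732927948620525045383 (.node (.node .leaf 34301594673
    135198268132306160580303588605065851677542023 .leaf) 34301594769
    135198267768845380482865654654093004812682887 (.node .leaf 34301636753
    135205753980917758037024306602713205285684871 .leaf))))) 34302165812
    136592064708395772958127827663029515747427975 (.node (.node (.node (.node (.node (.node .leaf
    34302165842 135204563501524143474526597756339331858269831 .leaf) 34302167894
    140779800973635664453867703602565911163537031 .leaf) 34303733788
    978056593158002465957355176536306390238855 (.node .leaf 34303733841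
    7486599055823643538684659651884561565319 .leaf)) 34303733905
    7486214825856111961440194557052379825799 (.node (.node (.node .leaf 34303733969
    7656356009316581193171881860768263931527 .leaf) 34303848860
    978057018890850663816171611221802757752455 .leaf) 34303848861
    978057024083147522350999239752299086972551 (.node .leaf 34303848924
    978057060429225532094792639465773391513223 .leaf))) 34303995904
    1227058215133958831656963386745126555846279 (.node (.node (.node (.node .leaf 34303995932
    136086489814383354387107677839822816918487040 .leaf) 34303998013
    140267926413906375683143051822980515320152064 .leaf) 34303999200
    161688116199423612375352452867579494323816071 (.node .leaf 34303999488
    151800644448181287668818202317778265374557831 .leaf)) 34304000000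
    15631101363136895839038622515200 (.node (.node (.node .leaf 34304005632
    964756337812314611748465867804633276465152 .leaf) 34304005646
    888273223551393804343090367725547918049280 .leaf) 34304016529
    156998117672349212605182934948067549758472192 (.node .leaf 34304020561
    157069747110586070151741975302931936966983680 .leaf)))) 34304021041
    157069963774749383093029258623482762663149568 (.node (.node (.node (.node (.node .leaf
    34304024709 157006965012915601344257702507511307670241280 .leaf) 34304024742
    157007010886858346499459800574446376329789440 .leaf) 34304024768
    146180711443065704735827978230827032389206016 (.node .leaf 34304024793
    145843151261150750774761971960995784404877312 .leaf)) 34304024797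
    136434939305976537787123857524717772687654912 (.node (.node (.node .leaf 34304025637
    157028789607378393877974910115634050647834624 .leaf) 34304025667
    146180767195556047349576156281270839902846976 .leaf) 34304028881
    168241897781336867143634487203760546770960384 (.node .leaf 34304028889
    167263245694718739870567678532753094569476096 .leaf))) 34304030765
    168143877864829136131338752814121187751084032 (.node (.node (.node (.node .leaf 34304030915
    168241964241600841451623638850372514716172288 .leaf) 34304031968
    168241974524741945683813240295969785034145815 .leaf) 34304032256
    168220289499218600215513880022656549625272975 (.node .leaf 34304032286
    136086540989661193344309123681366110391091200 .leaf)) 34304032480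
    168242237711885000746407267671887572737825431 (.node (.node .leaf 34307360576
    136592064725265667145360643934183336563803783 .leaf) 34307470848
    7486212108012360317090668972780865029767 (.node .leaf 34308059605
    159881755561768944578880369043373397804957696 .leaf)))))) 34308059612
    159881755556576647720345532181166238692655131 (.node (.node (.node (.node (.node (.node (.node
    .leaf 34308146464 137811636707523555189619438128799290375898759 .leaf) 34308190493
    158477070069324876859135436837309264947167232 .leaf) 34308887890
    136599550940101268322476329747606928051504775 (.node .leaf 34308888337
    7486723635196546991311730674448063628935 .leaf)) 34308896210
    147750093296320072830898676106139992506861191 (.node (.node (.node .leaf 34309167072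
    157091922778266177298774410755325847268343808 .leaf) 34309230912
    137819122940363735620563634421660007878985351 .leaf) 34309239133
    158477155137198766682698375524945678668388043 (.node .leaf 34309239232
    148969665296582540128985980780193072334341767 .leaf))) 34309242336
    162669490545623455163607569042472950917234703 (.node (.node (.node (.node .leaf 34309242364
    142176325284456125453683667798889294886984347 .leaf) 34310029720
    135198267769377791815487177420509703982909063 .leaf) 34310033812
    7486216007186773439933087508823447799431 (.node .leaf 34318333216
    7486575533298965697301890445774365755015 .leaf)) 34318335264
    7553036933088211490947080798788382983815 (.node (.node (.node .leaf 34318335296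
    7553057702275645630257594920773699864199 .leaf) 34318335360
    7552673472308114053013129825941518124679 .leaf) 34318370051
    45861119331063112731696835561137735303 (.node .leaf 34318370080
    363496413694063726675817792838928007 .leaf)))) 34318370624
    50894929440955006207534608068808902279 (.node (.node (.node (.node (.node .leaf 34318372128
    66824896202939857371866170806856156807 .leaf) 34318372224
    66461435422842419437915197959991297671 .leaf) 34318372256
    139379714647655846982606560739762898255316615 (.node .leaf 34318414208
    7486212108013085065756056871825976952455 .leaf)) 34318414272
    7656353291473554297487744175541861058183 (.node (.node (.node .leaf 34318859776
    7552673472308105590532346362740626261639 .leaf) 34318939648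
    7542039683836043069937233305156859561607 .leaf) 34318940672
    7552673507802322396920463761639102318215 (.node .leaf 34320432448
    7553057702275800372762505591796319749767 .leaf))) 34320432512
    7552673472308268795518040496964138010247 (.node (.node (.node (.node .leaf 34320432576
    7722814655768738027249727800680022115975 .leaf) 34320511296
    7486596337980771385505432637680778577543 .leaf) 34320511360
    7486212108013239808260967542848596838023 (.node .leaf 34320511424
    7656353291473709039992654846564480943751 .leaf)) 34320579584
    7552673507802470792567155445265928128135 (.node (.node .leaf 34320579614
    156996121488954498490481999126668945895309312 .leaf) 34320580096
    150537516302189461938836848946374124398544519 (.node .leaf 34320793984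
    156998117829375627761943217831081171854147584 .leaf))))) 34320798016
    157069747267612485308502258185945559062659072 (.node (.node (.node (.node (.node (.node .leaf
    34320806336 168241897938363282300394770086774168866635776 .leaf) 34320809952
    168242238220730092888109425728690215640734359 .leaf) 34322564403
    47191645401101347937735443379090982535 (.node .leaf 34322564531
    137985918075627785223855400485311811544254087 .leaf)) 34324624643
    7532582001308616944770791740205988939399 (.node (.node (.node .leaf 34324624672
    136599550916533365853388932594705011650692743 .leaf) 34324624700
    137570121297583355094388688846864682410411655 .leaf) 34324626848
    142174794009509060292717457022759948031198855 (.node .leaf 34324661507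
    46369964423345311195577112224462112391 .leaf))) 34324661536
    136592064704496480581755357380077030123865735 (.node (.node (.node (.node .leaf 34324661555
    47701666873101987089659850438295783047 .leaf) 34324661563
    137985861288044951019256951372719081765832327 .leaf) 34324663595
    142167251012769442858294898548840649548203655 (.node .leaf 34324663712
    142167307797472175021083881808131966504371847 .leaf)) 34324836352
    1227058215134275750200533814716817958340231 (.node (.node .leaf 34324839454
    162568624741716818266554667099466826261315584 .leaf) 34324839936
    151800644448181604587361772745749956777051783 (.node .leaf 34324840160
    162669660686807230098170151704762091915182095 .leaf)))) 34324840416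
    165457253836623557990862116488843137103429647 (.node (.node (.node (.node (.node .leaf
    34324923680 137811636707523555189770553856251119022737031 .leaf) 34324923707
    136080325867436642707679108795407297923891200 .leaf) 34324925856
    143386879800499249629099078284306055403243143 (.node .leaf 34324938720
    168242294868688921024286821446200031990257319 .leaf)) 34325151232
    7552673472308144385953594757593554060935 (.node (.node (.node .leaf 34357968864
    168285862154323858218571402522061954355412992 .leaf) 34359050208
    162713041371677344719627190558202511369437223 .leaf) 34359230361
    151538287261240740456687178943989532512600064 (.node .leaf 34359508960
    157138211813991393709591265348357533131194368 .leaf))) 34359639552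
    157116261763252539082669011301083231889244160 (.node (.node (.node (.node .leaf 34359640032
    159925469489507676773104016825827357805494272 .leaf) 34359701504
    157072298876519300055822381199182599144980480 .leaf) 34359705088
    162691381601484756902993086091703387620753408 (.node .leaf 34359705568
    165500969486949254168500427987801309001662464 .leaf)) 34359705600
    15630951909682463996494547501056 (.node (.node .leaf 34359738336
    137843876769098104281365973317250265799180288 .leaf) 34359738366
    136086536326978614230580458829140061699686400 (.node .leaf 34359738367
    136086536020633099586697035338786625873231872 .leaf)))))))

/-- The search once all bits are decided. -/
noncomputable def tripleSearch0 : ℕ → Bool := leafTest 2 tripleFaceCodes largeTripleMasks [3, 5,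
  6, 9, 10, 12, 17, 18, 20, 24, 33, 34, 36, 40, 48, 65, 66, 68, 72, 80, 96] tripleSolutions

theorem certifies_tripleSearch0 :
    Certifies (TripleCandidate tripleMasks) (Sol 2) tripleMasks 0 tripleSearch0 :=
  certifies_leafTest enumerates_tripleMasks faceData_triple _

/-- The search when the lowest `1` bits are undecided. -/
noncomputable def tripleSearch1 : ℕ → Bool := branch 1 tripleTest0 tripleSearch0

theorem certifies_tripleSearch1 :
    Certifies (TripleCandidate tripleMasks) (Sol 2) tripleMasks 1 tripleSearch1 :=
  certifies_tripleSearch0.branch accepts_tripleTest0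

/-- The search when the lowest `2` bits are undecided. -/
noncomputable def tripleSearch2 : ℕ → Bool := branch 2 tripleTest1 tripleSearch1

theorem certifies_tripleSearch2 :
    Certifies (TripleCandidate tripleMasks) (Sol 2) tripleMasks 2 tripleSearch2 :=
  certifies_tripleSearch1.branch accepts_tripleTest1

/-- The search when the lowest `3` bits are undecided. -/
noncomputable def tripleSearch3 : ℕ → Bool := branch 4 tripleTest2 tripleSearch2

theorem certifies_tripleSearch3 :
    Certifies (TripleCandidate tripleMasks) (Sol 2) tripleMasks 3 tripleSearch3 :=
  certifies_tripleSearch2.branch accepts_tripleTest2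

/-- The search when the lowest `4` bits are undecided. -/
noncomputable def tripleSearch4 : ℕ → Bool := branch 8 tripleTest3 tripleSearch3

theorem certifies_tripleSearch4 :
    Certifies (TripleCandidate tripleMasks) (Sol 2) tripleMasks 4 tripleSearch4 :=
  certifies_tripleSearch3.branch accepts_tripleTest3

/-- The search when the lowest `5` bits are undecided. -/
noncomputable def tripleSearch5 : ℕ → Bool := branch 16 tripleTest4 tripleSearch4

theorem certifies_tripleSearch5 :
    Certifies (TripleCandidate tripleMasks) (Sol 2) tripleMasks 5 tripleSearch5 :=
  certifies_tripleSearch4.branch accepts_tripleTest4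

/-- The search when the lowest `6` bits are undecided. -/
noncomputable def tripleSearch6 : ℕ → Bool := branch 32 tripleTest5 tripleSearch5

theorem certifies_tripleSearch6 :
    Certifies (TripleCandidate tripleMasks) (Sol 2) tripleMasks 6 tripleSearch6 :=
  certifies_tripleSearch5.branch accepts_tripleTest5

/-- The search when the lowest `7` bits are undecided. -/
noncomputable def tripleSearch7 : ℕ → Bool := branch 64 tripleTest6 tripleSearch6

theorem certifies_tripleSearch7 :
    Certifies (TripleCandidate tripleMasks) (Sol 2) tripleMasks 7 tripleSearch7 :=
  certifies_tripleSearch6.branch accepts_tripleTest6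

/-- The search when the lowest `8` bits are undecided. -/
noncomputable def tripleSearch8 : ℕ → Bool := branch 128 tripleTest7 tripleSearch7

theorem certifies_tripleSearch8 :
    Certifies (TripleCandidate tripleMasks) (Sol 2) tripleMasks 8 tripleSearch8 :=
  certifies_tripleSearch7.branch accepts_tripleTest7

/-- The search when the lowest `9` bits are undecided. -/
noncomputable def tripleSearch9 : ℕ → Bool := branch 256 tripleTest8 tripleSearch8

theorem certifies_tripleSearch9 :
    Certifies (TripleCandidate tripleMasks) (Sol 2) tripleMasks 9 tripleSearch9 :=
  certifies_tripleSearch8.branch accepts_tripleTest8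

/-- The search when the lowest `10` bits are undecided. -/
noncomputable def tripleSearch10 : ℕ → Bool := branch 512 tripleTest9 tripleSearch9

theorem certifies_tripleSearch10 :
    Certifies (TripleCandidate tripleMasks) (Sol 2) tripleMasks 10 tripleSearch10 :=
  certifies_tripleSearch9.branch accepts_tripleTest9

/-- The search when the lowest `11` bits are undecided. -/
noncomputable def tripleSearch11 : ℕ → Bool := branch 1024 tripleTest10 tripleSearch10

theorem certifies_tripleSearch11 :
    Certifies (TripleCandidate tripleMasks) (Sol 2) tripleMasks 11 tripleSearch11 :=
  certifies_tripleSearch10.branch accepts_tripleTest10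

/-- The search when the lowest `12` bits are undecided. -/
noncomputable def tripleSearch12 : ℕ → Bool := branch 2048 tripleTest11 tripleSearch11

theorem certifies_tripleSearch12 :
    Certifies (TripleCandidate tripleMasks) (Sol 2) tripleMasks 12 tripleSearch12 :=
  certifies_tripleSearch11.branch accepts_tripleTest11

/-- The search when the lowest `13` bits are undecided. -/
noncomputable def tripleSearch13 : ℕ → Bool := branch 4096 tripleTest12 tripleSearch12

theorem certifies_tripleSearch13 :
    Certifies (TripleCandidate tripleMasks) (Sol 2) tripleMasks 13 tripleSearch13 :=
  certifies_tripleSearch12.branch accepts_tripleTest12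

/-- The search when the lowest `14` bits are undecided. -/
noncomputable def tripleSearch14 : ℕ → Bool := branch 8192 tripleTest13 tripleSearch13

theorem certifies_tripleSearch14 :
    Certifies (TripleCandidate tripleMasks) (Sol 2) tripleMasks 14 tripleSearch14 :=
  certifies_tripleSearch13.branch accepts_tripleTest13

/-- The search when the lowest `15` bits are undecided. -/
noncomputable def tripleSearch15 : ℕ → Bool := branch 16384 tripleTest14 tripleSearch14

theorem certifies_tripleSearch15 :
    Certifies (TripleCandidate tripleMasks) (Sol 2) tripleMasks 15 tripleSearch15 :=
  certifies_tripleSearch14.branch accepts_tripleTest14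

/-- The search when the lowest `16` bits are undecided. -/
noncomputable def tripleSearch16 : ℕ → Bool := branch 32768 tripleTest15 tripleSearch15

theorem certifies_tripleSearch16 :
    Certifies (TripleCandidate tripleMasks) (Sol 2) tripleMasks 16 tripleSearch16 :=
  certifies_tripleSearch15.branch accepts_tripleTest15

/-- The search when the lowest `17` bits are undecided. -/
noncomputable def tripleSearch17 : ℕ → Bool := branch 65536 tripleTest16 tripleSearch16

theorem certifies_tripleSearch17 :
    Certifies (TripleCandidate tripleMasks) (Sol 2) tripleMasks 17 tripleSearch17 :=
  certifies_tripleSearch16.branch accepts_tripleTest16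

/-- The search when the lowest `18` bits are undecided. -/
noncomputable def tripleSearch18 : ℕ → Bool := branch 131072 tripleTest17 tripleSearch17

theorem certifies_tripleSearch18 :
    Certifies (TripleCandidate tripleMasks) (Sol 2) tripleMasks 18 tripleSearch18 :=
  certifies_tripleSearch17.branch accepts_tripleTest17

/-- The search when the lowest `19` bits are undecided. -/
noncomputable def tripleSearch19 : ℕ → Bool := branch 262144 (fun _ => true) tripleSearch18

theorem certifies_tripleSearch19 :
    Certifies (TripleCandidate tripleMasks) (Sol 2) tripleMasks 19 tripleSearch19 :=
  certifies_tripleSearch18.branch accepts_true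

/-- The search when the lowest `20` bits are undecided. -/
noncomputable def tripleSearch20 : ℕ → Bool := branch 524288 tripleTest19 tripleSearch19

theorem certifies_tripleSearch20 :
    Certifies (TripleCandidate tripleMasks) (Sol 2) tripleMasks 20 tripleSearch20 :=
  certifies_tripleSearch19.branch accepts_tripleTest19

/-- The search when the lowest `21` bits are undecided. -/
noncomputable def tripleSearch21 : ℕ → Bool := branch 1048576 (fun _ => true) tripleSearch20

theorem certifies_tripleSearch21 :
    Certifies (TripleCandidate tripleMasks) (Sol 2) tripleMasks 21 tripleSearch21 :=
  certifies_tripleSearch20.branch accepts_true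

/-- The search when the lowest `22` bits are undecided. -/
noncomputable def tripleSearch22 : ℕ → Bool := branch 2097152 (fun _ => true) tripleSearch21

theorem certifies_tripleSearch22 :
    Certifies (TripleCandidate tripleMasks) (Sol 2) tripleMasks 22 tripleSearch22 :=
  certifies_tripleSearch21.branch accepts_true

/-- The search when the lowest `23` bits are undecided. -/
noncomputable def tripleSearch23 : ℕ → Bool := branch 4194304 tripleTest22 tripleSearch22

theorem certifies_tripleSearch23 :
    Certifies (TripleCandidate tripleMasks) (Sol 2) tripleMasks 23 tripleSearch23 :=
  certifies_tripleSearch22.branch accepts_tripleTest22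

/-- The search when the lowest `24` bits are undecided. -/
noncomputable def tripleSearch24 : ℕ → Bool := branch 8388608 (fun _ => true) tripleSearch23

theorem certifies_tripleSearch24 :
    Certifies (TripleCandidate tripleMasks) (Sol 2) tripleMasks 24 tripleSearch24 :=
  certifies_tripleSearch23.branch accepts_true

/-- The search when the lowest `25` bits are undecided. -/
noncomputable def tripleSearch25 : ℕ → Bool := branch 16777216 (fun _ => true) tripleSearch24

theorem certifies_tripleSearch25 :
    Certifies (TripleCandidate tripleMasks) (Sol 2) tripleMasks 25 tripleSearch25 :=
  certifies_tripleSearch24.branch accepts_true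

/-- The search when the lowest `26` bits are undecided. -/
noncomputable def tripleSearch26 : ℕ → Bool := branch 33554432 tripleTest25 tripleSearch25

theorem certifies_tripleSearch26 :
    Certifies (TripleCandidate tripleMasks) (Sol 2) tripleMasks 26 tripleSearch26 :=
  certifies_tripleSearch25.branch accepts_tripleTest25

/-- The search when the lowest `27` bits are undecided. -/
noncomputable def tripleSearch27 : ℕ → Bool := branch 67108864 (fun _ => true) tripleSearch26

theorem certifies_tripleSearch27 :
    Certifies (TripleCandidate tripleMasks) (Sol 2) tripleMasks 27 tripleSearch27 :=
  certifies_tripleSearch26.branch accepts_true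

/-- The search when the lowest `28` bits are undecided. -/
noncomputable def tripleSearch28 : ℕ → Bool := branch 134217728 (fun _ => true) tripleSearch27

theorem certifies_tripleSearch28 :
    Certifies (TripleCandidate tripleMasks) (Sol 2) tripleMasks 28 tripleSearch28 :=
  certifies_tripleSearch27.branch accepts_true

/-- The search when the lowest `29` bits are undecided. -/
noncomputable def tripleSearch29 : ℕ → Bool := branch 268435456 tripleTest28 tripleSearch28

theorem certifies_tripleSearch29 :
    Certifies (TripleCandidate tripleMasks) (Sol 2) tripleMasks 29 tripleSearch29 :=
  certifies_tripleSearch28.branch accepts_tripleTest28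

/-- The search when the lowest `30` bits are undecided. -/
noncomputable def tripleSearch30 : ℕ → Bool := branch 536870912 (fun _ => true) tripleSearch29

theorem certifies_tripleSearch30 :
    Certifies (TripleCandidate tripleMasks) (Sol 2) tripleMasks 30 tripleSearch30 :=
  certifies_tripleSearch29.branch accepts_true

/-- The search when the lowest `31` bits are undecided. -/
noncomputable def tripleSearch31 : ℕ → Bool := branch 1073741824 (fun _ => true) tripleSearch30

theorem certifies_tripleSearch31 :
    Certifies (TripleCandidate tripleMasks) (Sol 2) tripleMasks 31 tripleSearch31 :=
  certifies_tripleSearch30.branch accepts_true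

/-- The search succeeds. -/
theorem tripleSearch31_eq_true : tripleSearch31 32212254720 = true := by
  decide +kernel

/-- Distinct pairs span disjoint intervals. -/
def PairwiseDisjointIntervals (P : Finset (Finset (Fin 7) × Finset (Fin 7))) : Prop :=
  ∀ p ∈ P, ∀ q ∈ P, p ≠ q → ∀ s, p.1 ⊆ s → s ⊆ p.2 → q.1 ⊆ s → s ⊆ q.2 → False

/-- `D` has an interval partition all of whose largest elements have at least `d` elements. -/
def DepthGe (D : Finset (Finset (Fin 7))) (d : ℕ) : Prop :=
  ∃ P : Finset (Finset (Fin 7) × Finset (Fin 7)),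
    (∀ p ∈ P, p.1 ⊆ p.2 ∧ p.2 ∈ D ∧ d ≤ #p.2) ∧ PairwiseDisjointIntervals P ∧
    ∀ s ∈ D, ∃ p ∈ P, p.1 ⊆ s ∧ s ⊆ p.2

/-- The subsets of `V` outside `D` with at most `d` elements are covered by disjoint intervals
outside `D` whose largest elements have more than `d` elements. -/
def CoDepthGt (V : Finset (Fin 7)) (D : Finset (Finset (Fin 7))) (d : ℕ) : Prop :=
  ∃ P : Finset (Finset (Fin 7) × Finset (Fin 7)),
    (∀ p ∈ P, p.1 ⊆ p.2 ∧ p.2 ⊆ V ∧ p.1 ∉ D ∧ d + 1 ≤ #p.2) ∧ PairwiseDisjointIntervals P ∧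
    ∀ s ⊆ V, s ∉ D → #s ≤ d → ∃ p ∈ P, p.1 ⊆ s ∧ s ⊆ p.2

/-- A down set on the vertex set `V`, of Stanley depth at least `d`. -/
structure DeepDownSet (V : Finset (Fin 7)) (D : Finset (Finset (Fin 7))) (d : ℕ) : Prop where
  down : IsDownSet D
  subset : ∀ s ∈ D, s ⊆ V
  empty_mem : ∅ ∈ D
  not_mem : V ∉ D
  depth : DepthGe D d

theorem PairwiseDisjointIntervals.mono {P Q : Finset (Finset (Fin 7) × Finset (Fin 7))}
    (h : PairwiseDisjointIntervals Q) (hPQ : P ⊆ Q) : PairwiseDisjointIntervals P :=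
  fun p hp q hq => h p (hPQ hp) q (hPQ hq)

theorem PairwiseDisjointIntervals.union {P Q : Finset (Finset (Fin 7) × Finset (Fin 7))}
    (hP : PairwiseDisjointIntervals P) (hQ : PairwiseDisjointIntervals Q)
    (h : ∀ p ∈ P, ∀ q ∈ Q, ∀ s, p.1 ⊆ s → s ⊆ p.2 → q.1 ⊆ s → s ⊆ q.2 → False) :
    PairwiseDisjointIntervals (P ∪ Q) := by
  intro p hp q hq hpq s h1 h2 h3 h4
  rcases mem_union.1 hp with hp | hp <;> rcases mem_union.1 hq with hq | hq
  · exact hP p hp q hq hpq s h1 h2 h3 h4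
  · exact h p hp q hq s h1 h2 h3 h4
  · exact h q hq p hp s h3 h4 h1 h2
  · exact hQ p hp q hq hpq s h1 h2 h3 h4

theorem pairwiseDisjointIntervals_singleton (p : Finset (Fin 7) × Finset (Fin 7)) :
    PairwiseDisjointIntervals {p} := by
  intro q hq r hr h
  rw [mem_singleton] at hq hr
  exact absurd (hq.trans hr.symm) h

namespace DeepDownSet

variable {V : Finset (Fin 7)} {D : Finset (Finset (Fin 7))} {d : ℕ}

theorem exists_superset (h : DeepDownSet V D d) {s : Finset (Fin 7)} (hs : s ∈ D) (hd : #s ≤ d) :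
    ∃ t ∈ D, s ⊆ t ∧ #t = d := by
  obtain ⟨P, h1, h2, h3⟩ := h.depth
  obtain ⟨p, hp, hp1, hp2⟩ := h3 s hs
  obtain ⟨t, ht1, ht2, ht3⟩ := exists_subsuperset_card_eq hp2 hd (h1 p hp).2.2
  exact ⟨t, h.down _ (h1 p hp).2.1 _ ht2, ht1, ht3⟩

theorem card_lt (h : DeepDownSet V D d) : d < #V := by
  obtain ⟨t, ht, -, rfl⟩ := h.exists_superset h.empty_mem (by simp)
  exact card_lt_card ((h.subset t ht).ssubset_of_ne fun e => h.not_mem (e ▸ ht))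

/-- One interval suffices in codimension one. -/
theorem coDepthGt_of_card (h : DeepDownSet V D d) (hV : #V = d + 1) : CoDepthGt V D d := by
  have key : ∀ s ⊆ V, s ∉ D ↔ V.filter (fun x => V.erase x ∈ D) ⊆ s := by
    intro s hs
    constructor
    · intro hsD x hx
      by_contra hxs
      exact hsD (h.down _ (mem_filter.1 hx).2 s fun y hy =>
        Finset.mem_erase.2 ⟨fun e => hxs (e ▸ hy), hs hy⟩)
    · intro hR hsD
      have hd : #s ≤ d := by
        have := card_lt_card (hs.ssubset_of_ne fun e => h.not_mem (e ▸ hsD))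
        omega
      obtain ⟨t, ht, hst, htd⟩ := h.exists_superset hsD hd
      obtain ⟨x, hxV, hxt⟩ := exists_of_ssubset
        ((h.subset t ht).ssubset_of_ne fun e => h.not_mem (e ▸ ht))
      have e : t = V.erase x := by
        apply eq_of_subset_of_card_le
        · exact fun y hy => Finset.mem_erase.2 ⟨fun e => hxt (e ▸ hy), h.subset t ht hy⟩
        · rw [card_erase_of_mem hxV]; omega
      exact hxt (hst (hR (mem_filter.2 ⟨hxV, e ▸ ht⟩)))
  refine ⟨{(V.filter (fun x => V.erase x ∈ D), V)}, ?_, pairwiseDisjointIntervals_singleton _, ?_⟩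
  · intro p hp
    rw [mem_singleton] at hp
    subst hp
    exact ⟨filter_subset _ _, subset_rfl, (key _ (filter_subset _ _)).2 subset_rfl, hV.ge⟩
  · exact fun s hs hsD _ => ⟨_, mem_singleton_self _, (key s hs).1 hsD, hs⟩

/-- A vertex that spans a non-face can be removed. -/
theorem coDepthGt_of_singleton (h : DeepDownSet V D d) {v : Fin 7} (hv : v ∈ V) (hvD : {v} ∉ D)
    (ih : V.erase v ∉ D → CoDepthGt (V.erase v) D d) : CoDepthGt V D d := by
  have hD : ∀ s ∈ D, v ∉ s := fun s hs hvs =>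
    hvD (h.down s hs _ (singleton_subset_iff.2 hvs))
  by_cases hVD : V.erase v ∈ D
  · refine ⟨{({v}, V)}, ?_, pairwiseDisjointIntervals_singleton _, ?_⟩
    · intro p hp
      rw [mem_singleton] at hp
      subst hp
      exact ⟨singleton_subset_iff.2 hv, subset_rfl, hvD, h.card_lt⟩
    · refine fun s hs hsD _ => ⟨_, mem_singleton_self _, singleton_subset_iff.2 ?_, hs⟩
      by_contra hvs
      exact hsD (h.down _ hVD s fun y hy => Finset.mem_erase.2 ⟨fun e => hvs (e ▸ hy), hs hy⟩)
  · obtain ⟨P, h1, h2, h3⟩ := ih hVD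
    refine ⟨P ∪ {({v}, V)}, ?_, h2.union (pairwiseDisjointIntervals_singleton _) ?_, ?_⟩
    · intro p hp
      rcases mem_union.1 hp with hp | hp
      · exact ⟨(h1 p hp).1, (h1 p hp).2.1.trans (erase_subset _ _), (h1 p hp).2.2⟩
      · rw [mem_singleton] at hp
        subst hp
        exact ⟨singleton_subset_iff.2 hv, subset_rfl, hvD, h.card_lt⟩
    · intro p hp q hq s _ h5 h6 _
      rw [mem_singleton] at hq
      subst hq
      exact notMem_erase v V ((h1 p hp).2.1 (h5 (singleton_subset_iff.1 h6)))
    · intro s hs hsD hd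
      by_cases hvs : v ∈ s
      · exact ⟨_, mem_union_right _ (mem_singleton_self _), singleton_subset_iff.2 hvs, hs⟩
      · obtain ⟨p, hp, hp'⟩ := h3 s
          (fun y hy => Finset.mem_erase.2 ⟨fun e => hvs (e ▸ hy), hs hy⟩) hsD hd
        exact ⟨p, mem_union_left _ hp, hp'⟩

theorem erase (h : DeepDownSet V D d) {v : Fin 7} (hvD : {v} ∉ D) (hVD : V.erase v ∉ D) :
    DeepDownSet (V.erase v) D d where
  down := h.down
  subset s hs _ hy := Finset.mem_erase.2
    ⟨fun e => hvD (h.down s hs _ (singleton_subset_iff.2 (e ▸ hy))),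
    h.subset s hs hy⟩
  empty_mem := h.empty_mem
  not_mem := hVD
  depth := h.depth

/-- The interval from `A` to `B` may be removed if its largest element is the only one to have
more than `d` elements and the union of the rest with `D` is a down set. -/
theorem coDepthGt_of_core (h : DeepDownSet V D d) {A B : Finset (Fin 7)} (hAB : A ⊆ B)
    (hne : A ≠ B) (hB : B ⊆ V) (hdB : #B = d + 1) (hA : A ∉ D)
    (hcore : ∀ z ∈ B, B.erase z ∈ D ↔ z ∈ A)
    (ih : ∀ D', D ⊂ D' → DeepDownSet V D' d → CoDepthGt V D' d) : CoDepthGt V D d := by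
  have hBD : B ∉ D := fun hBD => hA (h.down B hBD A hAB)
  set D' := D ∪ (Icc A B).erase B with hD'
  have mem_D' : ∀ s, s ∈ D' ↔ s ∈ D ∨ (s ≠ B ∧ A ⊆ s ∧ s ⊆ B) := by
    intro s
    simp only [hD', mem_union, Finset.mem_erase, mem_Icc]
  have herase : ∀ z ∈ B, B.erase z ∈ D' := by
    intro z hz
    by_cases hzA : z ∈ A
    · exact (mem_D' _).2 (Or.inl ((hcore z hz).2 hzA))
    · exact (mem_D' _).2 (Or.inr ⟨fun e => notMem_erase z B (by rwa [e]),
        fun y hy => Finset.mem_erase.2 ⟨fun e => hzA (e ▸ hy), hAB hy⟩, erase_subset _ _⟩)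
  have down : IsDownSet D' := by
    intro s hs t hts
    rcases (mem_D' s).1 hs with hs | ⟨h1, h2, h3⟩
    · exact (mem_D' t).2 (Or.inl (h.down s hs t hts))
    · by_cases hAt : A ⊆ t
      · refine (mem_D' t).2 (Or.inr ⟨?_, hAt, hts.trans h3⟩)
        rintro rfl
        exact h1 (h3.antisymm hts)
      · obtain ⟨z, hzA, hzt⟩ := not_subset.1 hAt
        exact (mem_D' t).2 (Or.inl (h.down _ ((hcore z (hAB hzA)).2 hzA) t fun y hy =>
          Finset.mem_erase.2 ⟨fun e => hzt (e ▸ hy), h3 (hts hy)⟩))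
  have hBD' : B ∉ D' := by simp [mem_D', hBD]
  have hdeep : DeepDownSet V D' d := by
    refine ⟨down, ?_, (mem_D' _).2 (Or.inl h.empty_mem), ?_, ?_⟩
    · intro s hs
      rcases (mem_D' s).1 hs with hs | hs
      · exact h.subset s hs
      · exact hs.2.2.trans hB
    · intro hVD'
      exact hBD' (down V hVD' B hB)
    · obtain ⟨P, h1, h2, h3⟩ := h.depth
      let f : Fin 7 → Finset (Fin 7) × Finset (Fin 7) := fun z =>
        (A ∪ (B \ A).filter (· < z), B.erase z)
      refine ⟨P ∪ (B \ A).image f, ?_, h2.union ?_ ?_, ?_⟩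
      · intro p hp
        rcases mem_union.1 hp with hp | hp
        · exact ⟨(h1 p hp).1, mem_union_left _ (h1 p hp).2.1, (h1 p hp).2.2⟩
        · obtain ⟨z, hz, rfl⟩ := mem_image.1 hp
          rw [mem_sdiff] at hz
          refine ⟨?_, herase z hz.1, by simp only [f]; rw [card_erase_of_mem hz.1]; omega⟩
          intro y hy
          simp only [f, mem_union, mem_filter, mem_sdiff, Finset.mem_erase] at hy ⊢
          rcases hy with hy | hy
          · exact ⟨fun e => hz.2 (e ▸ hy), hAB hy⟩
          · exact ⟨hy.2.ne, hy.1.1⟩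
      · have aux : ∀ y ∈ B \ A, ∀ z, y < z → ∀ s, (f z).1 ⊆ s → s ⊆ (f y).2 → False := by
          intro y hy z hyz s h5 h6
          have h7 : y ∈ s := h5 (mem_union_right _ (mem_filter.2 ⟨hy, hyz⟩))
          exact notMem_erase y B (h6 h7)
        intro p hp q hq hpq s h5 h6 h7 h8
        obtain ⟨y, hy, rfl⟩ := mem_image.1 hp
        obtain ⟨z, hz, rfl⟩ := mem_image.1 hq
        rcases lt_trichotomy y z with hyz | rfl | hyz
        · exact aux y hy z hyz s h7 h6
        · exact hpq rfl
        · exact aux z hz y hyz s h5 h8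
      · intro p hp q hq s _ h6 h7 _
        obtain ⟨z, hz, rfl⟩ := mem_image.1 hq
        exact hA (h.down _ (h1 p hp).2.1 A (subset_union_left.trans (h7.trans h6)))
      · intro s hs
        rcases (mem_D' s).1 hs with hs | ⟨h5, h6, h7⟩
        · obtain ⟨p, hp, hp'⟩ := h3 s hs
          exact ⟨p, mem_union_left _ hp, hp'⟩
        · have hne : (B \ s).Nonempty := by
            rw [sdiff_nonempty]
            exact fun e => h5 (h7.antisymm e)
          have hz := min'_mem _ hne
          rw [mem_sdiff] at hz
          refine ⟨f ((B \ s).min' hne), mem_union_right _ (mem_image_of_mem _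
            (mem_sdiff.2 ⟨hz.1, fun e => hz.2 (h6 e)⟩)), union_subset h6 ?_, ?_⟩
          · intro y hy
            rw [mem_filter, mem_sdiff] at hy
            by_contra hys
            exact absurd (min'_le _ _ (mem_sdiff.2 ⟨hy.1.1, hys⟩)) (not_le.2 hy.2)
          · exact fun y hy => Finset.mem_erase.2 ⟨fun e => hz.2 (e ▸ hy), h7 hy⟩
  obtain ⟨P, h1, h2, h3⟩ := ih D' (by
    refine Finset.ssubset_iff_subset_ne.2 ⟨subset_union_left, fun e => hA ?_⟩
    rw [e]
    exact (mem_D' A).2 (Or.inr ⟨hne, subset_rfl, hAB⟩)) hdeep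
  refine ⟨P.filter (fun p => #p.1 ≤ d) ∪ {(A, B)}, ?_,
    (h2.mono (filter_subset _ _)).union (pairwiseDisjointIntervals_singleton _) ?_, ?_⟩
  · intro p hp
    rcases mem_union.1 hp with hp | hp
    · obtain ⟨h5, h6, h7, h8⟩ := h1 p (mem_filter.1 hp).1
      exact ⟨h5, h6, fun e => h7 (mem_union_left _ e), h8⟩
    · rw [mem_singleton] at hp
      subst hp
      exact ⟨hAB, hB, hA, hdB.ge⟩
  · intro p hp q hq s h5 h6 h7 h8
    rw [mem_singleton] at hq
    subst hq
    rw [mem_filter] at hp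
    apply (h1 p hp.1).2.2.1
    have hpB : p.1 ≠ B := by
      intro e
      rw [e] at hp
      omega
    obtain ⟨z, hzB, hzp⟩ := exists_of_ssubset ((h5.trans h8).ssubset_of_ne hpB)
    exact down _ (herase z hzB) _ fun y hy => Finset.mem_erase.2 ⟨fun e => hzp (e ▸ hy), h8 (h5 hy)⟩
  · intro s hs hsD hd
    by_cases hsD' : s ∈ D'
    · rcases (mem_D' s).1 hsD' with h5 | ⟨h5, h6, h7⟩
      · exact absurd h5 hsD
      · exact ⟨_, mem_union_right _ (mem_singleton_self _), h6, h7⟩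
    · obtain ⟨p, hp, hp1, hp2⟩ := h3 s hs hsD' hd
      exact ⟨p, mem_union_left _ (mem_filter.2 ⟨hp, (card_le_card hp1).trans hd⟩), hp1, hp2⟩

end DeepDownSet

section Pointwise

open scoped Pointwise

theorem map_perm_eq_smul (σ : Equiv.Perm (Fin 7)) (s : Finset (Fin 7)) :
    s.map σ.toEmbedding = σ • s := by
  rw [map_eq_image]; rfl

theorem PairwiseDisjointIntervals.smul {P : Finset (Finset (Fin 7) × Finset (Fin 7))}
    (h : PairwiseDisjointIntervals P) (σ : Equiv.Perm (Fin 7)) :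
    PairwiseDisjointIntervals (σ • P) := by
  intro p hp q hq hpq s h1 h2 h3 h4
  obtain ⟨p, hp', rfl⟩ := mem_smul_finset.1 hp
  obtain ⟨q, hq', rfl⟩ := mem_smul_finset.1 hq
  exact h p hp' q hq' (fun e => hpq (e ▸ rfl)) (σ⁻¹ • s) (smul_finset_subset_iff.1 h1)
    (subset_smul_finset_iff.1 h2) (smul_finset_subset_iff.1 h3) (subset_smul_finset_iff.1 h4)

theorem DeepDownSet.smul {V : Finset (Fin 7)} {D : Finset (Finset (Fin 7))} {d : ℕ}
    (h : DeepDownSet V D d) (σ : Equiv.Perm (Fin 7)) : DeepDownSet (σ • V) (σ • D) d where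
  down s hs t hts := by
    rw [← inv_smul_mem_iff] at hs ⊢
    exact h.down _ hs _ (smul_finset_subset_smul_finset hts)
  subset s hs := by
    rw [← inv_smul_mem_iff] at hs
    simpa [subset_smul_finset_iff] using h.subset _ hs
  empty_mem := by
    rw [← inv_smul_mem_iff]
    simpa using h.empty_mem
  not_mem := by
    rw [smul_mem_smul_finset_iff]
    exact h.not_mem
  depth := by
    obtain ⟨P, h1, h2, h3⟩ := h.depth
    refine ⟨σ • P, ?_, h2.smul σ, ?_⟩
    · intro p hp
      obtain ⟨p, hp', rfl⟩ := mem_smul_finset.1 hp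
      obtain ⟨h4, h5, h6⟩ := h1 p hp'
      exact ⟨smul_finset_subset_smul_finset h4, smul_mem_smul_finset h5, by simpa using h6⟩
    · intro s hs
      obtain ⟨t, ht, rfl⟩ := mem_smul_finset.1 hs
      obtain ⟨p, hp, hp1, hp2⟩ := h3 t ht
      exact ⟨σ • p, smul_mem_smul_finset hp, smul_finset_subset_smul_finset hp1,
        smul_finset_subset_smul_finset hp2⟩

theorem CoDepthGt.of_smul {V : Finset (Fin 7)} {D : Finset (Finset (Fin 7))} {d : ℕ}
    {σ : Equiv.Perm (Fin 7)} (h : CoDepthGt (σ • V) (σ • D) d) : CoDepthGt V D d := by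
  obtain ⟨P, h1, h2, h3⟩ := h
  refine ⟨σ⁻¹ • P, ?_, h2.smul σ⁻¹, ?_⟩
  · intro p hp
    obtain ⟨p, hp', rfl⟩ := mem_smul_finset.1 hp
    obtain ⟨h4, h5, h6, h7⟩ := h1 p hp'
    refine ⟨smul_finset_subset_smul_finset h4, ?_, ?_, by simpa using h7⟩
    · simpa [subset_smul_finset_iff] using h5
    · rwa [Prod.smul_fst, inv_smul_mem_iff]
  · intro s hs hsD hd
    obtain ⟨p, hp, hp1, hp2⟩ := h3 (σ • s) (smul_finset_subset_smul_finset hs)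
      (by rwa [smul_mem_smul_finset_iff]) (by simpa using hd)
    exact ⟨σ⁻¹ • p, smul_mem_smul_finset hp, by simpa [subset_smul_finset_iff] using hp1,
      by simpa [subset_smul_finset_iff] using hp2⟩

end Pointwise

theorem coDepthGt_of_injOn {V : Finset (Fin 7)} {D : Finset (Finset (Fin 7))} {d : ℕ}
    (hsmall : ∀ s ⊆ V, #s < d → s ∈ D) {T : Finset (Fin 7) → Finset (Fin 7)}
    (hT : ∀ s ⊆ V, s ∉ D → #s = d → s ⊆ T s ∧ T s ⊆ V ∧ #(T s) = d + 1)
    (hinj : ∀ s ⊆ V, s ∉ D → #s = d → ∀ t ⊆ V, t ∉ D → #t = d → T s = T t → s = t) :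
    CoDepthGt V D d := by
  refine ⟨(V.powerset.filter fun s => s ∉ D ∧ #s = d).image fun s => (s, T s), ?_, ?_, ?_⟩
  · intro p hp
    obtain ⟨s, hs, rfl⟩ := mem_image.1 hp
    rw [mem_filter, mem_powerset] at hs
    obtain ⟨h1, h2, h3⟩ := hT s hs.1 hs.2.1 hs.2.2
    exact ⟨h1, h2, hs.2.1, h3.ge⟩
  · intro p hp q hq hpq s h1 h2 h3 h4
    obtain ⟨t, ht, rfl⟩ := mem_image.1 hp
    obtain ⟨u, hu, rfl⟩ := mem_image.1 hq
    rw [mem_filter, mem_powerset] at ht hu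
    dsimp only at h1 h2 h3 h4
    have htT := hT t ht.1 ht.2.1 ht.2.2
    have huT := hT u hu.1 hu.2.1 hu.2.2
    have htu : t ≠ u := by rintro rfl; exact hpq rfl
    have hd : d ≤ #s := ht.2.2 ▸ card_le_card h1
    have hd' : #s ≤ d + 1 := htT.2.2 ▸ card_le_card h2
    rcases hd.eq_or_lt with hd | hd
    · exact htu ((eq_of_subset_of_card_le h1 (by omega)).trans
        (eq_of_subset_of_card_le h3 (by omega)).symm)
    · refine htu (hinj t ht.1 ht.2.1 ht.2.2 u hu.1 hu.2.1 hu.2.2 ?_)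
      exact (eq_of_subset_of_card_le h2 (by omega)).symm.trans
        (eq_of_subset_of_card_le h4 (by omega))
  · intro s hs hsD hd
    have hd' : #s = d := hd.antisymm (not_lt.1 fun h => hsD (hsmall s hs h))
    exact ⟨_, mem_image_of_mem _ (mem_filter.2 ⟨mem_powerset.2 hs, hsD, hd'⟩), subset_rfl,
      (hT s hs hsD hd').1⟩

theorem coDepthGt_of_small {V : Finset (Fin 7)} {D : Finset (Finset (Fin 7))} {d : ℕ}
    (hV : 2 * d + 1 ≤ #V) (hsmall : ∀ s ⊆ V, #s < d → s ∈ D) : CoDepthGt V D d := by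
  have hall : ∀ A : Finset (powersetCard d V),
      #A ≤ #(A.biUnion fun s => (powersetCard (d + 1) V).filter (s.1 ⊆ ·)) := by
    intro A
    have h1 := card_mul_le_card_mul (s := A)
      (t := A.biUnion fun s => (powersetCard (d + 1) V).filter (s.1 ⊆ ·))
      (fun s t => s.1 ⊆ t) (m := d + 1) (n := d + 1) ?_ ?_
    · exact Nat.le_of_mul_le_mul_right h1 d.succ_pos
    · intro s hs
      have hsV := mem_powersetCard.1 s.2
      calc d + 1 ≤ #(V \ s.1) := by rw [card_sdiff_of_subset hsV.1]; omega
        _ = #((V \ s.1).image fun x => insert x s.1) := by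
          rw [card_image_of_injOn]
          intro x hx y hy hxy
          rw [mem_coe, mem_sdiff] at hx hy
          have h2 : x ∈ insert y s.1 :=
            (show insert x s.1 = insert y s.1 from hxy) ▸ mem_insert_self x s.1
          exact (mem_insert.1 h2).resolve_right hx.2
        _ ≤ _ := by
          apply card_le_card
          intro t ht
          obtain ⟨x, hx, rfl⟩ := mem_image.1 ht
          rw [mem_sdiff] at hx
          refine mem_filter.2 ⟨mem_biUnion.2 ⟨s, hs, mem_filter.2 ⟨mem_powersetCard.2
            ⟨insert_subset hx.1 hsV.1, ?_⟩, subset_insert _ _⟩⟩, subset_insert _ _⟩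
          rw [card_insert_of_notMem hx.2, hsV.2]
    · intro t ht
      obtain ⟨s, -, hs⟩ := mem_biUnion.1 ht
      have h2 := (mem_powersetCard.1 (mem_filter.1 hs).1).2
      calc #(bipartiteBelow (fun s t => s.1 ⊆ t) A t)
          = #((bipartiteBelow (fun s t => s.1 ⊆ t) A t).image Subtype.val) :=
            (card_image_of_injective _ Subtype.val_injective).symm
        _ ≤ #(powersetCard d t) := by
          apply card_le_card
          intro s hs
          obtain ⟨s, hs', rfl⟩ := mem_image.1 hs
          exact mem_powersetCard.2 ⟨(mem_filter.1 hs').2, (mem_powersetCard.1 s.2).2⟩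
        _ = d + 1 := by rw [card_powersetCard, h2, Nat.choose_succ_self_right]
  obtain ⟨f, hf, hf'⟩ := (all_card_le_biUnion_card_iff_exists_injective _).1 hall
  have hf'' : ∀ s : powersetCard d V, s.1 ⊆ f s ∧ f s ⊆ V ∧ #(f s) = d + 1 := by
    intro s
    have h1 := mem_filter.1 (hf' s)
    exact ⟨h1.2, mem_powersetCard.1 h1.1⟩
  refine coDepthGt_of_injOn hsmall
    (T := fun s => if hs : s ∈ powersetCard d V then f ⟨s, hs⟩ else s) ?_ ?_
  · intro s hs _ hd
    simpa [mem_powersetCard, hs, hd] using hf'' ⟨s, mem_powersetCard.2 ⟨hs, hd⟩⟩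
  · intro s hs _ hd t ht _ hd' h
    simp only [mem_powersetCard, hs, hd, ht, hd', and_self, dite_true] at h
    simpa using hf h

section Pointwise

open scoped Pointwise

/-- The intervals of `l` and of `r` are disjoint, except that an interval of `l` may contain the
smallest element of an interval of `r`. They start at all sets with at most three elements that
are not contained in an element of `faces`. -/
structure NestedTables (faces : List ℕ) (l r : List (ℕ × ℕ)) : Prop where
  left : ∀ p ∈ l, bitset p.1 ⊆ bitset p.2 ∧ 4 ≤ #(bitset p.2)
  right : ∀ p ∈ r, bitset p.1 ⊆ bitset p.2 ∧ 4 ≤ #(bitset p.2)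
  left_left : ∀ p ∈ l, ∀ q ∈ l, p ≠ q → ¬ bitset p.1 ∪ bitset q.1 ⊆ bitset p.2 ∩ bitset q.2
  right_right : ∀ p ∈ r, ∀ q ∈ r, p ≠ q → ¬ bitset p.1 ∪ bitset q.1 ⊆ bitset p.2 ∩ bitset q.2
  left_right : ∀ p ∈ l, ∀ q ∈ r, bitset p.1 ∪ bitset q.1 ⊆ bitset p.2 ∩ bitset q.2 →
    bitset p.1 ⊆ bitset q.1 ∧ bitset q.1 ⊆ bitset p.2
  covers : ∀ s, #s ≤ 3 → (∃ k ∈ faces, s ⊆ bitset k) ∨ (∃ p ∈ l, bitset p.1 = s) ∨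
    ∃ q ∈ r, bitset q.1 = s

theorem NestedTables.coDepthGt {faces : List ℕ} {l r : List (ℕ × ℕ)}
    (h : NestedTables faces l r) {D : Finset (Finset (Fin 7))} (hD : IsDownSet D)
    (hfaces : ∀ k ∈ faces, bitset k ∈ D) : CoDepthGt univ D 3 := by
  let g : ℕ × ℕ → Finset (Fin 7) × Finset (Fin 7) := fun p => (bitset p.1, bitset p.2)
  let L := (l.toFinset.filter fun p => bitset p.1 ∉ D).image g
  let R := (r.toFinset.filter fun q => bitset q.1 ∉ D ∧
    ∀ p ∈ l, bitset p.1 ∉ D → ¬ (bitset p.1 ⊆ bitset q.1 ∧ bitset q.1 ⊆ bitset p.2)).image g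
  have mem_L : ∀ p, p ∈ L → ∃ a ∈ l, bitset a.1 ∉ D ∧ g a = p := by
    intro p hp
    obtain ⟨a, ha, rfl⟩ := mem_image.1 hp
    rw [mem_filter, List.mem_toFinset] at ha
    exact ⟨a, ha.1, ha.2, rfl⟩
  have mem_R : ∀ p, p ∈ R → ∃ a ∈ r, bitset a.1 ∉ D ∧ (∀ p ∈ l, bitset p.1 ∉ D →
      ¬ (bitset p.1 ⊆ bitset a.1 ∧ bitset a.1 ⊆ bitset p.2)) ∧ g a = p := by
    intro p hp
    obtain ⟨a, ha, rfl⟩ := mem_image.1 hp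
    rw [mem_filter, List.mem_toFinset] at ha
    exact ⟨a, ha.1, ha.2.1, ha.2.2, rfl⟩
  have disj : ∀ t : List (ℕ × ℕ), (∀ p ∈ t, ∀ q ∈ t, p ≠ q →
      ¬ bitset p.1 ∪ bitset q.1 ⊆ bitset p.2 ∩ bitset q.2) → ∀ a ∈ t, ∀ b ∈ t, g a ≠ g b →
      ∀ s, (g a).1 ⊆ s → s ⊆ (g a).2 → (g b).1 ⊆ s → s ⊆ (g b).2 → False := by
    intro t ht a ha b hb hab s h1 h2 h3 h4
    exact ht a ha b hb (fun e => hab (e ▸ rfl))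
      ((union_subset h1 h3).trans (subset_inter h2 h4))
  refine ⟨L ∪ R, ?_, PairwiseDisjointIntervals.union ?_ ?_ ?_, ?_⟩
  · intro p hp
    rcases mem_union.1 hp with hp | hp
    · obtain ⟨a, ha, haD, rfl⟩ := mem_L p hp
      exact ⟨(h.left a ha).1, subset_univ _, haD, (h.left a ha).2⟩
    · obtain ⟨a, ha, haD, -, rfl⟩ := mem_R p hp
      exact ⟨(h.right a ha).1, subset_univ _, haD, (h.right a ha).2⟩
  · intro p hp q hq
    obtain ⟨a, ha, -, rfl⟩ := mem_L p hp
    obtain ⟨b, hb, -, rfl⟩ := mem_L q hq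
    exact disj l h.left_left a ha b hb
  · intro p hp q hq
    obtain ⟨a, ha, -, -, rfl⟩ := mem_R p hp
    obtain ⟨b, hb, -, -, rfl⟩ := mem_R q hq
    exact disj r h.right_right a ha b hb
  · intro p hp q hq s h1 h2 h3 h4
    obtain ⟨a, ha, haD, rfl⟩ := mem_L p hp
    obtain ⟨b, hb, -, hb', rfl⟩ := mem_R q hq
    exact hb' a ha haD (h.left_right a ha b hb
      ((union_subset h1 h3).trans (subset_inter h2 h4)))
  · intro s _ hsD hs
    rcases h.covers s hs with ⟨k, hk, hsk⟩ | ⟨p, hp, rfl⟩ | ⟨q, hq, rfl⟩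
    · exact absurd (hD _ (hfaces k hk) s hsk) hsD
    · exact ⟨g p, mem_union_left _ (mem_image_of_mem _ (by simp [hp, hsD])), subset_rfl,
        (h.left p hp).1⟩
    · by_cases hex : ∀ p ∈ l, bitset p.1 ∉ D →
          ¬ (bitset p.1 ⊆ bitset q.1 ∧ bitset q.1 ⊆ bitset p.2)
      · exact ⟨g q, mem_union_right _ (mem_image_of_mem _
          (mem_filter.2 ⟨List.mem_toFinset.2 hq, hsD, hex⟩)), subset_rfl, (h.right q hq).1⟩
      · push Not at hex
        obtain ⟨p, hp, hpD, hpq⟩ := hex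
        exact ⟨g p, mem_union_left _ (mem_image_of_mem _ (by simp [hp, hpD])), hpq⟩

/-- Intervals above pairs, for the triangle `{0, 1, 2}` and the edge `{0, 3}`. -/
def starPairs : List (ℕ × ℕ) :=
  [(10, 27), (12, 15), (17, 113), (18, 51), (20, 23), (24, 29), (33, 105), (34, 99), (36, 39),
  (40, 46), (48, 60), (65, 77), (66, 83), (68, 102), (72, 78), (80, 92), (96, 120)]

/-- Intervals above triples, for the triangle `{0, 1, 2}` and the edge `{0, 3}`. -/
def starTriples : List (ℕ × ℕ) :=
  [(11, 27), (13, 45), (14, 15), (19, 51), (21, 85), (22, 23), (25, 29), (26, 90), (28, 30),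
  (35, 99), (37, 53), (38, 39), (41, 105), (42, 43), (44, 46), (49, 113), (50, 58), (52, 54),
  (56, 60), (67, 83), (69, 77), (70, 71), (73, 75), (74, 106), (76, 78), (81, 89), (82, 86),
  (84, 116), (88, 92), (97, 101), (98, 114), (100, 102), (104, 108), (112, 120)]

/-- Intervals above pairs, for the triangle `{0, 1, 2}` and the edge `{3, 4}`. -/
def disjointPairs : List (ℕ × ℕ) :=
  [(9, 105), (10, 27), (12, 15), (17, 29), (18, 51), (20, 30), (33, 113), (34, 99), (36, 39),
  (40, 46), (48, 60), (65, 85), (66, 83), (68, 102), (72, 78), (80, 92), (96, 120)]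

/-- Intervals above triples, for the triangle `{0, 1, 2}` and the edge `{3, 4}`. -/
def disjointTriples : List (ℕ × ℕ) :=
  [(11, 27), (13, 77), (14, 15), (19, 51), (21, 53), (22, 23), (25, 29), (26, 90), (28, 30),
  (35, 99), (37, 45), (38, 39), (41, 105), (42, 43), (44, 46), (49, 113), (50, 58), (52, 54),
  (56, 60), (67, 83), (69, 85), (70, 71), (73, 75), (74, 106), (76, 78), (81, 89), (82, 86),
  (84, 116), (88, 92), (97, 101), (98, 114), (100, 102), (104, 108), (112, 120)]

theorem bitset_union (a b : ℕ) : bitset a ∪ bitset b = bitset (a ||| b) := by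
  ext i; simp [mem_bitset]

theorem bitset_inter (a b : ℕ) : bitset a ∩ bitset b = bitset (a &&& b) := by
  ext i; simp [mem_bitset]

theorem nestedTables_of_masks {faces : List ℕ} {l r : List (ℕ × ℕ)}
    (hl : ∀ p ∈ l, p.1 < 128 ∧ p.1 &&& p.2 = p.1 ∧ 4 ≤ weight p.2)
    (hr : ∀ p ∈ r, p.1 < 128 ∧ p.1 &&& p.2 = p.1 ∧ 4 ≤ weight p.2)
    (hll : ∀ p ∈ l, ∀ q ∈ l, p ≠ q → (p.1 ||| q.1) &&& (p.2 &&& q.2) ≠ p.1 ||| q.1)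
    (hrr : ∀ p ∈ r, ∀ q ∈ r, p ≠ q → (p.1 ||| q.1) &&& (p.2 &&& q.2) ≠ p.1 ||| q.1)
    (hlr : ∀ p ∈ l, ∀ q ∈ r, (p.1 ||| q.1) &&& (p.2 &&& q.2) = p.1 ||| q.1 →
      p.1 &&& q.1 = p.1 ∧ q.1 &&& p.2 = q.1)
    (hc : ∀ m < 128, weight m ≤ 3 → (∃ k ∈ faces, m &&& k = m) ∨ (∃ p ∈ l, p.1 = m) ∨
      ∃ q ∈ r, q.1 = m) : NestedTables faces l r := by
  have key : ∀ a < 128, ∀ b < 128, ∀ x y, bitset a ∪ bitset b ⊆ bitset x ∩ bitset y ↔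
      (a ||| b) &&& (x &&& y) = a ||| b := by
    intro a ha b hb x y
    rw [bitset_union, bitset_inter, bitset_subset (Nat.or_lt_two_pow (n := 7) ha hb)]
  refine ⟨fun p hp => ?_, fun p hp => ?_, fun p hp q hq h => ?_, fun p hp q hq h => ?_,
    fun p hp q hq => ?_, fun s hs => ?_⟩
  · rw [bitset_subset (hl p hp).1, card_bitset]
    exact (hl p hp).2
  · rw [bitset_subset (hr p hp).1, card_bitset]
    exact (hr p hp).2
  · rw [key _ (hl p hp).1 _ (hl q hq).1]
    exact hll p hp q hq h
  · rw [key _ (hr p hp).1 _ (hr q hq).1]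
    exact hrr p hp q hq h
  · rw [key _ (hl p hp).1 _ (hr q hq).1, bitset_subset (hl p hp).1, bitset_subset (hr q hq).1]
    exact hlr p hp q hq
  · rw [← bitset_mask s, card_bitset] at hs
    rcases hc _ (mask_lt s) hs with ⟨k, hk, h⟩ | ⟨p, hp, h⟩ | ⟨p, hp, h⟩
    · refine Or.inl ⟨k, hk, ?_⟩
      rw [← bitset_mask s, bitset_subset (mask_lt s)]
      exact h
    · exact Or.inr (Or.inl ⟨p, hp, h ▸ bitset_mask s⟩)
    · exact Or.inr (Or.inr ⟨p, hp, h ▸ bitset_mask s⟩)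

theorem nestedTables_star : NestedTables [7, 9, 16, 32, 64] starPairs starTriples :=
  nestedTables_of_masks (by decide +kernel) (by decide +kernel) (by decide +kernel)
    (by decide +kernel) (by decide +kernel) (by decide +kernel)

theorem nestedTables_disjoint : NestedTables [7, 24, 32, 64] disjointPairs disjointTriples :=
  nestedTables_of_masks (by decide +kernel) (by decide +kernel) (by decide +kernel)
    (by decide +kernel) (by decide +kernel) (by decide +kernel)

theorem exists_perm_extending {q : List (Fin 7)} (h : q.Nodup) :
    ∃ ρ : Equiv.Perm (Fin 7), ∀ (i : ℕ) (hi : i < q.length) (h7 : i < 7), ρ ⟨i, h7⟩ = q[i] := by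
  have hd : (q ++ (univ \ q.toFinset).toList).Nodup := by
    refine List.Nodup.append h (nodup_toList _) ?_
    intro x hx hx'
    simp at hx'
    exact hx' hx
  obtain ⟨ρ, hρ⟩ := exists_perm_of_nodup hd (by
    rw [List.length_append, length_toList, ← List.toFinset_card_of_nodup h,
      card_sdiff_of_subset (subset_univ _), card_univ, Fintype.card_fin]
    have := card_le_univ q.toFinset
    rw [Fintype.card_fin] at this
    omega)
  refine ⟨ρ, fun i hi h7 => ?_⟩
  rw [hρ, List.getD_append _ _ _ _ hi, List.getD_eq_getElem]

/-- Codimension three on seven vertices. -/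
theorem DeepDownSet.coDepthGt_three {D : Finset (Finset (Fin 7))} (h : DeepDownSet univ D 3)
    (hv : ∀ v, {v} ∈ D) : CoDepthGt univ D 3 := by
  have key : ∀ faces l r, NestedTables faces l r → ∀ ρ : Equiv.Perm (Fin 7),
      (∀ k ∈ faces, ρ • bitset k ∈ D) → CoDepthGt univ D 3 := by
    intro faces l r ht ρ hρ
    apply CoDepthGt.of_smul (σ := ρ⁻¹)
    have h1 := ht.coDepthGt (h.smul ρ⁻¹).down fun k hk => by
      rw [← inv_smul_mem_iff, inv_inv]
      exact hρ k hk
    simpa using h1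
  have hb7 : bitset 7 = {0, 1, 2} := by decide
  have hb9 : bitset 9 = {0, 3} := by decide
  have hb16 : bitset 16 = {4} := by decide
  have hb24 : bitset 24 = {3, 4} := by decide
  have hb32 : bitset 32 = {5} := by decide
  have hb64 : bitset 64 = {6} := by decide
  obtain ⟨F, hF, -, hF3⟩ := h.exists_superset h.empty_mem (by simp)
  obtain ⟨v, hvF⟩ : ∃ v, v ∉ F := by
    by_contra! hall
    rw [eq_univ_of_forall hall] at hF
    exact h.not_mem hF
  obtain ⟨t, ht, hvt, ht3⟩ := h.exists_superset (hv v) (by simp)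
  rw [singleton_subset_iff] at hvt
  obtain ⟨p, hpt, hpv⟩ := exists_mem_ne (s := t) (by omega) v
  have hvp : {p, v} ∈ D := h.down t ht _ (by simp [insert_subset_iff, hvt, hpt])
  by_cases hpF : p ∈ F
  · obtain ⟨a, b, hab, hFp⟩ := card_eq_two.1 (show #(F.erase p) = 2 by
      rw [card_erase_of_mem hpF, hF3])
    obtain rfl : F = {p, a, b} := by rw [← hFp, insert_erase hpF]
    have hpab : p ∉ ({a, b} : Finset (Fin 7)) := hFp ▸ notMem_erase p _
    simp only [mem_insert, mem_singleton, not_or] at hvF hpab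
    obtain ⟨ρ, hρ⟩ := exists_perm_extending (q := [p, a, b, v]) (by
      simp only [List.nodup_cons, List.mem_cons, List.not_mem_nil, or_false, not_or]
      tauto)
    have h0 : ρ 0 = p := hρ 0 (by simp) (by simp)
    have h1 : ρ 1 = a := hρ 1 (by simp) (by simp)
    have h2 : ρ 2 = b := hρ 2 (by simp) (by simp)
    have h3 : ρ 3 = v := hρ 3 (by simp) (by simp)
    apply key _ _ _ nestedTables_star ρ
    simp [hb7, hb9, hb16, hb32, hb64, smul_finset_insert, h0, h1, h2, h3, hF, hvp, hv]
  · obtain ⟨a, b, c, hab, hac, hbc, rfl⟩ := card_eq_three.1 hF3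
    simp only [mem_insert, mem_singleton, not_or] at hvF hpF
    obtain ⟨ρ, hρ⟩ := exists_perm_extending (q := [a, b, c, p, v]) (by
      simp only [List.nodup_cons, List.mem_cons, List.not_mem_nil, or_false, not_or]
      tauto)
    have h0 : ρ 0 = a := hρ 0 (by simp) (by simp)
    have h1 : ρ 1 = b := hρ 1 (by simp) (by simp)
    have h2 : ρ 2 = c := hρ 2 (by simp) (by simp)
    have h3 : ρ 3 = p := hρ 3 (by simp) (by simp)
    have h4 : ρ 4 = v := hρ 4 (by simp) (by simp)
    apply key _ _ _ nestedTables_disjoint ρ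
    simp [hb7, hb24, hb32, hb64, smul_finset_insert, h0, h1, h2, h3, h4, hF, hvp, hv]

end Pointwise

/-- The alternating sign of a set of size `j`, counted from size `d` downwards. -/
def downSign (d j : ℕ) : ℤ := if j ≤ d then (-1) ^ (d + j) else 0

/-- The alternating sum weighted by the distance to `d`. -/
def downWeight (d j : ℕ) : ℤ := if j ≤ d then (-1) ^ (d + 1 + j) * (d - j) else 0

/-- The alternating sign of a set with more than `c` elements. -/
def upSign (c j : ℕ) : ℤ := if c + 1 ≤ j then (-1) ^ (j + c + 1) else 0

/-- The alternating sum weighted by the distance to `c + 1`. -/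
def upWeight (c j : ℕ) : ℤ := if c + 1 ≤ j then (-1) ^ (j + c) * (j - c - 1) else 0

theorem neg_one_pow_eq_of_mod_eq {a b : ℕ} (h : a % 2 = b % 2) : (-1 : ℤ) ^ a = (-1) ^ b := by
  rw [neg_one_pow_eq_pow_mod_two, h, ← neg_one_pow_eq_pow_mod_two]

theorem sum_powerset_insert_card {U : Finset (Fin 7)} {x : Fin 7} (hx : x ∉ U) (f : ℕ → ℤ) :
    ∑ u ∈ (insert x U).powerset, f #u = ∑ u ∈ U.powerset, (f #u + f (#u + 1)) := by
  rw [sum_powerset_insert hx, sum_add_distrib]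
  congr 1
  refine sum_congr rfl fun u hu => ?_
  rw [card_insert_of_notMem fun h => hx (mem_powerset.1 hu h)]

theorem sum_Icc_card {A B : Finset (Fin 7)} (h : A ⊆ B) (f : ℕ → ℤ) :
    ∑ s ∈ Icc A B, f #s = ∑ u ∈ (B \ A).powerset, f (#A + #u) := by
  rw [Icc_eq_image_powerset h, sum_image]
  · refine sum_congr rfl fun u hu => ?_
    rw [card_union_of_disjoint]
    exact disjoint_of_subset_right (mem_powerset.1 hu) disjoint_sdiff
  · intro u hu v hv huv
    rw [mem_coe, mem_powerset] at hu hv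
    have key : ∀ w ⊆ B \ A, (A ∪ w) \ A = w := fun w hw => by
      rw [union_sdiff_left, sdiff_eq_self_of_disjoint]
      exact disjoint_of_subset_left hw sdiff_disjoint
    rw [← key u hu, ← key v hv]
    exact congrArg (· \ A) huv

theorem sum_Icc_card_eq_of_mem {A B : Finset (Fin 7)} (h : A ⊆ B) {x : Fin 7} (hx : x ∈ B \ A)
    (f : ℕ → ℤ) : ∑ s ∈ Icc A B, f #s = ∑ s ∈ Icc A (B.erase x), (f #s + f (#s + 1)) := by
  rw [mem_sdiff] at hx
  have hA : A ⊆ B.erase x := fun y hy => mem_erase.2 ⟨fun e => hx.2 (e ▸ hy), h hy⟩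
  have e : B \ A = insert x (B.erase x \ A) := by
    rw [← insert_sdiff_of_notMem _ hx.2, insert_erase hx.1]
  rw [sum_Icc_card h, sum_Icc_card hA fun j => f j + f (j + 1), e,
    sum_powerset_insert_card (by simp) fun j => f (#A + j)]
  rfl

theorem downSign_add (d j : ℕ) : downSign d j + downSign d (j + 1) = if j = d then 1 else 0 := by
  unfold downSign
  rcases lt_trichotomy j d with h | rfl | h
  · rw [if_pos h.le, if_pos (by omega), if_neg h.ne, ← add_assoc, pow_succ]
    ring
  · simp [← two_mul]
  · rw [if_neg (by omega), if_neg (by omega), if_neg (by omega), add_zero]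

theorem downWeight_add (d j : ℕ) :
    downWeight (d + 1) j + downWeight (d + 1) (j + 1) = downSign d j := by
  unfold downSign downWeight
  by_cases h : j ≤ d
  · rw [if_pos (by omega), if_pos (by omega), if_pos h,
      neg_one_pow_eq_of_mod_eq (show (d + 1 + 1 + j) % 2 = (d + j) % 2 by omega),
      neg_one_pow_eq_of_mod_eq (show (d + 1 + 1 + (j + 1)) % 2 = (d + j + 1) % 2 by omega),
      pow_succ]
    push_cast
    ring
  · rw [if_neg h, if_neg (show ¬ j + 1 ≤ d + 1 by omega), add_zero]
    split_ifs with h1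
    · obtain rfl : j = d + 1 := by omega
      simp
    · rfl

theorem upSign_add (c j : ℕ) : upSign c j + upSign c (j + 1) = if j = c then 1 else 0 := by
  unfold upSign
  rcases lt_trichotomy j c with h | rfl | h
  · rw [if_neg (by omega), if_neg (by omega), if_neg (by omega), add_zero]
  · rw [if_neg (by omega), if_pos le_rfl, if_pos rfl,
      neg_one_pow_eq_of_mod_eq (show (j + 1 + j + 1) % 2 = 0 % 2 by omega)]
    rfl
  · rw [if_pos (by omega), if_pos (by omega), if_neg h.ne', add_right_comm j 1 c,
      pow_succ _ (j + c + 1)]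
    ring

theorem upWeight_add (c j : ℕ) : upWeight c j + upWeight c (j + 1) = upSign c j := by
  unfold upSign upWeight
  by_cases h : c + 1 ≤ j
  · rw [if_pos h, if_pos (by omega), if_pos h, pow_succ, add_right_comm j 1 c, pow_succ]
    push_cast
    ring
  · rw [if_neg h, if_neg h, zero_add]
    split_ifs with h1
    · obtain rfl : j = c := by omega
      simp
    · rfl

theorem sum_downSign_nonneg {d : ℕ} {A B : Finset (Fin 7)} (h : A ⊆ B) (hd : d ≤ #B) :
    0 ≤ ∑ s ∈ Icc A B, downSign d #s := by
  rcases (B \ A).eq_empty_or_nonempty with e | ⟨x, hx⟩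
  · obtain rfl : A = B := h.antisymm (sdiff_eq_empty_iff_subset.1 e)
    rw [Icc_self, sum_singleton, downSign]
    split_ifs with h1
    · rw [le_antisymm h1 hd, Even.neg_one_pow ⟨_, rfl⟩]
      exact zero_le_one
    · exact le_rfl
  · rw [sum_Icc_card_eq_of_mem h hx]
    refine sum_nonneg fun s _ => ?_
    rw [downSign_add]
    split_ifs <;> simp

theorem sum_downWeight_nonneg {d : ℕ} {A B : Finset (Fin 7)} (h : A ⊆ B) (hd : d ≤ #B) :
    0 ≤ ∑ s ∈ Icc A B, downWeight d #s := by
  obtain _ | d := d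
  · refine sum_nonneg fun s _ => ?_
    unfold downWeight
    split_ifs with h1
    · rw [Nat.le_zero.1 h1]
      simp
    · exact le_rfl
  rcases (B \ A).eq_empty_or_nonempty with e | ⟨x, hx⟩
  · obtain rfl : A = B := h.antisymm (sdiff_eq_empty_iff_subset.1 e)
    rw [Icc_self, sum_singleton, downWeight]
    split_ifs with h1
    · rw [le_antisymm h1 hd]
      simp
    · exact le_rfl
  · rw [sum_Icc_card_eq_of_mem h hx, sum_congr rfl fun s _ => downWeight_add d #s]
    rw [mem_sdiff] at hx
    exact sum_downSign_nonneg (fun y hy => mem_erase.2 ⟨fun e => hx.2 (e ▸ hy), h hy⟩)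
      (by rw [card_erase_of_mem hx.1]; omega)

theorem sum_upSign {c : ℕ} {W : Finset (Fin 7)} (hW : W.Nonempty) :
    ∑ s ∈ W.powerset, upSign c #s = (#W - 1).choose c := by
  obtain ⟨x, hx⟩ := hW
  rw [← insert_erase hx, sum_powerset_insert_card (notMem_erase x W),
    sum_congr rfl fun s _ => upSign_add c #s, ← sum_filter, sum_const, nsmul_one,
    ← powersetCard_eq_filter, card_powersetCard, insert_erase hx, card_erase_of_mem hx]

theorem sum_upWeight {c : ℕ} {W : Finset (Fin 7)} (hW : 2 ≤ #W) :
    ∑ s ∈ W.powerset, upWeight c #s = (#W - 2).choose c := by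
  obtain ⟨x, hx⟩ : W.Nonempty := card_pos.1 (by omega)
  have hc := card_erase_of_mem hx
  rw [← insert_erase hx, sum_powerset_insert_card (notMem_erase x W),
    sum_congr rfl fun s _ => upWeight_add c #s, sum_upSign (card_pos.1 (by omega)),
    insert_erase hx, hc, Nat.sub_sub]

/-- A sum over the elements of a partitioned family that contain `C` is nonnegative if it is so
over all intervals. -/
theorem DepthGe.sum_nonneg {D : Finset (Finset (Fin 7))} {d : ℕ} (h : DepthGe D d)
    (hdown : IsDownSet D) {f : ℕ → ℤ}
    (hf : ∀ A B : Finset (Fin 7), A ⊆ B → d ≤ #B → 0 ≤ ∑ s ∈ Icc A B, f #s)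
    (C : Finset (Fin 7)) : 0 ≤ ∑ s ∈ D with C ⊆ s, f #s := by
  obtain ⟨P, h1, h2, h3⟩ := h
  have e : D.filter (C ⊆ ·) =
      (P.filter fun p => C ⊆ p.2).biUnion fun p => Icc (p.1 ∪ C) p.2 := by
    ext s
    simp only [mem_filter, mem_biUnion, mem_Icc, union_subset_iff]
    constructor
    · rintro ⟨hs, hCs⟩
      obtain ⟨p, hp, hp1, hp2⟩ := h3 s hs
      exact ⟨p, ⟨hp, hCs.trans hp2⟩, ⟨hp1, hCs⟩, hp2⟩
    · rintro ⟨p, ⟨hp, -⟩, ⟨-, hCs⟩, hp2⟩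
      exact ⟨hdown _ (h1 p hp).2.1 _ hp2, hCs⟩
  rw [e, sum_biUnion]
  · refine Finset.sum_nonneg fun p hp => ?_
    rw [mem_filter] at hp
    obtain ⟨h4, -, h5⟩ := h1 p hp.1
    exact hf _ _ (union_subset h4 hp.2) h5
  · intro p hp q hq hpq
    rw [mem_coe, mem_filter] at hp hq
    rw [Function.onFun, disjoint_left]
    intro s hs hs'
    rw [mem_Icc] at hs hs'
    exact h2 p hp.1 q hq.1 hpq s (subset_union_left.trans hs.1) hs.2
      (subset_union_left.trans hs'.1) hs'.2

section Pointwise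

open scoped Pointwise

/-- Whether `t` is the complement in `V` of a set outside `D`, for sets with `c + 1` elements. -/
def coMissing (V : Finset (Fin 7)) (D : Finset (Finset (Fin 7))) (c : ℕ) (t : Finset (Fin 7)) :
    Bool :=
  decide (#t = c + 1 ∧ t ⊆ V ∧ V \ t ∉ D)

theorem coMissing_eq_true {V : Finset (Fin 7)} {D : Finset (Finset (Fin 7))} {c : ℕ}
    {t : Finset (Fin 7)} : coMissing V D c t = true ↔ #t = c + 1 ∧ t ⊆ V ∧ V \ t ∉ D := by
  simp [coMissing]

theorem downSign_eq_upSign {d c j : ℕ} (hj : j ≤ d + 1 + c) :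
    upSign c (d + 1 + c - j) = downSign d j := by
  unfold upSign downSign
  by_cases h : j ≤ d
  · rw [if_pos (by omega), if_pos h]
    exact neg_one_pow_eq_of_mod_eq (by omega)
  · rw [if_neg (by omega), if_neg h]

theorem downWeight_eq_upWeight {d c j : ℕ} (hj : j ≤ d + 1 + c) :
    upWeight c (d + 1 + c - j) = downWeight d j := by
  unfold upWeight downWeight
  by_cases h : j ≤ d
  · rw [if_pos (by omega), if_pos h,
      neg_one_pow_eq_of_mod_eq (show (d + 1 + c - j + c) % 2 = (d + 1 + j) % 2 by omega),
      Nat.cast_sub hj]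
    push_cast
    ring
  · rw [if_neg (by omega), if_neg h]

namespace DeepDownSet

variable {V : Finset (Fin 7)} {D : Finset (Finset (Fin 7))} {d c : ℕ}

theorem face_iff (h : DeepDownSet V D d) (hV : #V = d + 1 + c) {s : Finset (Fin 7)}
    (hs : c + 1 ≤ #s) : Face c (coMissing V D c) s ↔ s ⊆ V ∧ V \ s ∉ D := by
  constructor
  · intro hF
    have hsV : s ⊆ V := by
      intro x hx
      obtain ⟨t, hxt, hts, ht⟩ := exists_subsuperset_card_eq (singleton_subset_iff.2 hx)
        (by simp) hs
      exact (coMissing_eq_true.1 (hF t hts ht)).2.1 (singleton_subset_iff.1 hxt)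
    refine ⟨hsV, fun hD => ?_⟩
    have hc := card_sdiff_of_subset hsV
    obtain ⟨u, hu, hsu, hud⟩ := h.exists_superset hD (by omega)
    have huV := h.subset u hu
    have hts : V \ u ⊆ s := by
      exact sdiff_le_comm.1 hsu
    have h1 := coMissing_eq_true.1 (hF _ hts (by rw [card_sdiff_of_subset huV]; omega))
    exact h1.2.2 (by rwa [Finset.sdiff_sdiff_eq_self huV])
  · rintro ⟨hsV, hsD⟩ t hts ht
    exact coMissing_eq_true.2 ⟨ht, hts.trans hsV, fun hD =>
      hsD (h.down _ hD _ (sdiff_subset_sdiff subset_rfl hts))⟩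

theorem sum_complements_le (h : DeepDownSet V D d) (hV : #V = d + 1 + c) {W : Finset (Fin 7)}
    (hW : W ⊆ V) {u f : ℕ → ℤ} (huf : ∀ j ≤ d + 1 + c, u (d + 1 + c - j) = f j)
    (hf : ∀ A B : Finset (Fin 7), A ⊆ B → d ≤ #B → 0 ≤ ∑ s ∈ Icc A B, f #s) :
    ∑ s ∈ W.powerset with V \ s ∉ D, u #s ≤ ∑ s ∈ W.powerset, u #s := by
  rw [← sum_filter_add_sum_filter_not W.powerset (fun s => V \ s ∉ D) fun s => u #s,
    le_add_iff_nonneg_right]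
  refine (h.depth.sum_nonneg h.down hf (V \ W)).trans_eq ?_
  refine sum_bij' (fun s _ => V \ s) (fun s _ => V \ s) ?_ ?_ ?_ ?_ ?_
  · intro s hs
    rw [mem_filter] at hs
    rw [mem_filter, mem_powerset, not_not, Finset.sdiff_sdiff_eq_self (h.subset s hs.1)]
    exact ⟨sdiff_le_comm.1 hs.2, hs.1⟩
  · intro s hs
    rw [mem_filter, mem_powerset, not_not] at hs
    exact mem_filter.2 ⟨hs.2, sdiff_subset_sdiff subset_rfl hs.1⟩
  · intro s hs
    exact Finset.sdiff_sdiff_eq_self (h.subset s (mem_filter.1 hs).1)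
  · intro s hs
    exact Finset.sdiff_sdiff_eq_self ((mem_powerset.1 (mem_filter.1 hs).1).trans hW)
  · intro s hs
    have hs' := h.subset s (mem_filter.1 hs).1
    rw [card_sdiff_of_subset hs', hV, huf _ (hV ▸ card_le_card hs')]

theorem filter_face_inter (h : DeepDownSet V D d) (hV : #V = d + 1 + c) (W : Finset (Fin 7))
    (r : ℕ) : ({s | s ⊆ W ∧ Face c (coMissing V D c) s ∧ c + 1 ≤ #s ∧ #s % 2 = r} :
      Finset (Finset (Fin 7))) =
    ((W ∩ V).powerset.filter fun s => V \ s ∉ D).filter fun s => c + 1 ≤ #s ∧ #s % 2 = r := by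
  ext s
  simp only [mem_filter, mem_univ, true_and, mem_powerset, subset_inter_iff]
  constructor
  · rintro ⟨h1, h2, h3, h4⟩
    obtain ⟨h5, h6⟩ := (h.face_iff hV h3).1 h2
    exact ⟨⟨⟨h1, h5⟩, h6⟩, h3, h4⟩
  · rintro ⟨⟨⟨h1, h5⟩, h6⟩, h3, h4⟩
    exact ⟨h1, (h.face_iff hV h3).2 ⟨h5, h6⟩, h3, h4⟩

theorem good (h : DeepDownSet V D d) (hV : #V = d + 1 + c)
    (hcore : ∀ X Y : Finset (Fin 7), #X = c → X ⊆ Y → X ≠ Y → Face c (coMissing V D c) Y →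
      ¬ ∀ z ∉ X, coMissing V D c (insert z X) = true ↔ z ∈ Y) :
    Good c (coMissing V D c) := by
  refine ⟨fun W _ => ?_, fun W _ => ?_, hcore⟩
  · rw [h.filter_face_inter hV, h.filter_face_inter hV]
    rcases (W ∩ V).eq_empty_or_nonempty with e | hne
    · rw [e, powerset_empty, filter_eq_empty_iff.2]
      · simp
      · intro s hs hs'
        rw [mem_filter, mem_singleton] at hs
        rw [hs.1] at hs'
        simp at hs'
    have h1 := h.sum_complements_le hV (inter_subset_right (s₁ := W))
      (fun j => downSign_eq_upSign) fun A B => sum_downSign_nonneg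
    rw [sum_upSign hne] at h1
    have h2 : ∑ s ∈ (W ∩ V).powerset with V \ s ∉ D, upSign c #s =
        ∑ s ∈ (W ∩ V).powerset with V \ s ∉ D,
          ((if c + 1 ≤ #s ∧ #s % 2 = (c + 1) % 2 then 1 else 0) -
            if c + 1 ≤ #s ∧ #s % 2 = c % 2 then 1 else 0) := by
      refine sum_congr rfl fun s _ => ?_
      unfold upSign
      by_cases hs : c + 1 ≤ #s
      · by_cases hp : #s % 2 = c % 2
        · rw [if_pos hs, if_neg (by omega), if_pos ⟨hs, hp⟩,
            neg_one_pow_eq_of_mod_eq (show (#s + c + 1) % 2 = 1 % 2 by omega)]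
          norm_num
        · rw [if_pos hs, if_pos (by omega), if_neg (by omega),
            neg_one_pow_eq_of_mod_eq (show (#s + c + 1) % 2 = 0 % 2 by omega)]
          norm_num
      · simp [hs]
    rw [h2, sum_sub_distrib, ← sum_filter, ← sum_filter, sum_const, sum_const, nsmul_one,
      nsmul_one] at h1
    have h3 : (#(W ∩ V) - 1).choose c ≤ (#W - 1).choose c :=
      Nat.choose_le_choose c (Nat.sub_le_sub_right (card_le_card inter_subset_left) 1)
    omega
  · rw [h.filter_face_inter hV, h.filter_face_inter hV]
    by_cases hlt : #(W ∩ V) < 2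
    · rw [sum_eq_zero]
      · simp
      · intro s hs
        simp only [mem_filter, mem_powerset] at hs
        have := card_le_card hs.1.1
        omega
    have h1 := h.sum_complements_le hV (inter_subset_right (s₁ := W))
      (fun j => downWeight_eq_upWeight) fun A B => sum_downWeight_nonneg
    rw [sum_upWeight (not_lt.1 hlt)] at h1
    have h2 : ∑ s ∈ (W ∩ V).powerset with V \ s ∉ D, upWeight c #s =
        ∑ s ∈ (W ∩ V).powerset with V \ s ∉ D,
          ((if c + 1 ≤ #s ∧ #s % 2 = c % 2 then ((#s - c - 1 : ℕ) : ℤ) else 0) -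
            if c + 1 ≤ #s ∧ #s % 2 = (c + 1) % 2 then ((#s - c - 1 : ℕ) : ℤ) else 0) := by
      refine sum_congr rfl fun s _ => ?_
      unfold upWeight
      by_cases hs : c + 1 ≤ #s
      · have hcast : ((#s - c - 1 : ℕ) : ℤ) = #s - c - 1 := by omega
        by_cases hp : #s % 2 = c % 2
        · rw [if_pos hs, if_pos ⟨hs, hp⟩, if_neg (by omega), hcast,
            neg_one_pow_eq_of_mod_eq (show (#s + c) % 2 = 0 % 2 by omega)]
          ring
        · rw [if_pos hs, if_neg (by omega), if_pos (by omega), hcast,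
            neg_one_pow_eq_of_mod_eq (show (#s + c) % 2 = 1 % 2 by omega)]
          ring
      · simp [hs]
    rw [h2, sum_sub_distrib, ← sum_filter, ← sum_filter, ← Nat.cast_sum, ← Nat.cast_sum] at h1
    have h3 : (#(W ∩ V) - 2).choose c ≤ (#W - 2).choose c :=
      Nat.choose_le_choose c (Nat.sub_le_sub_right (card_le_card inter_subset_left) 2)
    omega

theorem coDepthGt_of_sol (h : DeepDownSet V D d) (hV : #V = d + 1 + c)
    (hsol : Sol c (coMissing V D c)) : CoDepthGt V D d := by
  obtain ⟨P, h1, h2, h3⟩ := hsol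
  have hPV : ∀ p ∈ P, p.2 ⊆ V ∧ V \ p.2 ∉ D := fun p hp =>
    (h.face_iff hV (h1 p hp).2.2.1).1 (h1 p hp).2.2.2
  refine ⟨P.image fun p => (V \ p.2, V \ p.1), ?_, ?_, ?_⟩
  · intro p hp
    obtain ⟨p, hp', rfl⟩ := mem_image.1 hp
    obtain ⟨h4, h5, -, -⟩ := h1 p hp'
    refine ⟨sdiff_subset_sdiff subset_rfl h4, sdiff_subset, (hPV p hp').2, ?_⟩
    have := le_card_sdiff p.1 V
    dsimp only
    omega
  · intro p hp q hq hpq s h4 h5 h6 h7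
    obtain ⟨p, hp', rfl⟩ := mem_image.1 hp
    obtain ⟨q, hq', rfl⟩ := mem_image.1 hq
    dsimp only at h4 h5 h6 h7
    have h8 : ∀ p ∈ P, s ⊆ V \ p.1 → p.1 ⊆ V \ s := by
      intro p hp hs x hx
      exact mem_sdiff.2 ⟨(h1 p hp).1.trans (hPV p hp).1 hx, fun hxs => (mem_sdiff.1 (hs hxs)).2 hx⟩
    exact h2 p hp' q hq' (fun e => hpq (by rw [e])) (V \ s) (h8 p hp' h5)
      (sdiff_le_comm.1 h4) (h8 q hq' h7) (sdiff_le_comm.1 h6)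
  · intro s hs hsD hd
    have hc := card_sdiff_of_subset hs
    obtain ⟨p, hp, hp1, hp2⟩ := h3 (V \ s) ((h.face_iff hV (by omega)).2
      ⟨sdiff_subset, by rwa [Finset.sdiff_sdiff_eq_self hs]⟩) (by omega)
    refine ⟨_, mem_image_of_mem _ hp, sdiff_le_comm.1 hp2, ?_⟩
    exact fun x hx => mem_sdiff.2 ⟨hs hx, fun hxp => (mem_sdiff.1 (hp1 hxp)).2 hx⟩

/-- It suffices to solve the families without cores, after relabelling the vertices. -/
theorem coDepthGt_of_forall_good (H : ∀ V D, DeepDownSet V D d → #V = d + 1 + c →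
      ∃ σ : Equiv.Perm (Fin 7), Good c (coMissing (σ • V) (σ • D) c) →
        CoDepthGt (σ • V) (σ • D) d) :
    ∀ V D, DeepDownSet V D d → #V = d + 1 + c → CoDepthGt V D d := by
  suffices ∀ k V D, #(univ \ D : Finset (Finset (Fin 7))) ≤ k → DeepDownSet V D d →
      #V = d + 1 + c → CoDepthGt V D d from fun V D => this _ V D le_rfl
  intro k
  induction k with
  | zero =>
    intro V D hk h
    have : V ∈ univ \ D := mem_sdiff.2 ⟨mem_univ _, h.not_mem⟩
    rw [card_eq_zero.1 (Nat.le_zero.1 hk)] at this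
    exact absurd this (notMem_empty _)
  | succ k ih =>
    intro V D hk h hV
    obtain ⟨σ, hσ⟩ := H V D h hV
    apply CoDepthGt.of_smul (σ := σ)
    replace h := h.smul σ
    replace hV : #(σ • V) = d + 1 + c := by rwa [card_smul_finset]
    replace hk : #(univ \ (σ • D)) ≤ k + 1 := by
      rwa [card_univ_sdiff, card_smul_finset, ← card_univ_sdiff]
    generalize σ • V = V at *
    generalize σ • D = D at *
    by_cases hcore : ∀ X Y : Finset (Fin 7), #X = c → X ⊆ Y → X ≠ Y →
        Face c (coMissing V D c) Y → ¬ ∀ z ∉ X, coMissing V D c (insert z X) = true ↔ z ∈ Y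
    · exact hσ (h.good hV hcore)
    push Not at hcore
    obtain ⟨X, Y, hX, hXY, hne, hF, hz⟩ := hcore
    have hY : c + 1 ≤ #Y := hX ▸ card_lt_card (hXY.ssubset_of_ne hne)
    obtain ⟨hYV, hYD⟩ := (h.face_iff hV hY).1 hF
    have hXV := hXY.trans hYV
    refine h.coDepthGt_of_core (A := V \ Y) (B := V \ X) (sdiff_subset_sdiff subset_rfl hXY)
      ?_ sdiff_subset (by rw [card_sdiff_of_subset hXV]; omega) hYD ?_ ?_
    · intro e
      apply hne
      rw [← Finset.sdiff_sdiff_eq_self hXV, ← e, Finset.sdiff_sdiff_eq_self hYV]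
    · intro z hzB
      rw [mem_sdiff] at hzB
      have h1 := hz z hzB.2
      rw [coMissing_eq_true, card_insert_of_notMem hzB.2, hX] at h1
      rw [mem_sdiff, ← h1, sdiff_insert]
      simp [insert_subset_iff, hzB, hXV]
    · intro D' hDD' h'
      refine ih V D' ?_ h' hV
      have h1 := card_lt_card hDD'
      have h2 := card_le_univ D'
      rw [card_univ_sdiff] at hk ⊢
      omega

end DeepDownSet

end Pointwise

theorem card_mem_erase_choose (A : Finset (Finset (Fin 7))) (v : Fin 7)
    (hA : ∀ t ∈ A, #t = 3) :
    #{t ∈ A | v ∈ t} ≤ (#{a | a ≠ v ∧ ∃ t ∈ A, v ∈ t ∧ a ∈ t}).choose 2 := by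
  rw [← card_powersetCard]
  refine card_le_card_of_injOn (fun t => t.erase v) ?_ ?_
  · intro t ht
    rw [mem_coe, mem_filter] at ht
    rw [mem_coe, mem_powersetCard, card_erase_of_mem ht.2, hA t ht.1]
    refine ⟨fun a ha => ?_, rfl⟩
    rw [mem_erase] at ha
    exact mem_filter.2 ⟨mem_univ _, ha.1, t, ht.1, ht.2, ha.2⟩
  · intro t ht u hu htu
    rw [mem_coe, mem_filter] at ht hu
    rw [← insert_erase ht.2, ← insert_erase hu.2]
    exact congrArg (insert v) htu

theorem sum_card_filter_mem (A : Finset (Finset (Fin 7))) {k : ℕ} (hA : ∀ t ∈ A, #t = k) :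
    ∑ v, #{t ∈ A | v ∈ t} = #A * k := by
  simp_rw [card_filter]
  rw [sum_comm, ← smul_eq_mul, ← sum_const]
  refine sum_congr rfl fun t ht => ?_
  rw [← hA t ht, sum_boole, filter_univ_mem, Nat.cast_id]

/-- Families of triples without a four-element face satisfy Hall's condition for pairs. -/
theorem Good.card_le_card_biUnion_pairs {H : Finset (Fin 7) → Bool} (hH : Good 2 H)
    (h4 : ∀ s, #s = 4 → ¬ Face 2 H s) (A : Finset (Finset (Fin 7)))
    (hA : ∀ t ∈ A, #t = 3 ∧ H t = true) : #A ≤ #(A.biUnion (powersetCard 2)) := by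
  induction A using Finset.strongInduction with
  | H A ih =>
  by_contra! hlt
  set B := A.biUnion (powersetCard 2) with hB
  have mem_B : ∀ p, p ∈ B ↔ ∃ t ∈ A, p ⊆ t ∧ #p = 2 := by
    intro p
    simp only [hB, mem_biUnion, mem_powersetCard]
  have hA3 : ∀ t ∈ A, #t = 3 := fun t ht => (hA t ht).1
  set W := A.biUnion id with hW
  have mem_W : ∀ v, v ∈ W ↔ ∃ t ∈ A, v ∈ t := by
    intro v
    simp only [hW, mem_biUnion, id]
  have hWne : W.Nonempty := by
    obtain ⟨t, ht⟩ : A.Nonempty := card_pos.1 (by omega)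
    obtain ⟨v, hv⟩ : t.Nonempty := card_pos.1 (by rw [hA3 t ht]; omega)
    exact ⟨v, (mem_W v).2 ⟨t, ht, hv⟩⟩
  have hcardA : #A ≤ (#W - 1).choose 2 := by
    refine le_trans (card_le_card ?_) ((hH.card_odd_le W hWne).trans_eq ?_)
    · intro t ht
      refine mem_filter.2 ⟨mem_univ _, fun v hv => (mem_W v).2 ⟨t, ht, hv⟩, ?_, (hA3 t ht).ge,
        by rw [hA3 t ht]⟩
      intro u hu hc
      rw [eq_of_subset_of_card_le hu (by rw [hA3 t ht, hc])]
      exact (hA t ht).2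
    · rw [Nat.add_eq_left, card_eq_zero, filter_eq_empty_iff]
      rintro s - ⟨-, hF, h3, h2⟩
      obtain ⟨u, hu, hu4⟩ := exists_subset_card_eq (show 4 ≤ #s by omega)
      exact h4 u hu4 fun t ht => hF t (ht.trans hu)
  have hdeg : ∀ v ∈ W, #{p ∈ B | v ∈ p} + 1 ≤ #{t ∈ A | v ∈ t} := by
    intro v hv
    obtain ⟨t, ht, hvt⟩ := (mem_W v).1 hv
    have h1 := ih (A.filter (v ∉ ·)) (filter_ssubset.2 ⟨t, ht, not_not.2 hvt⟩)
      fun t ht => hA t (mem_filter.1 ht).1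
    have h2 : (A.filter (v ∉ ·)).biUnion (powersetCard 2) ⊆ B.filter (v ∉ ·) := by
      intro p hp
      obtain ⟨t, ht, hpt⟩ := mem_biUnion.1 hp
      rw [mem_filter] at ht
      rw [mem_powersetCard] at hpt
      exact mem_filter.2 ⟨(mem_B p).2 ⟨t, ht.1, hpt⟩, fun hvp => ht.2 (hpt.1 hvp)⟩
    have h3 := card_le_card h2
    have h5 := card_filter_add_card_filter_not (s := A) (v ∈ ·)
    have h6 := card_filter_add_card_filter_not (s := B) (v ∈ ·)
    omega
  have hchoose : ∀ v, #{t ∈ A | v ∈ t} ≤ (#{p ∈ B | v ∈ p}).choose 2 := by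
    intro v
    refine (card_mem_erase_choose A v hA3).trans (Nat.choose_le_choose 2 ?_)
    refine card_le_card_of_injOn (fun a => {v, a}) ?_ ?_
    · intro a ha
      obtain ⟨-, hav, t, ht, hvt, hat⟩ := mem_filter.1 ha
      exact mem_filter.2 ⟨(mem_B _).2 ⟨t, ht, by simp [insert_subset_iff, hvt, hat],
        card_pair hav.symm⟩, mem_insert_self _ _⟩
    · intro a ha b hb hab
      have hav := (mem_filter.1 ha).2.1
      have h1 : a ∈ ({v, b} : Finset (Fin 7)) :=
        (show ({v, a} : Finset (Fin 7)) = {v, b} from hab) ▸ by simp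
      simpa [hav] using h1
  have hfour : ∀ v ∈ W, 4 ≤ #{p ∈ B | v ∈ p} := by
    intro v hv
    by_contra! hlt4
    have h1 := (hdeg v hv).trans (hchoose v)
    interval_cases #{p ∈ B | v ∈ p} <;> revert h1 <;> decide
  have hsumB := sum_card_filter_mem B (k := 2) fun p hp => by
    obtain ⟨t, -, -, h⟩ := (mem_B p).1 hp
    exact h
  have hsumA := sum_card_filter_mem A hA3
  have h7 : #W ≤ 7 := card_le_univ W
  have hle : #W * 4 ≤ #B * 2 := by
    rw [← hsumB, ← smul_eq_mul, ← sum_const]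
    exact (sum_le_sum hfour).trans (sum_le_sum_of_subset (subset_univ _))
  have hW7 : #W = 7 := by
    by_contra hne
    have h8 : #W < 7 := by omega
    have h9 : ∀ w < 7, (w - 1).choose 2 * 2 < w * 4 + 2 := by decide
    have := h9 _ h8
    omega
  have hWu : W = univ := eq_univ_of_card W hW7
  have hA15 : #A ≤ 15 := by
    rw [hW7] at hcardA
    exact hcardA
  have heq : ∀ v, #{p ∈ B | v ∈ p} = 4 := by
    by_contra! hne
    obtain ⟨v, hv⟩ := hne
    have h8 : ∑ _v : Fin 7, 4 < ∑ v, #{p ∈ B | v ∈ p} :=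
      sum_lt_sum (fun v _ => hfour v (hWu ▸ mem_univ v))
        ⟨v, mem_univ v, lt_of_le_of_ne (hfour v (hWu ▸ mem_univ v)) hv.symm⟩
    rw [hsumB, sum_const, card_univ, Fintype.card_fin, smul_eq_mul] at h8
    omega
  have h9 : #A * 3 ≤ ∑ _v : Fin 7, 6 := by
    rw [← hsumA]
    refine sum_le_sum fun v _ => (hchoose v).trans_eq ?_
    rw [heq]
    rfl
  rw [sum_const, card_univ, Fintype.card_fin, smul_eq_mul] at h9
  omega

theorem Good.exists_pairs {H : Finset (Fin 7) → Bool} (hH : Good 2 H)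
    (h4 : ∀ s, #s = 4 → ¬ Face 2 H s) : ∃ φ : Finset (Fin 7) → Finset (Fin 7),
      (∀ t, #t = 3 → H t = true → φ t ⊆ t ∧ #(φ t) = 2) ∧
      ∀ t u, #t = 3 → H t = true → #u = 3 → H u = true → φ t = φ u → t = u := by
  obtain ⟨f, hf, hf'⟩ := (all_card_le_biUnion_card_iff_exists_injective
    fun t : {t : Finset (Fin 7) // #t = 3 ∧ H t = true} => powersetCard 2 t.1).1 (by
      intro A
      have h1 := hH.card_le_card_biUnion_pairs h4 (A.image Subtype.val) (by
        intro t ht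
        obtain ⟨t, -, rfl⟩ := mem_image.1 ht
        exact t.2)
      rwa [card_image_of_injective _ Subtype.val_injective, image_biUnion] at h1)
  refine ⟨fun t => if h : #t = 3 ∧ H t = true then f ⟨t, h⟩ else t, ?_, ?_⟩
  · intro t h3 ht
    simpa [h3, ht] using mem_powersetCard.1 (hf' ⟨t, h3, ht⟩)
  · intro t u h3 ht h3' hu h
    simp only [h3, ht, h3', hu, and_self, dite_true] at h
    simpa using hf h

theorem DeepDownSet.coDepthGt_of_no_face {V : Finset (Fin 7)} {D : Finset (Finset (Fin 7))}
    {d : ℕ} (h : DeepDownSet V D d) (hV : #V = d + 1 + 2) (hH : Good 2 (coMissing V D 2))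
    (h4 : ∀ s, #s = 4 → ¬ Face 2 (coMissing V D 2) s) : CoDepthGt V D d := by
  obtain ⟨φ, h1, h2⟩ := hH.exists_pairs h4
  have key : ∀ s ⊆ V, s ∉ D → #s = d → #(V \ s) = 3 ∧ coMissing V D 2 (V \ s) = true := by
    intro s hs hsD hd
    have hc := card_sdiff_of_subset hs
    refine ⟨by omega, coMissing_eq_true.2 ⟨by omega, sdiff_subset, ?_⟩⟩
    rwa [Finset.sdiff_sdiff_eq_self hs]
  refine coDepthGt_of_injOn (T := fun s => V \ φ (V \ s)) ?_ ?_ ?_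
  · intro s hs hd
    by_contra hsD
    have hc := card_sdiff_of_subset hs
    have hF := (h.face_iff hV (s := V \ s) (by omega)).2
      ⟨sdiff_subset, by rwa [Finset.sdiff_sdiff_eq_self hs]⟩
    obtain ⟨u, hu, hu4⟩ := exists_subset_card_eq (show 4 ≤ #(V \ s) by omega)
    exact h4 u hu4 fun t ht => hF t (ht.trans hu)
  · intro s hs hsD hd
    obtain ⟨h3, h5⟩ := key s hs hsD hd
    obtain ⟨h6, h7⟩ := h1 _ h3 h5
    refine ⟨?_, sdiff_subset, ?_⟩
    · exact fun x hx => mem_sdiff.2 ⟨hs hx, fun hxp => (mem_sdiff.1 (h6 hxp)).2 hx⟩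
    · rw [card_sdiff_of_subset (h6.trans sdiff_subset)]
      omega
  · intro s hs hsD hd t ht htD htd hst
    obtain ⟨h3, h5⟩ := key s hs hsD hd
    obtain ⟨h3', h5'⟩ := key t ht htD htd
    have h6 := (h1 _ h3 h5).1.trans sdiff_subset
    have h7 := (h1 _ h3' h5').1.trans sdiff_subset
    have h8 := h2 _ _ h3 h5 h3' h5' (by
      rw [← Finset.sdiff_sdiff_eq_self h6, ← Finset.sdiff_sdiff_eq_self h7]
      exact congrArg (V \ ·) hst)
    rw [← Finset.sdiff_sdiff_eq_self hs, h8, Finset.sdiff_sdiff_eq_self ht]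

section Pointwise

open scoped Pointwise

theorem coMissing_inv_smul (σ : Equiv.Perm (Fin 7)) (V : Finset (Fin 7))
    (D : Finset (Finset (Fin 7))) (c : ℕ) :
    coMissing (σ⁻¹ • V) (σ⁻¹ • D) c = fun s => coMissing V D c (σ • s) := by
  ext s
  rw [Bool.eq_iff_iff, coMissing_eq_true, coMissing_eq_true, card_smul_finset,
    smul_finset_subset_iff, ← smul_mem_smul_finset_iff σ, smul_finset_sdiff, smul_inv_smul,
    smul_inv_smul]

theorem face_smul {c : ℕ} {H : Finset (Fin 7) → Bool} {σ : Equiv.Perm (Fin 7)}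
    {s : Finset (Fin 7)} : Face c (fun t => H (σ • t)) s ↔ Face c H (σ • s) := by
  constructor
  · intro h t ht hc
    rw [← smul_inv_smul σ t]
    exact h (σ⁻¹ • t) (by rwa [← subset_smul_finset_iff]) (by rwa [card_smul_finset])
  · intro h t ht hc
    exact h _ (smul_finset_subset_smul_finset ht) (by rwa [card_smul_finset])

theorem degree_smul (c : ℕ) (H : Finset (Fin 7) → Bool) (σ : Equiv.Perm (Fin 7)) (v : Fin 7) :
    degree c (fun t => H (σ • t)) v = degree c H (σ v) := by
  refine card_bij (fun s _ => σ • s) ?_ (fun s _ t _ h => smul_left_cancel σ h) ?_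
  · intro s hs
    simp only [mem_filter, mem_univ, true_and] at hs ⊢
    exact ⟨⟨hs.1.1, smul_mem_smul_finset hs.1.2⟩, by rw [card_smul_finset, hs.2]⟩
  · intro s hs
    simp only [mem_filter, mem_univ, true_and] at hs
    refine ⟨σ⁻¹ • s, ?_, smul_inv_smul σ s⟩
    simp only [mem_filter, mem_univ, true_and, smul_inv_smul, card_smul_finset]
    exact ⟨⟨hs.1.1, mem_inv_smul_finset_iff.2 hs.1.2⟩, hs.2⟩

theorem exists_smul_eq_of_card_eq {s t : Finset (Fin 7)} (h : #s = #t) :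
    ∃ σ : Equiv.Perm (Fin 7), σ • s = t := by
  refine ⟨(equivOfCardEq h).extendSubtype, eq_of_subset_of_card_le ?_
    (by rw [card_smul_finset, h])⟩
  intro x hx
  obtain ⟨y, hy, rfl⟩ := mem_smul_finset.1 hx
  exact (equivOfCardEq h).extendSubtype_mem y hy

theorem sol_one_of_good {H : Finset (Fin 7) → Bool} :
    ∃ σ : Equiv.Perm (Fin 7), Good 1 (fun s => H (σ • s)) → Sol 1 fun s => H (σ • s) := by
  obtain ⟨σ, -, hσ⟩ := exists_max_image univ
    (fun σ : Equiv.Perm (Fin 7) => code edgeMasks fun s => H (σ • s)) univ_nonempty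
  refine ⟨σ, fun hg => certifies_edgeSearch21 _ ⟨hg, fun ρ => ?_⟩ ?_⟩
  · simp only [map_perm_eq_smul, smul_smul]
    exact hσ (σ * ρ) (mem_univ _)
  · rw [clearLow, Nat.div_eq_of_lt (show code edgeMasks _ < 2 ^ 21 from codeOf_lt _ edgeMasks),
      mul_zero]
    exact edgeSearch21_eq_true

theorem le_code_tripleMasks_iff {H : Finset (Fin 7) → Bool} :
    32212254720 ≤ code tripleMasks H ↔ Face 2 H {0, 1, 2, 3} := by
  have h1 : bitset 15 = {0, 1, 2, 3} := by decide
  have h2 : faceCode tripleMasks 15 = 32212254720 := by decide +kernel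
  have h3 : code tripleMasks H < 2 ^ 35 := codeOf_lt _ tripleMasks
  rw [← h1, face_bitset_iff enumerates_tripleMasks, h2]
  constructor
  · intro h
    have h4 : clearLow 31 (code tripleMasks H) = 32212254720 := by
      unfold clearLow
      omega
    rw [← land_clearLow (k := 31) (by norm_num), h4, Nat.and_self]
  · intro h
    rw [← h]
    exact Nat.and_le_left

theorem clearLow_code_tripleMasks {H : Finset (Fin 7) → Bool}
    (h : 32212254720 ≤ code tripleMasks H) : clearLow 31 (code tripleMasks H) = 32212254720 := by
  have h3 : code tripleMasks H < 2 ^ 35 := codeOf_lt _ tripleMasks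
  unfold clearLow
  omega

theorem sol_two_of_good {H : Finset (Fin 7) → Bool} (hH : ∃ s, #s = 4 ∧ Face 2 H s) :
    ∃ σ : Equiv.Perm (Fin 7), Good 2 (fun s => H (σ • s)) → Sol 2 fun s => H (σ • s) := by
  set S : Finset (Equiv.Perm (Fin 7)) :=
    {σ | 32212254720 ≤ code tripleMasks fun s => H (σ • s)} with hS
  have mem_S : ∀ σ, σ ∈ S ↔ 32212254720 ≤ code tripleMasks fun s => H (σ • s) := by simp [hS]
  have mem_S' : ∀ σ, σ ∈ S ↔ Face 2 H (σ • {0, 1, 2, 3}) := by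
    intro σ
    rw [mem_S, le_code_tripleMasks_iff, face_smul]
  have hne : S.Nonempty := by
    obtain ⟨s, hs, hF⟩ := hH
    obtain ⟨σ, rfl⟩ := exists_smul_eq_of_card_eq (s := {0, 1, 2, 3}) hs.symm
    exact ⟨σ, (mem_S' σ).2 hF⟩
  obtain ⟨τ, hτS, hτ⟩ := exists_min_image S (fun σ => degree 2 H (σ 6)) hne
  obtain ⟨σ, hσT, hσ⟩ := exists_max_image {σ ∈ S | degree 2 H (σ 6) = degree 2 H (τ 6)}
    (fun σ => code tripleMasks fun s => H (σ • s)) ⟨τ, mem_filter.2 ⟨hτS, rfl⟩⟩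
  obtain ⟨hσS, hστ⟩ := mem_filter.1 hσT
  have hdeg : ∀ ρ : Equiv.Perm (Fin 7), ρ • ({0, 1, 2, 3} : Finset (Fin 7)) = {0, 1, 2, 3} →
      degree 2 (fun s => H (σ • s)) 6 ≤ degree 2 (fun s => H (σ • s)) (ρ 6) := by
    intro ρ hρ
    rw [degree_smul, degree_smul, hστ]
    exact hτ (σ * ρ) ((mem_S' _).2 (by rw [mul_smul, hρ]; exact (mem_S' σ).1 hσS))
  refine ⟨σ, fun hg => certifies_tripleSearch31 _ ⟨hg,
    hdeg (Equiv.swap 4 6) (by decide), hdeg (Equiv.swap 5 6) (by decide), fun ρ hρ => ?_⟩ ?_⟩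
  · simp only [map_perm_eq_smul, smul_smul]
    by_cases h : σ * ρ ∈ S
    · refine hσ (σ * ρ) (mem_filter.2 ⟨h, ?_⟩)
      rw [Equiv.Perm.mul_apply, hρ, hστ]
    · exact (not_le.1 (mt (mem_S _).2 h)).le.trans ((mem_S σ).1 hσS)
  · rw [clearLow_code_tripleMasks ((mem_S σ).1 hσS)]
    exact tripleSearch31_eq_true

namespace DeepDownSet

variable {V : Finset (Fin 7)} {D : Finset (Finset (Fin 7))} {d : ℕ}

theorem coDepthGt_of_card_eq_add_two (h : DeepDownSet V D d) (hV : #V = d + 1 + 1) :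
    CoDepthGt V D d := by
  refine coDepthGt_of_forall_good (c := 1) (fun V D h hV => ?_) V D h hV
  obtain ⟨σ, hσ⟩ := sol_one_of_good (H := coMissing V D 1)
  rw [← coMissing_inv_smul] at hσ
  exact ⟨σ⁻¹, fun hg => (h.smul σ⁻¹).coDepthGt_of_sol (by rwa [card_smul_finset]) (hσ hg)⟩

theorem coDepthGt_of_card_eq_add_three (h : DeepDownSet V D d) (hV : #V = d + 1 + 2) :
    CoDepthGt V D d := by
  refine coDepthGt_of_forall_good (c := 2) (fun V D h hV => ?_) V D h hV
  by_cases h4 : ∃ s, #s = 4 ∧ Face 2 (coMissing V D 2) s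
  · obtain ⟨σ, hσ⟩ := sol_two_of_good h4
    rw [← coMissing_inv_smul] at hσ
    exact ⟨σ⁻¹, fun hg => (h.smul σ⁻¹).coDepthGt_of_sol (by rwa [card_smul_finset]) (hσ hg)⟩
  · refine ⟨1, ?_⟩
    rw [one_smul, one_smul]
    push Not at h4
    exact fun hg => h.coDepthGt_of_no_face hV hg h4

theorem coDepthGt (h : DeepDownSet V D d) : CoDepthGt V D d := by
  induction V using Finset.strongInduction generalizing D with
  | H V ih =>
  have hlt := h.card_lt
  by_cases hv : ∃ v ∈ V, {v} ∉ D
  · obtain ⟨v, hv, hvD⟩ := hv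
    exact h.coDepthGt_of_singleton hv hvD fun hVD => ih _ (erase_ssubset hv) (h.erase hvD hVD)
  push Not at hv
  have h7 : #V ≤ 7 := card_le_univ V
  obtain hV | hV | hV | hV : #V = d + 1 ∨ #V = d + 1 + 1 ∨ #V = d + 1 + 2 ∨ d + 4 ≤ #V := by omega
  · exact h.coDepthGt_of_card hV
  · exact h.coDepthGt_of_card_eq_add_two hV
  · exact h.coDepthGt_of_card_eq_add_three hV
  by_cases hd : d ≤ 2
  · refine coDepthGt_of_small (by omega) fun s hs hsd => ?_
    obtain h0 | h1 : #s = 0 ∨ #s = 1 := by omega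
    · rw [card_eq_zero.1 h0]
      exact h.empty_mem
    · obtain ⟨v, rfl⟩ := card_eq_one.1 h1
      exact hv v (singleton_subset_iff.1 hs)
  · obtain rfl : d = 3 := by omega
    obtain rfl : V = univ := eq_univ_of_card V (le_antisymm h7 hV)
    exact h.coDepthGt_three fun v => hv v (mem_univ v)

end DeepDownSet

end Pointwise

theorem IntervalPartition.le_card {n : ℕ} {Q : Finset (Finset (Fin n))} {k : ℕ}
    (hQ : Q.Nonempty) (P : IntervalPartition n Q) (hP : ∀ p ∈ P.pairs, k ≤ #p.2) : k ≤ n := by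
  obtain ⟨C, hC⟩ := hQ
  obtain ⟨p, hp, -⟩ := P.covers C hC
  exact (hP p hp).trans ((card_le_univ _).trans_eq (Fintype.card_fin n))

theorem exists_intervalPartition_sdepth {n : ℕ} {Q : Finset (Finset (Fin n))} (hQ : Q.Nonempty) :
    ∃ P : IntervalPartition n Q, ∀ p ∈ P.pairs, sdepth Q ≤ #p.2 := by
  refine Nat.sSup_mem (s := {k | ∃ P : IntervalPartition n Q, ∀ p ∈ P.pairs, k ≤ #p.2}) ?_
    ⟨n, fun k ⟨P, hP⟩ => P.le_card hQ hP⟩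
  refine ⟨0, ⟨Q.image fun s => (s, s), ?_, ?_, ?_, ?_⟩, fun _ _ => Nat.zero_le _⟩
  · intro p hp
    obtain ⟨s, -, rfl⟩ := mem_image.1 hp
    exact subset_rfl
  · intro p hp
    obtain ⟨s, hs, rfl⟩ := mem_image.1 hp
    rw [Icc_self]
    exact singleton_subset_iff.2 hs
  · intro p hp q hq hpq
    obtain ⟨s, -, rfl⟩ := mem_image.1 hp
    obtain ⟨t, -, rfl⟩ := mem_image.1 hq
    rw [Icc_self, Icc_self, disjoint_singleton]
    exact fun e => hpq (Prod.ext e e)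
  · exact fun s hs => ⟨_, mem_image_of_mem _ hs, by simp⟩

theorem IntervalPartition.le_sdepth {n : ℕ} {Q : Finset (Finset (Fin n))} {k : ℕ}
    (hQ : Q.Nonempty) (P : IntervalPartition n Q) (hP : ∀ p ∈ P.pairs, k ≤ #p.2) :
    k ≤ sdepth Q :=
  le_csSup ⟨n, fun _ ⟨P, hP⟩ => P.le_card hQ hP⟩ ⟨P, hP⟩

theorem IntervalPartition.deepDownSet {n : ℕ} {D : Finset (Finset (Fin n))} {d : ℕ}
    (P : IntervalPartition n D) (hP : ∀ p ∈ P.pairs, d ≤ #p.2) (hD : IsDownSet D) (h0 : ∅ ∈ D)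
    (hU : univ ∉ D) (f : Fin n ↪ Fin 7) :
    DeepDownSet (univ.map f) (D.map (mapEmbedding f).toEmbedding) d where
  down := by
    intro s hs t hts
    obtain ⟨s, hs', rfl⟩ := mem_map.1 hs
    obtain ⟨t, ht, rfl⟩ := subset_map_iff.1 hts
    exact mem_map_of_mem (mapEmbedding f).toEmbedding (hD s hs' t ht)
  subset := by
    intro s hs
    obtain ⟨s, hs, rfl⟩ := mem_map.1 hs
    exact map_subset_map.2 (subset_univ s)
  empty_mem := mem_map.2 ⟨∅, h0, map_empty f⟩
  not_mem := by
    rw [show univ.map f = (mapEmbedding f).toEmbedding univ from rfl, mem_map']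
    exact hU
  depth := by
    refine ⟨P.pairs.image fun p => (p.1.map f, p.2.map f), ?_, ?_, ?_⟩
    · intro p hp
      obtain ⟨p, hp', rfl⟩ := mem_image.1 hp
      refine ⟨map_subset_map.2 (P.le p hp'), mem_map_of_mem (mapEmbedding f).toEmbedding
        (P.sub p hp' (mem_Icc.2 ⟨P.le p hp', le_rfl⟩)), ?_⟩
      rw [card_map]
      exact hP p hp'
    · intro p hp q hq hpq s h1 h2 h3 h4
      obtain ⟨p, hp', rfl⟩ := mem_image.1 hp
      obtain ⟨q, hq', rfl⟩ := mem_image.1 hq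
      obtain ⟨s, hs, rfl⟩ := subset_map_iff.1 h2
      exact disjoint_left.1 (P.disj p hp' q hq' fun e => hpq (e ▸ rfl))
        (mem_Icc.2 ⟨map_subset_map.1 h1, map_subset_map.1 h2⟩)
        (mem_Icc.2 ⟨map_subset_map.1 h3, map_subset_map.1 h4⟩)
    · intro s hs
      obtain ⟨s, hs', rfl⟩ := mem_map.1 hs
      obtain ⟨p, hp, hps⟩ := P.covers s hs'
      exact ⟨_, mem_image_of_mem _ hp, map_subset_map.2 (mem_Icc.1 hps).1,
        map_subset_map.2 (mem_Icc.1 hps).2⟩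

theorem CoDepthGt.exists_intervalPartition {n : ℕ} {D : Finset (Finset (Fin n))} {d : ℕ}
    (hD : IsDownSet D) (f : Fin n ↪ Fin 7)
    (h : CoDepthGt (univ.map f) (D.map (mapEmbedding f).toEmbedding) d) :
    ∃ P : IntervalPartition n (univ \ D), ∀ p ∈ P.pairs, d + 1 ≤ #p.2 := by
  classical
  obtain ⟨P, h1, h2, h3⟩ := h
  have mem_iff : ∀ s : Finset (Fin n), s.map f ∈ D.map (mapEmbedding f).toEmbedding ↔ s ∈ D :=
    fun s => mem_map' (mapEmbedding f).toEmbedding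
  set Q : Finset (Finset (Fin n) × Finset (Fin n)) := {p | (p.1.map f, p.2.map f) ∈ P} with hQ
  have mem_Q : ∀ p, p ∈ Q ↔ (p.1.map f, p.2.map f) ∈ P := by simp [hQ]
  set R : Finset (Finset (Fin n)) := {s | s ∉ D ∧ ∀ p ∈ Q, ¬ (p.1 ⊆ s ∧ s ⊆ p.2)} with hR
  have mem_R : ∀ s, s ∈ R ↔ s ∉ D ∧ ∀ p ∈ Q, ¬ (p.1 ⊆ s ∧ s ⊆ p.2) := by simp [hR]
  have hPQ : ∀ p ∈ P, ∃ q ∈ Q, q.1.map f = p.1 ∧ q.2.map f = p.2 := by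
    intro p hp
    obtain ⟨h4, h5, -, -⟩ := h1 p hp
    obtain ⟨a, -, ha⟩ := subset_map_iff.1 (h4.trans h5)
    obtain ⟨b, -, hb⟩ := subset_map_iff.1 h5
    exact ⟨(a, b), (mem_Q _).2 (by rwa [← ha, ← hb]), ha.symm, hb.symm⟩
  have hcase : ∀ p ∈ Q ∪ R.image fun s => (s, s), p ∈ Q ∨ p.2 = p.1 ∧ p.1 ∈ R := by
    intro p hp
    rcases mem_union.1 hp with hp | hp
    · exact Or.inl hp
    · obtain ⟨s, hs, rfl⟩ := mem_image.1 hp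
      exact Or.inr ⟨rfl, hs⟩
  have hmixed : ∀ p ∈ Q, ∀ s ∈ R, ∀ C, p.1 ⊆ C → C ⊆ p.2 → s ⊆ C → C ⊆ s → False := by
    intro p hp s hs C h4 h5 h6 h7
    exact ((mem_R s).1 hs).2 p hp (subset_antisymm h6 h7 ▸ ⟨h4, h5⟩)
  refine ⟨⟨Q ∪ R.image fun s => (s, s), ?_, ?_, ?_, ?_⟩, ?_⟩
  · intro p hp
    rcases hcase p hp with hp | ⟨e, -⟩
    · exact map_subset_map.1 (h1 _ ((mem_Q p).1 hp)).1
    · exact e.ge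
  · intro p hp s hs
    rw [mem_Icc] at hs
    refine mem_sdiff.2 ⟨mem_univ s, fun hsD => ?_⟩
    have hpD := hD s hsD p.1 hs.1
    rcases hcase p hp with hp | ⟨-, hp⟩
    · exact (h1 _ ((mem_Q p).1 hp)).2.2.1 ((mem_iff _).2 hpD)
    · exact ((mem_R _).1 hp).1 hpD
  · intro p hp q hq hpq
    rw [disjoint_left]
    intro s hs hs'
    rw [mem_Icc] at hs hs'
    rcases hcase p hp with hp | ⟨e, hp⟩ <;> rcases hcase q hq with hq | ⟨e', hq⟩
    · refine h2 _ ((mem_Q p).1 hp) _ ((mem_Q q).1 hq) (fun e => hpq ?_) (s.map f)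
        (map_subset_map.2 hs.1) (map_subset_map.2 hs.2) (map_subset_map.2 hs'.1)
        (map_subset_map.2 hs'.2)
      rw [Prod.mk.injEq, map_inj, map_inj] at e
      exact Prod.ext e.1 e.2
    · exact hmixed p hp _ hq s hs.1 hs.2 hs'.1 (e' ▸ hs'.2)
    · exact hmixed q hq _ hp s hs'.1 hs'.2 hs.1 (e ▸ hs.2)
    · rw [e] at hs
      rw [e'] at hs'
      have h4 : p.1 = q.1 := (subset_antisymm hs.1 hs.2).trans (subset_antisymm hs'.2 hs'.1)
      exact hpq (Prod.ext h4 (by rw [e, e', h4]))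
  · intro s hs
    by_cases hsQ : ∃ p ∈ Q, p.1 ⊆ s ∧ s ⊆ p.2
    · obtain ⟨p, hp, hps⟩ := hsQ
      exact ⟨p, mem_union_left _ hp, mem_Icc.2 hps⟩
    · push Not at hsQ
      exact ⟨(s, s), mem_union_right _ (mem_image_of_mem _ ((mem_R s).2 ⟨(mem_sdiff.1 hs).2,
        fun p hp h => hsQ p hp h.1 h.2⟩)), by simp⟩
  · intro p hp
    rcases hcase p hp with hp | ⟨e, hp⟩
    · have h4 := (h1 _ ((mem_Q p).1 hp)).2.2.2
      rwa [card_map] at h4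
    · by_contra! hlt
      obtain ⟨h4, h5⟩ := (mem_R _).1 hp
      rw [e] at hlt
      obtain ⟨q, hq, h6, h7⟩ := h3 (p.1.map f) (map_subset_map.2 (subset_univ _))
        (by rwa [mem_iff]) (by rw [card_map]; omega)
      obtain ⟨r, hr, hr1, hr2⟩ := hPQ q hq
      exact h5 r hr ⟨map_subset_map.1 (hr1.trans_subset h6), map_subset_map.1 (h7.trans hr2.ge)⟩

/-- If `n ≤ 7` is positive and `D ⊆ 2^[n]` is a down set with `∅ ∈ D` and nonempty
complement `U = 2^[n] \ D`, then `sdepth(U) > sdepth(D)`. -/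
theorem sdepth_ideal_gt_quotient_le_seven
    (n : ℕ) (hn1 : 1 ≤ n) (hn7 : n ≤ 7)
    (D : Finset (Finset (Fin n))) (hD : IsDownSet D) (h0 : ∅ ∈ D)
    (hU : ((Finset.univ : Finset (Finset (Fin n))) \ D).Nonempty) :
    sdepth D < sdepth ((Finset.univ : Finset (Finset (Fin n))) \ D) := by
  have hUD : univ ∉ D := by
    obtain ⟨s, hs⟩ := hU
    exact fun h => (mem_sdiff.1 hs).2 (hD univ h s (subset_univ s))
  obtain ⟨P, hP⟩ := exists_intervalPartition_sdepth ⟨∅, h0⟩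
  obtain ⟨Q, hQ⟩ := (P.deepDownSet hP hD h0 hUD
    (Fin.castLEEmb hn7)).coDepthGt.exists_intervalPartition hD
  exact Q.le_sdepth hU hQ
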